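/- Let (L,p) be a Brascamp–Lieb datum with L_j : ℝ^n → ℝ^{n_j} linear surjections and p_j ∈ [0,1] for 1 ≤ j ≤ m. Suppose B_j : ℝ^n → ℝ^{n_j} are C² submersions in a neighbourhood of a point x₀ with dB_j(x₀) = L_j for each j. Then for every ε > 0 there exists a neighbourhood U of x₀ such that for all nonnegative integrable functions f_j on ℝ^{n_j}, ∫_U ∏_{j=1}^m f_j(B_j(x))^{p_j} dx ≤ (1+ε) · BL(L,p) · ∏_{j=1}^m (∫_{ℝ^{n_j}} f_j(x_j) dx_j)^{p_j}. -/

import Mathlib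

open MeasureTheory
open scoped ENNReal

/-- The Brascamp–Lieb constant of the datum `(L, p)`: the smallest constant `C ∈ [0,∞]`
such that `∫ ∏_j f_j(L_j x)^{p_j} dx ≤ C ∏_j (∫ f_j)^{p_j}` for all nonnegative
(measurable) integrands `f_j`. -/
noncomputable def BLconst {m n : ℕ} (nj : Fin m → ℕ)
    (L : ∀ j, (Fin n → ℝ) →L[ℝ] (Fin (nj j) → ℝ)) (p : Fin m → ℝ) : ℝ≥0∞ :=
  sInf {C : ℝ≥0∞ | ∀ f : ∀ j, (Fin (nj j) → ℝ) → ℝ≥0∞,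
    (∀ j, Measurable (f j)) →
    ∫⁻ x, ∏ j, (f j (L j x)) ^ (p j) ≤ C * ∏ j, (∫⁻ xj, f j xj) ^ (p j)}

set_option linter.unusedSectionVars false

namespace NLBL

noncomputable def nsq {k : ℕ} (x : Fin k → ℝ) : ℝ := ∑ i, x i ^ 2

noncomputable def gam {k : ℕ} (x : Fin k → ℝ) : ℝ≥0∞ := ENNReal.ofReal (Real.exp (-Real.pi * nsq x))

lemma nsq_nonneg {k : ℕ} (x : Fin k → ℝ) : 0 ≤ nsq x := Finset.sum_nonneg fun _ _ => sq_nonneg _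

lemma nsq_eq_dot {k : ℕ} (x : Fin k → ℝ) : nsq x = x ⬝ᵥ x := by
  simp [nsq, dotProduct, sq]

@[fun_prop] lemma continuous_nsq {k : ℕ} : Continuous (nsq : (Fin k → ℝ) → ℝ) := by
  unfold nsq; fun_prop

@[fun_prop] lemma continuous_gam {k : ℕ} : Continuous (gam : (Fin k → ℝ) → ℝ≥0∞) := by
  unfold gam; exact ENNReal.continuous_ofReal.comp (by fun_prop)

@[fun_prop] lemma measurable_gam {k : ℕ} : Measurable (gam : (Fin k → ℝ) → ℝ≥0∞) :=
  continuous_gam.measurable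

lemma gam_le_one {k : ℕ} (x : Fin k → ℝ) : gam x ≤ 1 := by
  unfold gam
  rw [← ENNReal.ofReal_one]
  apply ENNReal.ofReal_le_ofReal
  rw [Real.exp_le_one_iff]
  have := nsq_nonneg x
  have := Real.pi_pos
  nlinarith

lemma gam_ne_zero {k : ℕ} (x : Fin k → ℝ) : gam x ≠ 0 := by
  simp [gam, Real.exp_pos]

lemma gam_ne_top {k : ℕ} (x : Fin k → ℝ) : gam x ≠ ∞ := by
  simp [gam]

lemma gam_rpow {k : ℕ} (x : Fin k → ℝ) (p : ℝ) :
    gam x ^ p = ENNReal.ofReal (Real.exp (-Real.pi * (p * nsq x))) := by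
  unfold gam
  rw [ENNReal.ofReal_rpow_of_pos (Real.exp_pos _), ← Real.exp_mul]
  congr 2; ring

lemma prod_gam_rpow {ι : Type*} [Fintype ι] {d : ι → ℕ} (x : ∀ j, Fin (d j) → ℝ) (p : ι → ℝ) :
    ∏ j, gam (x j) ^ p j = ENNReal.ofReal (Real.exp (-Real.pi * ∑ j, p j * nsq (x j))) := by
  simp_rw [gam_rpow]
  rw [← ENNReal.ofReal_prod_of_nonneg (fun _ _ => (Real.exp_pos _).le), ← Real.exp_sum,
    Finset.mul_sum]

lemma integrable_gauss {k : ℕ} :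
    Integrable (fun x : Fin k → ℝ => Real.exp (-Real.pi * nsq x)) := by
  have : (fun x : Fin k → ℝ => Real.exp (-Real.pi * nsq x)) =
      fun x => ∏ i, Real.exp (-Real.pi * x i ^ 2) := by
    ext x; rw [← Real.exp_sum, nsq, Finset.mul_sum]
  rw [this]
  exact Integrable.fintype_prod (f := fun (_ : Fin k) t => Real.exp (-Real.pi * t ^ 2))
    fun i => integrable_exp_neg_mul_sq Real.pi_pos

lemma lintegral_gam {k : ℕ} : ∫⁻ x : Fin k → ℝ, gam x = 1 := by
  unfold gam
  rw [← ofReal_integral_eq_lintegral_ofReal integrable_gauss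
    (Filter.Eventually.of_forall fun _ => (Real.exp_pos _).le)]
  have : (fun x : Fin k → ℝ => Real.exp (-Real.pi * nsq x)) =
      fun x => ∏ i, Real.exp (-Real.pi * x i ^ 2) := by
    ext x; rw [← Real.exp_sum, nsq, Finset.mul_sum]
  rw [this, integral_fintype_prod_volume_eq_prod (fun (_ : Fin k) t => Real.exp (-Real.pi * t ^ 2))]
  simp only [integral_gaussian]
  simp [Real.pi_ne_zero]

lemma lintegral_comp_smul_pi {k : ℕ} (f : (Fin k → ℝ) → ℝ≥0∞) (hf : Measurable f) {c : ℝ} (hc : 0 < c) :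
    ∫⁻ x, f (c • x) = ENNReal.ofReal (c ^ k)⁻¹ * ∫⁻ x, f x := by
  have h := Measure.map_addHaar_smul (volume : Measure (Fin k → ℝ)) hc.ne'
  rw [← lintegral_map (f := f) (g := fun x => c • x) hf (by fun_prop), h, lintegral_smul_measure]
  simp [abs_of_pos hc]

lemma nsq_add {k : ℕ} (x y : Fin k → ℝ) : nsq (x + y) = nsq x + 2 * (x ⬝ᵥ y) + nsq y := by
  simp only [nsq, dotProduct, Pi.add_apply, Finset.mul_sum, ← Finset.sum_add_distrib]
  exact Finset.sum_congr rfl fun i _ => by ring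

lemma nsq_sub {k : ℕ} (x y : Fin k → ℝ) : nsq (x - y) = nsq x - 2 * (x ⬝ᵥ y) + nsq y := by
  simp only [nsq, dotProduct, Pi.sub_apply, Finset.mul_sum, ← Finset.sum_add_distrib,
    ← Finset.sum_sub_distrib]
  exact Finset.sum_congr rfl fun i _ => by ring

lemma nsq_smul {k : ℕ} (c : ℝ) (x : Fin k → ℝ) : nsq (c • x) = c ^ 2 * nsq x := by
  simp [nsq, Finset.mul_sum, mul_pow]

lemma dot_sq_le {k : ℕ} (x y : Fin k → ℝ) : (x ⬝ᵥ y) ^ 2 ≤ nsq x * nsq y :=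
  Finset.sum_mul_sq_le_sq_mul_sq _ _ _

lemma lintegral_gam_mul_exp {k : ℕ} (c : Fin k → ℝ) :
    ∫⁻ x : Fin k → ℝ, gam x * ENNReal.ofReal (Real.exp (2 * Real.pi * (x ⬝ᵥ c))) =
      ENNReal.ofReal (Real.exp (Real.pi * nsq c)) := by
  have : ∀ x : Fin k → ℝ, gam x * ENNReal.ofReal (Real.exp (2 * Real.pi * (x ⬝ᵥ c))) =
      ENNReal.ofReal (Real.exp (Real.pi * nsq c)) * gam (x - c) := by
    intro x
    unfold gam
    rw [← ENNReal.ofReal_mul (Real.exp_pos _).le, ← ENNReal.ofReal_mul (Real.exp_pos _).le,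
      ← Real.exp_add, ← Real.exp_add, nsq_sub]
    congr 2; ring
  simp_rw [this]
  rw [lintegral_const_mul _ (by fun_prop), lintegral_sub_right_eq_self (fun x => gam x) c,
    lintegral_gam, mul_one]

lemma lintegral_gam_mul_exp_abs_lt_top {k : ℕ} (C : ℝ) :
    ∫⁻ x : Fin k → ℝ, gam x * ENNReal.ofReal (Real.exp (C * ∑ i, |x i|)) < ∞ := by
  have key : ∀ x : Fin k → ℝ, gam x * ENNReal.ofReal (Real.exp (C * ∑ i, |x i|)) ≤
      ENNReal.ofReal (Real.exp (k * C ^ 2)) * gam ((1 / 2 : ℝ) • x) := by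
    intro x
    unfold gam
    rw [← ENNReal.ofReal_mul (Real.exp_pos _).le, ← ENNReal.ofReal_mul (Real.exp_pos _).le,
      ← Real.exp_add, ← Real.exp_add, nsq_smul]
    apply ENNReal.ofReal_le_ofReal
    apply Real.exp_le_exp.2
    have h1 : C * ∑ i, |x i| ≤ k * C ^ 2 + nsq x := by
      have : ∀ i ∈ Finset.univ, C * |x i| ≤ C ^ 2 + x i ^ 2 := fun i _ => by
        rw [← sq_abs (x i)]; nlinarith [sq_nonneg (C - |x i|), sq_nonneg (C + |x i|), sq_nonneg C, sq_nonneg (|x i|)]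
      have := Finset.sum_le_sum this
      rw [Finset.sum_add_distrib, ← Finset.mul_sum] at this
      simpa [nsq] using this
    have := Real.pi_gt_three
    have := nsq_nonneg x
    nlinarith
  refine (lintegral_mono key).trans_lt ?_
  rw [lintegral_const_mul _ (by fun_prop),
    lintegral_comp_smul_pi (fun x => gam x) (by fun_prop) (by norm_num), lintegral_gam]
  exact ENNReal.mul_lt_top ENNReal.ofReal_lt_top (by simp)

def GaussBound {ι : Type*} [Fintype ι] {n : ℕ} {d : ι → ℕ} (T : ∀ j, Matrix (Fin (d j)) (Fin n) ℝ)
    (p : ι → ℝ) (S θ c : ℝ) : Prop :=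
  ∀ μ : ∀ j, Measure (Fin (d j) → ℝ), (∀ j, IsFiniteMeasure (μ j)) →
    (∀ j, ∀ᵐ z ∂μ j, ∀ i, |z i| ≤ S) →
    ∫⁻ x, ∏ j, (∫⁻ z, gam ((T j).mulVec x - θ • z) ∂μ j) ^ p j ≤
      ENNReal.ofReal (Real.exp c) * ∏ j, (μ j Set.univ) ^ p j

lemma gam_mul_gam_rotate {k : ℕ} (a b : Fin k → ℝ) :
    gam a * gam b = gam ((√2)⁻¹ • (a + b)) * gam ((√2)⁻¹ • (a - b)) := by
  unfold gam
  rw [← ENNReal.ofReal_mul (Real.exp_pos _).le, ← ENNReal.ofReal_mul (Real.exp_pos _).le,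
    ← Real.exp_add, ← Real.exp_add, nsq_smul, nsq_smul, nsq_add, nsq_sub]
  congr 2
  have : (√2)⁻¹ ^ 2 = (1 / 2 : ℝ) := by
    rw [inv_pow, Real.sq_sqrt (by norm_num)]; norm_num
  rw [this]; ring

lemma lintegral_rotate {n : ℕ} (G : (Fin n → ℝ) → (Fin n → ℝ) → ℝ≥0∞)
    (hG : Measurable (Function.uncurry G)) :
    ∫⁻ x, ∫⁻ y, G x y = ∫⁻ u, ∫⁻ v, G ((√2)⁻¹ • (v + u)) ((√2)⁻¹ • (v - u)) := by
  have h2 : (0 : ℝ) < √2 := by positivity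
  have hc : ∀ (x y : Fin n → ℝ), Measurable fun y => G x y := fun x y => hG.of_uncurry_left
  have e1 : ∀ x, ∫⁻ y, G x y = ENNReal.ofReal ((√2) ^ n) * ∫⁻ v, G x (√2 • v - x) := by
    intro x
    have hm : Measurable fun y => G x (y - x) :=
      hG.comp (f := fun y => (x, y - x)) (by fun_prop)
    rw [lintegral_comp_smul_pi (fun y => G x (y - x)) hm h2, ← mul_assoc, ← ENNReal.ofReal_mul
      (by positivity), mul_inv_cancel₀ (by positivity), ENNReal.ofReal_one, one_mul,
      lintegral_sub_right_eq_self (fun y => G x y) x]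
  simp_rw [e1]
  have hm : Measurable (Function.uncurry fun x v : Fin n → ℝ => G x (√2 • v - x)) :=
    hG.comp (f := fun q : (Fin n → ℝ) × (Fin n → ℝ) => (q.1, √2 • q.2 - q.1)) (by fun_prop)
  rw [lintegral_const_mul _ hm.lintegral_prod_right, lintegral_lintegral_swap hm.aemeasurable]
  have e2 : ∀ v, ∫⁻ x, G x (√2 • v - x) = ENNReal.ofReal ((√2)⁻¹ ^ n) *
      ∫⁻ u, G ((√2)⁻¹ • (v + u)) ((√2)⁻¹ • (v - u)) := by
    intro v
    have hm1 : Measurable fun x => G (x + (√2)⁻¹ • v) (√2 • v - (x + (√2)⁻¹ • v)) :=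
      hG.comp (f := fun x => (x + (√2)⁻¹ • v, √2 • v - (x + (√2)⁻¹ • v))) (by fun_prop)
    rw [← lintegral_add_right_eq_self (fun x => G x (√2 • v - x)) ((√2)⁻¹ • v)]
    have := lintegral_comp_smul_pi _ hm1 (c := (√2)⁻¹) (by positivity)
    have h3 : ∀ u : Fin n → ℝ, √2 • v - ((√2)⁻¹ • u + (√2)⁻¹ • v) = (√2)⁻¹ • (v - u) := by
      intro u
      have h4 : √2 = (√2)⁻¹ * 2 := by
        field_simp; norm_num
      ext i
      simp only [Pi.sub_apply, Pi.smul_apply, Pi.add_apply, smul_eq_mul]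
      linear_combination (v i) * h4
    simp_rw [h3] at this
    have h5 : ∀ u : Fin n → ℝ, (√2)⁻¹ • (v + u) = (√2)⁻¹ • u + (√2)⁻¹ • v := by
      intro u; rw [smul_add, add_comm]
    simp_rw [h5, this]
    rw [← mul_assoc, ← ENNReal.ofReal_mul (by positivity), mul_inv_cancel₀ (by positivity),
      ENNReal.ofReal_one, one_mul]
  simp_rw [e2]
  have hm2 : Measurable (Function.uncurry fun v u : Fin n → ℝ =>
      G ((√2)⁻¹ • (v + u)) ((√2)⁻¹ • (v - u))) :=
    hG.comp (f := fun q : (Fin n → ℝ) × (Fin n → ℝ) =>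
      ((√2)⁻¹ • (q.1 + q.2), (√2)⁻¹ • (q.1 - q.2))) (by fun_prop)
  rw [lintegral_const_mul _ hm2.lintegral_prod_right, lintegral_lintegral_swap hm2.aemeasurable,
    ← mul_assoc, ← ENNReal.ofReal_mul (by positivity), ← mul_pow, mul_inv_cancel₀ h2.ne']
  simp

lemma measurable_smoothed {n k : ℕ} (T : Matrix (Fin k) (Fin n) ℝ) (θ : ℝ)
    (μ : Measure (Fin k → ℝ)) [SFinite μ] :
    Measurable fun x => ∫⁻ z, gam (T.mulVec x - θ • z) ∂μ := by
  apply Measurable.lintegral_prod_right' (f := fun q : (Fin n → ℝ) × (Fin k → ℝ) =>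
    gam (T.mulVec q.1 - θ • q.2))
  apply measurable_gam.comp
  have : Continuous fun q : (Fin n → ℝ) × (Fin k → ℝ) => T.mulVec q.1 - θ • q.2 := by
    fun_prop
  exact this.measurable

lemma GaussBound.double {ι : Type*} [Fintype ι] {n : ℕ} {d : ι → ℕ}
    {T : ∀ j, Matrix (Fin (d j)) (Fin n) ℝ} {p : ι → ℝ} {S θ c : ℝ} (hp : ∀ j, 0 ≤ p j)
    (hT : ∀ x, ∑ j, p j * nsq ((T j).mulVec x) = nsq x)
    (h : GaussBound T p S ((√2)⁻¹ * θ) c) : GaussBound T p S θ (2 * c) := by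
  intro μ hμ hS
  have hF := fun j => measurable_smoothed (T j) θ (μ j)
  have hF' := fun j => measurable_smoothed (T j) ((√2)⁻¹ * θ) (μ j)
  have h1 : ∀ y : Fin n → ℝ, gam y = ∏ j, gam ((T j).mulVec y) ^ p j := by
    intro y; rw [prod_gam_rpow, hT]; rfl
  have hTm : ∀ j, Measurable fun y : Fin n → ℝ => gam ((T j).mulVec y) := fun j =>
    measurable_gam.comp (by fun_prop : Continuous fun y => (T j).mulVec y).measurable
  have e0 : ∀ x, ∏ j, (∫⁻ z, gam ((T j).mulVec x - θ • z) ∂μ j) ^ p j =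
      ∫⁻ y, ∏ j, ((∫⁻ z, gam ((T j).mulVec x - θ • z) ∂μ j) * gam ((T j).mulVec y)) ^ p j := by
    intro x
    simp_rw [ENNReal.mul_rpow_of_nonneg _ _ (hp _), Finset.prod_mul_distrib, ← h1]
    rw [lintegral_const_mul _ measurable_gam, lintegral_gam, mul_one]
  simp_rw [e0]
  rw [lintegral_rotate (fun x y =>
    ∏ j, ((∫⁻ z, gam ((T j).mulVec x - θ • z) ∂μ j) * gam ((T j).mulVec y)) ^ p j)]
  swap
  · apply Finset.measurable_prod _ fun j _ => ?_
    exact (((hF j).comp measurable_fst).mul ((hTm j).comp measurable_snd)).pow_const _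
  have e1 : ∀ u v : Fin n → ℝ, ∀ j,
      (∫⁻ z, gam ((T j).mulVec ((√2)⁻¹ • (v + u)) - θ • z) ∂μ j) *
        gam ((T j).mulVec ((√2)⁻¹ • (v - u))) =
      ∫⁻ z, gam ((T j).mulVec v - ((√2)⁻¹ * θ) • z) ∂((μ j).withDensity
        fun z => gam ((T j).mulVec u - ((√2)⁻¹ * θ) • z)) := by
    intro u v j
    rw [← lintegral_mul_const _ (by fun_prop), lintegral_withDensity_eq_lintegral_mul _
      (by fun_prop) (by fun_prop)]
    congr 1; ext z
    have h4 : (√2)⁻¹ * (√2)⁻¹ * 2 = 1 := by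
      rw [← mul_inv, Real.mul_self_sqrt (by norm_num)]; norm_num
    rw [gam_mul_gam_rotate, Pi.mul_apply, mul_comm]
    congr 2
    · simp only [Matrix.mulVec_smul, Matrix.mulVec_add, Matrix.mulVec_sub]
      ext i
      simp only [Pi.sub_apply, Pi.smul_apply, Pi.add_apply, smul_eq_mul]
      linear_combination ((T j).mulVec u i) * h4
    · simp only [Matrix.mulVec_smul, Matrix.mulVec_add, Matrix.mulVec_sub]
      ext i
      simp only [Pi.sub_apply, Pi.smul_apply, Pi.add_apply, smul_eq_mul]
      linear_combination ((T j).mulVec v i) * h4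
  simp_rw [e1]
  have e2 : ∀ u : Fin n → ℝ, (∫⁻ v, ∏ j, (∫⁻ z, gam ((T j).mulVec v - ((√2)⁻¹ * θ) • z)
      ∂((μ j).withDensity fun z => gam ((T j).mulVec u - ((√2)⁻¹ * θ) • z))) ^ p j) ≤
      ENNReal.ofReal (Real.exp c) * ∏ j,
        (∫⁻ z, gam ((T j).mulVec u - ((√2)⁻¹ * θ) • z) ∂μ j) ^ p j := by
    intro u
    refine (h _ (fun j => ?_) (fun j => ?_)).trans_eq ?_
    · refine isFiniteMeasure_withDensity (ne_of_lt ?_)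
      calc _ ≤ ∫⁻ z, 1 ∂μ j := lintegral_mono fun z => gam_le_one _
        _ < ∞ := by simp
    · exact (withDensity_absolutelyContinuous _ _).ae_le (hS j)
    · simp
  calc _ ≤ _ := lintegral_mono e2
    _ = ENNReal.ofReal (Real.exp c) * ∫⁻ u, ∏ j,
        (∫⁻ z, gam ((T j).mulVec u - ((√2)⁻¹ * θ) • z) ∂μ j) ^ p j := by
      rw [lintegral_const_mul]
      exact Finset.measurable_prod _ fun j _ => (hF' j).pow_const _
    _ ≤ ENNReal.ofReal (Real.exp c) * (ENNReal.ofReal (Real.exp c) *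
        ∏ j, (μ j Set.univ) ^ p j) := by gcongr; exact h μ hμ hS
    _ = _ := by
      rw [← mul_assoc, ← ENNReal.ofReal_mul (Real.exp_pos _).le, ← Real.exp_add, two_mul]

lemma exp_le_quadratic (t : ℝ) : Real.exp t ≤ 1 + t + t ^ 2 * Real.exp |t| := by
  have h1 : Real.exp t - 1 ≤ t * Real.exp t := by
    have h := Real.add_one_le_exp (-t)
    have h2 : Real.exp (-t) * Real.exp t = 1 := by rw [← Real.exp_add]; simp
    nlinarith [Real.exp_pos t]
  rcases le_total 0 t with h | h
  · rw [abs_of_nonneg h]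
    nlinarith
  · have h3 := Real.add_one_le_exp t
    have h4 : 1 ≤ Real.exp |t| := Real.one_le_exp (abs_nonneg t)
    nlinarith [sq_nonneg t, Real.exp_pos t]

lemma integral_exp_bounds {Ω : Type*} [MeasurableSpace Ω] (ν : Measure Ω) [IsProbabilityMeasure ν]
    {Y : Ω → ℝ} (hY : AEStronglyMeasurable Y ν) {B : ℝ} (hB : ∀ᵐ z ∂ν, |Y z| ≤ B) :
    Integrable (fun z => Real.exp (Y z)) ν ∧ 1 + ∫ z, Y z ∂ν ≤ ∫ z, Real.exp (Y z) ∂ν ∧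
      ∫ z, Real.exp (Y z) ∂ν ≤ 1 + ∫ z, Y z ∂ν + B ^ 2 * Real.exp B := by
  have hi : Integrable Y ν := Integrable.of_bound hY B hB
  have he : Integrable (fun z => Real.exp (Y z)) ν := by
    refine Integrable.of_bound (Real.continuous_exp.comp_aestronglyMeasurable hY) (Real.exp B) ?_
    filter_upwards [hB] with z hz
    rw [Real.norm_eq_abs, Real.abs_exp]
    exact Real.exp_le_exp.2 ((le_abs_self _).trans hz)
  refine ⟨he, ?_, ?_⟩
  · have : 1 + ∫ z, Y z ∂ν = ∫ z, (1 + Y z) ∂ν := by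
      rw [integral_add (integrable_const _) hi]; simp
    rw [this]
    exact integral_mono ((integrable_const _).add hi) he fun z => by
      have := Real.add_one_le_exp (Y z); simp only; linarith
  · have : 1 + ∫ z, Y z ∂ν + B ^ 2 * Real.exp B =
        ∫ z, (1 + Y z + B ^ 2 * Real.exp B) ∂ν := by
      have hi2 : Integrable (fun z => 1 + Y z) ν := (integrable_const _).add hi
      rw [integral_add hi2 (integrable_const _), integral_add (integrable_const _) hi]; simp
    rw [this]
    refine integral_mono_ae he (((integrable_const _).add hi).add (integrable_const _)) ?_
    filter_upwards [hB] with z hz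
    have h1 := exp_le_quadratic (Y z)
    have h2 : Y z ^ 2 * Real.exp |Y z| ≤ B ^ 2 * Real.exp B := by
      have : Y z ^ 2 ≤ B ^ 2 := sq_le_sq' (by linarith [neg_abs_le (Y z)]) ((le_abs_self _).trans hz)
      have := Real.exp_le_exp.2 hz
      gcongr
    linarith

lemma abs_prod_one_add_sub_le {ι : Type*} (s : Finset ι) (c : ι → ℝ) {τ : ℝ}
    (hc : ∀ j, |c j| ≤ τ) (hτ : 0 ≤ τ) :
    |∏ j ∈ s, (1 + c j) - 1 - ∑ j ∈ s, c j| ≤ (s.card : ℝ) ^ 2 * τ ^ 2 * (1 + τ) ^ s.card := by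
  classical
  induction s using Finset.induction_on with
  | empty => simp
  | insert a s ha ih =>
    rw [Finset.prod_insert ha, Finset.sum_insert ha, Finset.card_insert_of_notMem ha]
    set P := ∏ j ∈ s, (1 + c j)
    set Q := ∑ j ∈ s, c j with hQ
    have hQ' : |Q| ≤ s.card * τ := by
      refine (Finset.abs_sum_le_sum_abs _ _).trans ?_
      refine (Finset.sum_le_card_nsmul _ _ τ fun j _ => hc j).trans_eq (by simp)
    have h1 : (1 + c a) * P - 1 - (c a + Q) = c a * Q + (1 + c a) * (P - 1 - Q) := by ring
    rw [h1]
    have hca := hc a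
    have h2 : |1 + c a| ≤ 1 + τ := (abs_add_le _ _).trans (by simpa using hca)
    have h3 : (1 : ℝ) ≤ (1 + τ) ^ (s.card + 1) := one_le_pow₀ (by linarith)
    calc _ ≤ |c a| * |Q| + |1 + c a| * |P - 1 - Q| := by
          rw [← abs_mul, ← abs_mul]; exact abs_add_le _ _
      _ ≤ τ * (s.card * τ) + (1 + τ) * ((s.card : ℝ) ^ 2 * τ ^ 2 * (1 + τ) ^ s.card) := by gcongr
      _ = s.card * τ ^ 2 * 1 + (s.card : ℝ) ^ 2 * τ ^ 2 * (1 + τ) ^ (s.card + 1) := by ring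
      _ ≤ s.card * τ ^ 2 * (1 + τ) ^ (s.card + 1) +
          (s.card : ℝ) ^ 2 * τ ^ 2 * (1 + τ) ^ (s.card + 1) := by gcongr
      _ ≤ _ := by
        push_cast
        have : (0 : ℝ) ≤ (s.card + 1) * τ ^ 2 * (1 + τ) ^ (s.card + 1) := by positivity
        nlinarith

/-- the sum of the absolute values of the coordinates -/
noncomputable def lone {k : ℕ} (x : Fin k → ℝ) : ℝ := ∑ i, |x i|

lemma lone_nonneg {k : ℕ} (x : Fin k → ℝ) : 0 ≤ lone x := Finset.sum_nonneg fun _ _ => abs_nonneg _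

lemma nsq_le_lone_sq {k : ℕ} (x : Fin k → ℝ) : nsq x ≤ lone x ^ 2 := by
  have := Finset.sum_sq_le_sq_sum_of_nonneg (s := Finset.univ) (f := fun i => |x i|)
    (fun i _ => abs_nonneg _)
  simpa [nsq, lone] using this

lemma abs_dot_le {k : ℕ} {x y : Fin k → ℝ} {a b : ℝ} (ha : 0 ≤ a) (hb : 0 ≤ b)
    (hx : nsq x ≤ a ^ 2) (hy : nsq y ≤ b ^ 2) : |x ⬝ᵥ y| ≤ a * b := by
  apply abs_le_of_sq_le_sq _ (by positivity)
  refine (dot_sq_le x y).trans ?_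
  rw [mul_pow]
  exact mul_le_mul hx hy (nsq_nonneg _) (by positivity)

lemma nsq_transpose_le {k n : ℕ} {T : Matrix (Fin k) (Fin n) ℝ}
    (hT : ∀ x, nsq (T.mulVec x) ≤ nsq x) (ζ : Fin k → ℝ) : nsq (Matrix.vecMul ζ T) ≤ nsq ζ := by
  set w := Matrix.vecMul ζ T
  have h1 : nsq w = ζ ⬝ᵥ T.mulVec w := by
    rw [nsq_eq_dot, Matrix.dotProduct_mulVec]
  have h2 := dot_sq_le ζ (T.mulVec w)
  rw [← h1] at h2
  have h3 := hT w
  have h4 := nsq_nonneg w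
  have h5 := nsq_nonneg ζ
  by_contra! h
  have h6 : nsq ζ * nsq (T.mulVec w) ≤ nsq ζ * nsq w := by gcongr
  nlinarith

section single
variable {k n : ℕ} (T : Matrix (Fin k) (Fin n) ℝ) (ν : Measure (Fin k → ℝ))
  (b : Fin k → ℝ) (θ : ℝ)

noncomputable def mean (ν : Measure (Fin k → ℝ)) : Fin k → ℝ := fun i => ∫ z, z i ∂ν

noncomputable def tilt (x : Fin n → ℝ) (z : Fin k → ℝ) : ℝ :=
  2 * Real.pi * θ * ((T.mulVec x + θ • b) ⬝ᵥ (z - mean ν)) - Real.pi * θ ^ 2 * nsq (z - mean ν)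

noncomputable def tiltInt (x : Fin n → ℝ) : ℝ := ∫ z, Real.exp (tilt T ν b θ x z) ∂ν

noncomputable def tiltConst (A : ℝ) : ℝ := 12 * Real.pi * A ^ 2 + 4 * Real.pi * A

@[fun_prop] lemma continuous_dot_right (c : Fin k → ℝ) : Continuous fun z : Fin k → ℝ => c ⬝ᵥ z := by
  unfold dotProduct; fun_prop

lemma continuous_tilt (x : Fin n → ℝ) : Continuous (tilt T ν b θ x) := by
  unfold tilt
  have h1 : Continuous fun z : Fin k → ℝ => z - mean ν := by fun_prop
  have := (continuous_dot_right (T.mulVec x + θ • b)).comp h1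
  have := continuous_nsq.comp h1
  fun_prop

variable [IsProbabilityMeasure ν] {S A : ℝ}

lemma abs_mean_le (hS : ∀ᵐ z ∂ν, ∀ i, |z i| ≤ S) (i : Fin k) : |mean ν i| ≤ S := by
  have : ∀ᵐ z ∂ν, ‖z i‖ ≤ S := hS.mono fun z hz => hz i
  have := norm_integral_le_of_norm_le_const this
  simpa [mean] using this

lemma nsq_le_of_abs_le {z : Fin k → ℝ} (hz : ∀ i, |z i| ≤ S) : nsq z ≤ k * S ^ 2 := by
  have : ∀ i ∈ Finset.univ, z i ^ 2 ≤ S ^ 2 := fun i _ => by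
    rw [← sq_abs]; have := hz i; have := abs_nonneg (z i); gcongr
  simpa [nsq] using Finset.sum_le_sum this

lemma nsq_centered_le (hS : ∀ᵐ z ∂ν, ∀ i, |z i| ≤ S) (hA : k * S ^ 2 ≤ A ^ 2) :
    ∀ᵐ z ∂ν, nsq (z - mean ν) ≤ (2 * A) ^ 2 := by
  filter_upwards [hS] with z hz
  have : ∀ i, |(z - mean ν) i| ≤ 2 * S := fun i => by
    have h1 := hz i
    have h2 := abs_mean_le ν hS i
    have := abs_sub (z i) (mean ν i)
    simp only [Pi.sub_apply]; linarith
  have := nsq_le_of_abs_le this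
  nlinarith

lemma integral_dot_centered (hS : ∀ᵐ z ∂ν, ∀ i, |z i| ≤ S) (c : Fin k → ℝ) :
    ∫ z, c ⬝ᵥ (z - mean ν) ∂ν = 0 := by
  have hi : ∀ i, Integrable (fun z : Fin k → ℝ => z i) ν := fun i =>
    Integrable.of_bound (continuous_apply i).aestronglyMeasurable S (hS.mono fun z hz => hz i)
  have hi' : ∀ i, Integrable (fun z : Fin k → ℝ => c i * (z i - mean ν i)) ν := fun i =>
    ((hi i).sub (integrable_const _)).const_mul _
  simp only [dotProduct, Pi.sub_apply]
  rw [integral_finsetSum _ fun i _ => hi' i]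
  apply Finset.sum_eq_zero fun i _ => ?_
  rw [integral_const_mul, integral_sub (hi i) (integrable_const _)]
  simp [mean]

lemma tilt_bound (hA0 : 0 ≤ A) (hθ : 0 ≤ θ) (hθ1 : θ ≤ 1) (hT : ∀ x, nsq (T.mulVec x) ≤ nsq x)
    (hb : nsq b ≤ (2 * A) ^ 2) (x : Fin n → ℝ) (z : Fin k → ℝ)
    (hz : nsq (z - mean ν) ≤ (2 * A) ^ 2) :
    |tilt T ν b θ x z| ≤ θ * (tiltConst A * (1 + lone x)) := by
  unfold tilt
  rw [add_dotProduct, smul_dotProduct, smul_eq_mul]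
  have h1 := abs_dot_le (lone_nonneg x) (by positivity) ((hT x).trans (nsq_le_lone_sq x)) hz
  have h2 := abs_dot_le (by positivity) (by positivity) hb hz
  have h3 := lone_nonneg x
  set u := T.mulVec x ⬝ᵥ (z - mean ν)
  set w := b ⬝ᵥ (z - mean ν)
  set q := nsq (z - mean ν)
  have hq : 0 ≤ q := nsq_nonneg _
  have hpi := Real.pi_pos
  have : |2 * Real.pi * θ * (u + θ * w) - Real.pi * θ ^ 2 * q| ≤
      2 * Real.pi * θ * (|u| + θ * |w|) + Real.pi * θ ^ 2 * q := by
    refine (abs_sub _ _).trans ?_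
    rw [abs_mul, abs_of_nonneg (by positivity : 0 ≤ 2 * Real.pi * θ),
      abs_of_nonneg (by positivity : 0 ≤ Real.pi * θ ^ 2 * q)]
    gcongr
    refine (abs_add_le _ _).trans ?_
    rw [abs_mul, abs_of_nonneg hθ]
  refine this.trans ?_
  calc _ ≤ 2 * Real.pi * θ * (lone x * (2 * A) + 1 * (2 * A * (2 * A))) +
        Real.pi * (θ * 1) * (2 * A) ^ 2 := by rw [sq θ]; gcongr
    _ ≤ _ := by
      unfold tiltConst
      have : 0 ≤ θ * (12 * Real.pi * A ^ 2 * lone x) := by positivity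
      have : 0 ≤ θ * (4 * Real.pi * A) := by positivity
      nlinarith

lemma lintegral_eq_tiltInt (hA0 : 0 ≤ A) (hθ : 0 ≤ θ) (hθ1 : θ ≤ 1)
    (hT : ∀ x, nsq (T.mulVec x) ≤ nsq x) (hb : nsq b ≤ (2 * A) ^ 2)
    (hS : ∀ᵐ z ∂ν, ∀ i, |z i| ≤ S) (hA : k * S ^ 2 ≤ A ^ 2) (x : Fin n → ℝ) :
    ∫⁻ z, gam (T.mulVec x + θ • b + θ • mean ν - θ • z) ∂ν =
      gam (T.mulVec x + θ • b) * ENNReal.ofReal (tiltInt T ν b θ x) := by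
  have hB : ∀ᵐ z ∂ν, |tilt T ν b θ x z| ≤ θ * (tiltConst A * (1 + lone x)) :=
    (nsq_centered_le ν hS hA).mono fun z hz => tilt_bound T ν b θ hA0 hθ hθ1 hT hb x z hz
  have hi := (integral_exp_bounds ν (continuous_tilt T ν b θ x).aestronglyMeasurable hB).1
  unfold tiltInt
  rw [ofReal_integral_eq_lintegral_ofReal hi
    (Filter.Eventually.of_forall fun _ => (Real.exp_pos _).le), ← lintegral_const_mul' _ _ (gam_ne_top _)]
  congr 1; ext z
  unfold gam tilt
  rw [← ENNReal.ofReal_mul (Real.exp_pos _).le, ← Real.exp_add]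
  have : T.mulVec x + θ • b + θ • mean ν - θ • z = (T.mulVec x + θ • b) - θ • (z - mean ν) := by
    rw [smul_sub]; abel
  rw [this, nsq_sub, nsq_smul, dotProduct_smul, smul_eq_mul]
  congr 2; ring

lemma tiltInt_bound (hA0 : 0 ≤ A) (hθ : 0 ≤ θ) (hθ1 : θ ≤ 1)
    (hT : ∀ x, nsq (T.mulVec x) ≤ nsq x) (hb : nsq b ≤ (2 * A) ^ 2)
    (hS : ∀ᵐ z ∂ν, ∀ i, |z i| ≤ S) (hA : k * S ^ 2 ≤ A ^ 2) (x : Fin n → ℝ) :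
    |tiltInt T ν b θ x - 1| ≤ θ ^ 2 * ((1 + tiltConst A + 2 * tiltConst A ^ 2) *
      Real.exp ((tiltConst A + 1) * (1 + lone x))) := by
  have hc := nsq_centered_le ν hS hA
  have hB : ∀ᵐ z ∂ν, |tilt T ν b θ x z| ≤ θ * (tiltConst A * (1 + lone x)) :=
    hc.mono fun z hz => tilt_bound T ν b θ hA0 hθ hθ1 hT hb x z hz
  obtain ⟨_, h1, h2⟩ := integral_exp_bounds ν (continuous_tilt T ν b θ x).aestronglyMeasurable hB
  have hpi := Real.pi_pos
  have hl := lone_nonneg x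
  have hcq : Continuous fun z : Fin k → ℝ => nsq (z - mean ν) := by fun_prop
  have hiq : Integrable (fun z => nsq (z - mean ν)) ν :=
    Integrable.of_bound hcq.aestronglyMeasurable _ (hc.mono fun z hz => by
      rwa [Real.norm_eq_abs, abs_of_nonneg (nsq_nonneg _)])
  have hid : Integrable (fun z => (T.mulVec x + θ • b) ⬝ᵥ (z - mean ν)) ν := by
    set y := T.mulVec x + θ • b
    refine Integrable.of_bound ?_ (lone y * (2 * A)) (hc.mono fun z hz => ?_)
    · exact ((continuous_dot_right y).comp
        (by fun_prop : Continuous fun z : Fin k → ℝ => z - mean ν)).aestronglyMeasurable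
    · exact abs_dot_le (lone_nonneg _) (by positivity) (nsq_le_lone_sq _) hz
  have h3 : ∫ z, tilt T ν b θ x z ∂ν = -(Real.pi * θ ^ 2 * ∫ z, nsq (z - mean ν) ∂ν) := by
    unfold tilt
    rw [integral_sub (hid.const_mul _) (hiq.const_mul _), integral_const_mul, integral_const_mul,
      integral_dot_centered ν hS]
    ring
  have h4 : 0 ≤ ∫ z, nsq (z - mean ν) ∂ν := integral_nonneg fun z => nsq_nonneg _
  have h5 : ∫ z, nsq (z - mean ν) ∂ν ≤ (2 * A) ^ 2 := by
    calc _ ≤ ∫ z, (2 * A) ^ 2 ∂ν := integral_mono_ae hiq (integrable_const _) hc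
      _ = _ := by simp
  have hD : 0 ≤ tiltConst A := by unfold tiltConst; positivity
  have hD4 : 4 * Real.pi * A ^ 2 ≤ tiltConst A := by
    unfold tiltConst
    have : 0 ≤ Real.pi * A ^ 2 := by positivity
    have : 0 ≤ Real.pi * A := by positivity
    linarith
  rw [h3] at h1 h2
  change 1 + _ ≤ tiltInt T ν b θ x at h1
  change tiltInt T ν b θ x ≤ _ at h2
  set D := tiltConst A
  set s := 1 + lone x with hs
  have hs1 : 1 ≤ s := by linarith
  have hE : 1 ≤ Real.exp ((D + 1) * s) := Real.one_le_exp (by positivity)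
  have h6 : s ^ 2 ≤ 2 * Real.exp s := by
    have := Real.quadratic_le_exp_of_nonneg (by linarith : 0 ≤ s); nlinarith
  rw [abs_le]
  constructor
  · have : Real.pi * θ ^ 2 * ∫ z, nsq (z - mean ν) ∂ν ≤ θ ^ 2 * D := by
      calc _ ≤ Real.pi * θ ^ 2 * (2 * A) ^ 2 := by gcongr
        _ = θ ^ 2 * (4 * Real.pi * A ^ 2) := by ring
        _ ≤ _ := by gcongr
    have : θ ^ 2 * D ≤ θ ^ 2 * ((1 + D + 2 * D ^ 2) * Real.exp ((D + 1) * s)) := by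
      gcongr
      nlinarith [sq_nonneg D]
    linarith
  · have h7 : (θ * (D * s)) ^ 2 * Real.exp (θ * (D * s)) ≤
        θ ^ 2 * ((1 + D + 2 * D ^ 2) * Real.exp ((D + 1) * s)) := by
      calc _ ≤ (θ * (D * s)) ^ 2 * Real.exp (1 * (D * s)) := by gcongr
        _ = θ ^ 2 * (D ^ 2 * s ^ 2 * Real.exp (D * s)) := by rw [one_mul]; ring
        _ ≤ θ ^ 2 * (D ^ 2 * (2 * Real.exp s) * Real.exp (D * s)) := by gcongr
        _ = θ ^ 2 * (2 * D ^ 2 * Real.exp ((D + 1) * s)) := by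
          rw [add_mul, Real.exp_add (D * s), one_mul]; ring
        _ ≤ _ := by gcongr; linarith
    have : 0 ≤ Real.pi * θ ^ 2 * ∫ z, nsq (z - mean ν) ∂ν := by positivity
    linarith

lemma lintegral_gam_tiltInt (hA0 : 0 ≤ A) (hθ : 0 ≤ θ) (hθ1 : θ ≤ 1)
    (hT : ∀ x, nsq (T.mulVec x) ≤ nsq x) (hb : nsq b ≤ (2 * A) ^ 2)
    (hS : ∀ᵐ z ∂ν, ∀ i, |z i| ≤ S) (hA : k * S ^ 2 ≤ A ^ 2) :
    ∫⁻ x, gam x * ENNReal.ofReal (tiltInt T ν b θ x) ≤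
      ENNReal.ofReal (1 + θ ^ 4 * ((8 * Real.pi * A ^ 2) ^ 2 * Real.exp (8 * Real.pi * A ^ 2))) := by
  have hc := nsq_centered_le ν hS hA
  have hpi := Real.pi_pos
  have e1 : ∀ x, gam x * ENNReal.ofReal (tiltInt T ν b θ x) =
      ∫⁻ z, gam x * ENNReal.ofReal (Real.exp (tilt T ν b θ x z)) ∂ν := by
    intro x
    have hB : ∀ᵐ z ∂ν, |tilt T ν b θ x z| ≤ θ * (tiltConst A * (1 + lone x)) :=
      hc.mono fun z hz => tilt_bound T ν b θ hA0 hθ hθ1 hT hb x z hz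
    have hi := (integral_exp_bounds ν (continuous_tilt T ν b θ x).aestronglyMeasurable hB).1
    unfold tiltInt
    rw [ofReal_integral_eq_lintegral_ofReal hi
      (Filter.Eventually.of_forall fun _ => (Real.exp_pos _).le),
      ← lintegral_const_mul' _ _ (gam_ne_top _)]
  simp_rw [e1]
  have hct : Continuous (Function.uncurry fun x z => tilt T ν b θ x z) := by
    unfold tilt Function.uncurry dotProduct
    have : Continuous fun q : (Fin n → ℝ) × (Fin k → ℝ) => T.mulVec q.1 + θ • b := by fun_prop
    have h1 : Continuous fun q : (Fin n → ℝ) × (Fin k → ℝ) => nsq (q.2 - mean ν) := by fun_prop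
    have h2 : ∀ i, Continuous fun q : (Fin n → ℝ) × (Fin k → ℝ) => (T.mulVec q.1 + θ • b) i :=
      fun i => (continuous_apply i).comp this
    simp only [Pi.sub_apply]
    fun_prop
  rw [lintegral_lintegral_swap]
  swap
  · apply Measurable.aemeasurable
    exact (measurable_gam.comp measurable_fst).mul
      (ENNReal.measurable_ofReal.comp (Real.continuous_exp.comp hct).measurable)
  have e2 : ∀ z, ∫⁻ x, gam x * ENNReal.ofReal (Real.exp (tilt T ν b θ x z)) ≤
      ENNReal.ofReal (Real.exp (2 * Real.pi * θ ^ 2 * (b ⬝ᵥ (z - mean ν)))) := by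
    intro z
    set ζ := z - mean ν with hζ
    have : ∀ x, gam x * ENNReal.ofReal (Real.exp (tilt T ν b θ x z)) =
      ENNReal.ofReal (Real.exp (2 * Real.pi * θ ^ 2 * (b ⬝ᵥ ζ) - Real.pi * θ ^ 2 * nsq ζ)) *
        (gam x * ENNReal.ofReal (Real.exp (2 * Real.pi * (x ⬝ᵥ Matrix.vecMul (θ • ζ) T)))) := by
      intro x
      rw [mul_left_comm, ← ENNReal.ofReal_mul (Real.exp_pos _).le, ← Real.exp_add]
      unfold tilt
      rw [← hζ, add_dotProduct, smul_dotProduct, dotProduct_comm x, ← Matrix.dotProduct_mulVec,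
        smul_dotProduct, dotProduct_comm ζ]
      simp only [smul_eq_mul]
      congr 3; ring
    simp_rw [this]
    rw [lintegral_const_mul', lintegral_gam_mul_exp, ← ENNReal.ofReal_mul (Real.exp_pos _).le,
      ← Real.exp_add]
    · apply ENNReal.ofReal_le_ofReal
      apply Real.exp_le_exp.2
      have := nsq_transpose_le hT (θ • ζ)
      rw [nsq_smul] at this
      nlinarith
    · simp
  refine (lintegral_mono e2).trans ?_
  have hY : Continuous fun z : Fin k → ℝ => 2 * Real.pi * θ ^ 2 * (b ⬝ᵥ (z - mean ν)) :=
    continuous_const.mul ((continuous_dot_right b).comp (by fun_prop))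
  have hB : ∀ᵐ z ∂ν, |2 * Real.pi * θ ^ 2 * (b ⬝ᵥ (z - mean ν))| ≤ θ ^ 2 * (8 * Real.pi * A ^ 2) := by
    filter_upwards [hc] with z hz
    have h2 := abs_dot_le (by positivity) (by positivity) hb hz
    rw [abs_mul, abs_of_nonneg (by positivity : 0 ≤ 2 * Real.pi * θ ^ 2)]
    calc _ ≤ 2 * Real.pi * θ ^ 2 * (2 * A * (2 * A)) := by gcongr
      _ = _ := by ring
  obtain ⟨hi, -, h⟩ := integral_exp_bounds ν hY.aestronglyMeasurable hB
  rw [← ofReal_integral_eq_lintegral_ofReal hi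
      (Filter.Eventually.of_forall fun _ => (Real.exp_pos _).le)]
  apply ENNReal.ofReal_le_ofReal
  refine h.trans ?_
  rw [integral_const_mul, integral_dot_centered ν hS]
  have h1 : θ ^ 2 * (8 * Real.pi * A ^ 2) ≤ 1 * (8 * Real.pi * A ^ 2) := by
    gcongr; exact pow_le_one₀ hθ hθ1
  have h2 := Real.exp_le_exp.2 h1
  rw [one_mul] at h2
  calc _ = 1 + θ ^ 4 * ((8 * Real.pi * A ^ 2) ^ 2 * Real.exp (θ ^ 2 * (8 * Real.pi * A ^ 2))) := by ring
    _ ≤ _ := by gcongr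

end single

section geom
variable {ι : Type*} [Fintype ι] {n : ℕ} {d : ι → ℕ}
  {T : ∀ j, Matrix (Fin (d j)) (Fin n) ℝ} {p : ι → ℝ}

lemma sum_nsq_sub (hT : ∀ x, ∑ j, p j * nsq ((T j).mulVec x) = nsq x)
    (w : ∀ j, Fin (d j) → ℝ) (x : Fin n → ℝ) :
    ∑ j, p j * nsq ((T j).mulVec x - w j) = nsq (x - ∑ j, p j • Matrix.vecMul (w j) (T j)) +
      (∑ j, p j * nsq (w j) - nsq (∑ j, p j • Matrix.vecMul (w j) (T j))) := by
  have h1 : x ⬝ᵥ (∑ j, p j • Matrix.vecMul (w j) (T j)) = ∑ j, p j * ((T j).mulVec x ⬝ᵥ w j) := by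
    rw [dotProduct_sum]
    refine Finset.sum_congr rfl fun j _ => ?_
    rw [dotProduct_smul, smul_eq_mul, dotProduct_comm x, ← Matrix.dotProduct_mulVec,
      dotProduct_comm]
  rw [nsq_sub, h1, ← hT x]
  simp_rw [nsq_sub, mul_add, mul_sub, Finset.sum_add_distrib, Finset.sum_sub_distrib,
    Finset.mul_sum]
  have : ∑ j, p j * (2 * ((T j).mulVec x ⬝ᵥ w j)) = ∑ j, 2 * (p j * ((T j).mulVec x ⬝ᵥ w j)) :=
    Finset.sum_congr rfl fun j _ => by ring
  rw [this]; ring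

lemma nsq_barycenter_le (hp : ∀ j, 0 ≤ p j)
    (hT : ∀ x, ∑ j, p j * nsq ((T j).mulVec x) = nsq x) (w : ∀ j, Fin (d j) → ℝ) :
    nsq (∑ j, p j • Matrix.vecMul (w j) (T j)) ≤ ∑ j, p j * nsq (w j) := by
  have := sum_nsq_sub hT w (∑ j, p j • Matrix.vecMul (w j) (T j))
  rw [sub_self] at this
  have h0 : nsq (0 : Fin n → ℝ) = 0 := by simp [nsq]
  have h1 : 0 ≤ ∑ j, p j * nsq ((T j).mulVec (∑ j, p j • Matrix.vecMul (w j) (T j)) - w j) :=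
    Finset.sum_nonneg fun j _ => mul_nonneg (hp j) (nsq_nonneg _)
  linarith

lemma prod_rpow_expansion {ι : Type*} [Fintype ι] {p e : ι → ℝ} (hp : ∀ j, 0 ≤ p j)
    (hp1 : ∀ j, p j ≤ 1) (he : ∀ j, 0 ≤ e j) {t β : ℝ} (ht : 0 ≤ t) (ht1 : t ≤ 1)
    (hβ : 1 ≤ β) (h : ∀ j, |e j - 1| ≤ t * β) :
    ∏ j, e j ^ p j + ∑ j, p j ≤ 1 + ∑ j, p j * e j +
      t ^ 2 * ((Fintype.card ι : ℝ) ^ 2 * 2 ^ Fintype.card ι * β ^ (Fintype.card ι + 2)) := by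
  have h1 : ∏ j, e j ^ p j ≤ ∏ j, (1 + p j * (e j - 1)) := by
    refine Finset.prod_le_prod (fun j _ => Real.rpow_nonneg (he j) _) fun j _ => ?_
    have := rpow_one_add_le_one_add_mul_self (s := e j - 1) (by linarith [he j]) (hp j) (hp1 j)
    rwa [add_sub_cancel] at this
  have h2 := abs_prod_one_add_sub_le Finset.univ (fun j => p j * (e j - 1)) (τ := t * β)
    (fun j => by
      rw [abs_mul, abs_of_nonneg (hp j)]
      calc _ ≤ 1 * (t * β) := mul_le_mul (hp1 j) (h j) (abs_nonneg _) zero_le_one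
        _ = _ := one_mul _) (by positivity)
  have h3 := (abs_le.1 h2).2
  have h4 : ∑ j, p j * (e j - 1) = ∑ j, p j * e j - ∑ j, p j := by
    simp_rw [mul_sub, mul_one, Finset.sum_sub_distrib]
  rw [h4] at h3
  have h5 : (1 + t * β) ≤ 2 * β := by nlinarith
  have h6 : ((Finset.univ : Finset ι).card : ℝ) ^ 2 * (t * β) ^ 2 * (1 + t * β) ^ (Finset.univ : Finset ι).card ≤
      t ^ 2 * ((Fintype.card ι : ℝ) ^ 2 * 2 ^ Fintype.card ι * β ^ (Fintype.card ι + 2)) := by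
    rw [Finset.card_univ]
    calc _ ≤ (Fintype.card ι : ℝ) ^ 2 * (t * β) ^ 2 * (2 * β) ^ Fintype.card ι := by gcongr
      _ = _ := by rw [mul_pow, mul_pow, pow_add]; ring
  linarith

theorem gaussBound_small (hp : ∀ j, 0 < p j) (hp1 : ∀ j, p j ≤ 1)
    (hT : ∀ x, ∑ j, p j * nsq ((T j).mulVec x) = nsq x)
    (hT1 : ∀ j x, nsq ((T j).mulVec x) ≤ nsq x) {S : ℝ} (hS0 : 0 ≤ S) :
    ∃ K, ∀ θ, 0 ≤ θ → θ ≤ 1 → GaussBound T p S θ (K * θ ^ 4) := by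
  classical
  set A := √(∑ j, (d j : ℝ)) * S with hA
  have hA0 : 0 ≤ A := by positivity
  have hA2 : A ^ 2 = (∑ j, (d j : ℝ)) * S ^ 2 := by
    rw [hA, mul_pow, Real.sq_sqrt (by positivity)]
  have hdA : ∀ j, d j * S ^ 2 ≤ A ^ 2 := fun j => by
    rw [hA2]
    gcongr
    exact Finset.single_le_sum (f := fun j => (d j : ℝ)) (fun _ _ => by positivity) (Finset.mem_univ j)
  set D := tiltConst A
  have hD : 0 ≤ D := by have := Real.pi_pos; simp only [D, tiltConst]; positivity
  set m := Fintype.card ι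
  set E := 1 + D + 2 * D ^ 2
  have hE : 1 ≤ E := by simp only [E]; nlinarith [sq_nonneg D]
  set G : (Fin n → ℝ) → ℝ := fun x => (m : ℝ) ^ 2 * 2 ^ m *
    (E * Real.exp ((D + 1) * (1 + lone x))) ^ (m + 2) with hG
  have hG0 : ∀ x, 0 ≤ G x := fun x => by simp only [hG]; positivity
  have hGc : Continuous G := by simp only [hG, lone]; fun_prop
  set J := ∫⁻ x, gam x * ENNReal.ofReal (G x) with hJ
  have hJt : J ≠ ∞ := by
    have : ∀ x, gam x * ENNReal.ofReal (G x) =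
        ENNReal.ofReal ((m : ℝ) ^ 2 * 2 ^ m * (E * Real.exp (D + 1)) ^ (m + 2)) *
        (gam x * ENNReal.ofReal (Real.exp (((m + 2 : ℕ) * (D + 1)) * ∑ i, |x i|))) := by
      intro x
      rw [mul_left_comm, ← ENNReal.ofReal_mul (by positivity)]
      congr 2
      simp only [hG]
      rw [mul_assoc ((m + 2 : ℕ) : ℝ), Real.exp_nat_mul, mul_assoc _ _ (Real.exp _ ^ (m + 2)), ← mul_pow,
        mul_assoc E, ← Real.exp_add]
      congr 4
      rw [lone]; ring
    simp_rw [hJ, this]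
    rw [lintegral_const_mul' _ _ ENNReal.ofReal_ne_top]
    exact (ENNReal.mul_lt_top ENNReal.ofReal_lt_top (lintegral_gam_mul_exp_abs_lt_top _)).ne
  set c3 := (8 * Real.pi * A ^ 2) ^ 2 * Real.exp (8 * Real.pi * A ^ 2)
  have hc3 : 0 ≤ c3 := by positivity
  set P := ∑ j, p j with hP
  have hP0 : 0 ≤ P := Finset.sum_nonneg fun j _ => (hp j).le
  refine ⟨P * c3 + J.toReal, fun θ hθ hθ1 => ?_⟩
  have hθ2 : θ ^ 2 ≤ 1 := pow_le_one₀ hθ hθ1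
  have main : ∀ ν : ∀ j, Measure (Fin (d j) → ℝ), (∀ j, IsProbabilityMeasure (ν j)) →
      (∀ j, ∀ᵐ z ∂ν j, ∀ i, |z i| ≤ S) →
      ∫⁻ x, ∏ j, (∫⁻ z, gam ((T j).mulVec x - θ • z) ∂ν j) ^ p j ≤
      ENNReal.ofReal (Real.exp ((P * c3 + J.toReal) * θ ^ 4)) := by
    intro ν hν hS
    set v := ∑ j, p j • Matrix.vecMul (mean (ν j)) (T j) with hv
    set b : ∀ j, Fin (d j) → ℝ := fun j => (T j).mulVec v - mean (ν j) with hb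
    have hm : ∀ j, nsq (mean (ν j)) ≤ d j * S ^ 2 := fun j =>
      nsq_le_of_abs_le (fun i => abs_mean_le (ν j) (hS j) i)
    have hv1 : nsq v ≤ A ^ 2 := by
      refine (nsq_barycenter_le (fun j => (hp j).le) hT _).trans ?_
      rw [hA2, Finset.sum_mul]
      refine Finset.sum_le_sum fun j _ => ?_
      calc _ ≤ 1 * nsq (mean (ν j)) := by gcongr; exacts [nsq_nonneg _, hp1 j]
        _ ≤ _ := by rw [one_mul]; exact hm j
    have hbA : ∀ j, nsq (b j) ≤ (2 * A) ^ 2 := by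
      intro j
      have h1 : nsq (b j) ≤ 2 * nsq ((T j).mulVec v) + 2 * nsq (mean (ν j)) := by
        have h2 := nsq_sub ((T j).mulVec v) (mean (ν j))
        have h3 := nsq_add ((T j).mulVec v) (mean (ν j))
        have h4 := nsq_nonneg ((T j).mulVec v + mean (ν j))
        simp only [hb]; linarith
      have h2 := hT1 j v
      have h3 := hm j
      have h4 := hdA j
      nlinarith
    set e : ι → (Fin n → ℝ) → ℝ := fun j x => tiltInt (T j) (ν j) (b j) θ x
    have he0 : ∀ j x, 0 ≤ e j x := fun j x => integral_nonneg fun _ => (Real.exp_pos _).le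
    have he1 : ∀ j x, |e j x - 1| ≤ θ ^ 2 * (E * Real.exp ((D + 1) * (1 + lone x))) := fun j x =>
      tiltInt_bound (T j) (ν j) (b j) θ hA0 hθ hθ1 (hT1 j) (hbA j) (hS j) (hdA j) x
    have hem : ∀ j, Measurable fun x => gam x * ENNReal.ofReal (e j x) := by
      intro j
      have h1 : ∀ x, gam x * ENNReal.ofReal (e j x) = gam x * ((gam ((T j).mulVec x + θ • b j))⁻¹ *
          ∫⁻ z, gam ((T j).mulVec x + θ • b j + θ • mean (ν j) - θ • z) ∂(ν j)) := by
        intro x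
        rw [lintegral_eq_tiltInt (T j) (ν j) (b j) θ hA0 hθ hθ1 (hT1 j) (hbA j) (hS j) (hdA j) x,
          ← mul_assoc (gam _)⁻¹, ENNReal.inv_mul_cancel (gam_ne_zero _) (gam_ne_top _), one_mul]
      simp_rw [h1]
      have h2 : Measurable fun x => (T j).mulVec x + θ • b j :=
        (by fun_prop : Continuous fun x => (T j).mulVec x + θ • b j).measurable
      have h3 : Measurable fun q : (Fin n → ℝ) × (Fin (d j) → ℝ) =>
          (T j).mulVec q.1 + θ • b j + θ • mean (ν j) - θ • q.2 :=
        (by fun_prop : Continuous fun q : (Fin n → ℝ) × (Fin (d j) → ℝ) =>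
          (T j).mulVec q.1 + θ • b j + θ • mean (ν j) - θ • q.2).measurable
      exact measurable_gam.mul ((measurable_gam.comp h2).inv.mul
        (measurable_gam.comp h3).lintegral_prod_right')
    have hpt : ∀ x, ∏ j, (∫⁻ z, gam ((T j).mulVec (x + θ • v) - θ • z) ∂ν j) ^ p j ≤
        gam x * ENNReal.ofReal (∏ j, e j x ^ p j) := by
      intro x
      have h1 : ∀ j, ∫⁻ z, gam ((T j).mulVec (x + θ • v) - θ • z) ∂ν j =
          gam ((T j).mulVec x + θ • b j) * ENNReal.ofReal (e j x) := by
        intro j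
        rw [← lintegral_eq_tiltInt (T j) (ν j) (b j) θ hA0 hθ hθ1 (hT1 j) (hbA j) (hS j) (hdA j) x]
        congr 1; ext z
        congr 1
        simp only [hb, Matrix.mulVec_add, Matrix.mulVec_smul, smul_sub]
        abel
      simp_rw [h1, ENNReal.mul_rpow_of_nonneg _ _ (hp _).le, Finset.prod_mul_distrib]
      rw [ENNReal.ofReal_prod_of_nonneg (fun j _ => Real.rpow_nonneg (he0 j x) _)]
      simp_rw [ENNReal.ofReal_rpow_of_nonneg (he0 _ x) (hp _).le]
      gcongr
      rw [prod_gam_rpow]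
      apply ENNReal.ofReal_le_ofReal
      apply Real.exp_le_exp.2
      have h2 := sum_nsq_sub hT (fun j => θ • mean (ν j)) (x + θ • v)
      have h3 := nsq_barycenter_le (fun j => (hp j).le) hT (fun j => θ • mean (ν j))
      have h4 : ∑ j, p j • Matrix.vecMul (θ • mean (ν j)) (T j) = θ • v := by
        rw [hv, Finset.smul_sum]
        refine Finset.sum_congr rfl fun j _ => ?_
        rw [Matrix.smul_vecMul, smul_comm]
      simp only [h4, add_sub_cancel_right] at h2 h3
      have h5 : ∀ j, (T j).mulVec (x + θ • v) - θ • mean (ν j) = (T j).mulVec x + θ • b j := by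
        intro j
        simp only [hb, Matrix.mulVec_add, Matrix.mulVec_smul, smul_sub]
        abel
      simp_rw [h5] at h2
      have := Real.pi_pos
      nlinarith
    have hpt2 : ∀ x, gam x * ENNReal.ofReal (∏ j, e j x ^ p j) + gam x * ENNReal.ofReal P ≤
        gam x + ∑ j, ENNReal.ofReal (p j) * (gam x * ENNReal.ofReal (e j x)) +
          ENNReal.ofReal (θ ^ 4) * (gam x * ENNReal.ofReal (G x)) := by
      intro x
      have h1 := prod_rpow_expansion (fun j => (hp j).le) hp1 (fun j => he0 j x)
        (sq_nonneg θ) hθ2 (β := E * Real.exp ((D + 1) * (1 + lone x)))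
        (by
          have := Real.one_le_exp (x := (D + 1) * (1 + lone x))
            (by have := lone_nonneg x; positivity)
          nlinarith) (fun j => he1 j x)
      have h2 := ENNReal.ofReal_le_ofReal h1
      rw [ENNReal.ofReal_add (Finset.prod_nonneg fun j _ => Real.rpow_nonneg (he0 j x) _) hP0,
        ENNReal.ofReal_add (by
          have : 0 ≤ ∑ j, p j * e j x := Finset.sum_nonneg fun j _ => mul_nonneg (hp j).le (he0 j x)
          linarith) (mul_nonneg (by positivity) (hG0 x)),
        ENNReal.ofReal_add zero_le_one (Finset.sum_nonneg fun j _ => mul_nonneg (hp j).le (he0 j x)),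
        ENNReal.ofReal_sum_of_nonneg (fun j _ => mul_nonneg (hp j).le (he0 j x)),
        ENNReal.ofReal_mul (by positivity), ENNReal.ofReal_one, ← pow_mul] at h2
      simp_rw [ENNReal.ofReal_mul (hp _).le] at h2
      rw [← mul_add]
      refine (mul_le_mul_of_nonneg_left h2 zero_le).trans_eq ?_
      rw [mul_add, mul_add, mul_one, Finset.mul_sum]
      congr 1
      · congr 1
        exact Finset.sum_congr rfl fun j _ => by rw [mul_left_comm]
      · rw [mul_left_comm]
    have h1 : ∫⁻ x, ∏ j, (∫⁻ z, gam ((T j).mulVec x - θ • z) ∂ν j) ^ p j ≤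
        ∫⁻ x, gam x * ENNReal.ofReal (∏ j, e j x ^ p j) := by
      rw [← lintegral_add_right_eq_self _ (θ • v)]
      exact lintegral_mono hpt
    set I := ∫⁻ x, gam x * ENNReal.ofReal (∏ j, e j x ^ p j)
    have h2 : I + ENNReal.ofReal P ≤ 1 + (∑ j, ENNReal.ofReal (p j) *
        ENNReal.ofReal (1 + θ ^ 4 * c3)) + ENNReal.ofReal (θ ^ 4) * J := by
      calc I + ENNReal.ofReal P = ∫⁻ x, (gam x * ENNReal.ofReal (∏ j, e j x ^ p j) +
            gam x * ENNReal.ofReal P) := by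
            rw [lintegral_add_right _ (by fun_prop), lintegral_mul_const _ (by fun_prop),
              lintegral_gam, one_mul]
        _ ≤ _ := lintegral_mono hpt2
        _ = 1 + (∑ j, ENNReal.ofReal (p j) * (∫⁻ x, gam x * ENNReal.ofReal (e j x))) +
            ENNReal.ofReal (θ ^ 4) * J := by
          have hJm : Measurable fun x => ENNReal.ofReal (θ ^ 4) * (gam x * ENNReal.ofReal (G x)) :=
            (measurable_gam.mul (ENNReal.measurable_ofReal.comp hGc.measurable)).const_mul _
          rw [lintegral_add_right _ hJm, lintegral_add_left measurable_gam, lintegral_gam,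
            lintegral_finsetSum _ fun j _ => (hem j).const_mul _,
            lintegral_const_mul' _ _ ENNReal.ofReal_ne_top]
          congr 2
          exact Finset.sum_congr rfl fun j _ => lintegral_const_mul' _ _ ENNReal.ofReal_ne_top
        _ ≤ _ := by
          gcongr with j
          exact lintegral_gam_tiltInt (T j) (ν j) (b j) θ hA0 hθ hθ1 (hT1 j) (hbA j) (hS j) (hdA j)
    have h3 : 1 + (∑ j, ENNReal.ofReal (p j) * ENNReal.ofReal (1 + θ ^ 4 * c3)) +
        ENNReal.ofReal (θ ^ 4) * J =
        ENNReal.ofReal (1 + (P * c3 + J.toReal) * θ ^ 4) + ENNReal.ofReal P := by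
      rw [← ENNReal.ofReal_toReal hJt, ← ENNReal.ofReal_mul (by positivity), ← Finset.sum_mul,
        ← ENNReal.ofReal_sum_of_nonneg (fun j _ => (hp j).le), ← hP, ← ENNReal.ofReal_mul hP0,
        ← ENNReal.ofReal_one, ← ENNReal.ofReal_add zero_le_one (by positivity),
        ← ENNReal.ofReal_add (by positivity) (by positivity),
        ← ENNReal.ofReal_add (by positivity) (by positivity),
        ENNReal.toReal_ofReal (by positivity)]
      congr 1; ring
    rw [h3] at h2
    have h4 : I ≤ ENNReal.ofReal (1 + (P * c3 + J.toReal) * θ ^ 4) :=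
      ENNReal.le_of_add_le_add_right ENNReal.ofReal_ne_top h2
    refine h1.trans (h4.trans (ENNReal.ofReal_le_ofReal ?_))
    have := Real.add_one_le_exp ((P * c3 + J.toReal) * θ ^ 4)
    linarith
  intro μ hμ hS
  by_cases hz : ∃ j, μ j Set.univ = 0
  · obtain ⟨j, hj⟩ := hz
    have hj' : μ j = 0 := Measure.measure_univ_eq_zero.1 hj
    have : ∀ x, ∏ j, (∫⁻ z, gam ((T j).mulVec x - θ • z) ∂μ j) ^ p j = 0 := fun x => by
      apply Finset.prod_eq_zero (Finset.mem_univ j)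
      rw [hj', lintegral_zero_measure, ENNReal.zero_rpow_of_pos (hp j)]
    simp [this]
  push Not at hz
  have hfin : ∀ j, μ j Set.univ ≠ ∞ := fun j => measure_ne_top _ _
  have hν : ∀ j, IsProbabilityMeasure ((μ j Set.univ)⁻¹ • μ j) := fun j =>
    ⟨by simp [ENNReal.inv_mul_cancel (hz j) (hfin j)]⟩
  have := main _ hν (fun j => (Measure.ae_smul_measure (hS j) _))
  have e1 : ∀ j x, (∫⁻ z, gam ((T j).mulVec x - θ • z) ∂μ j) ^ p j =
      (μ j Set.univ) ^ p j *
      (∫⁻ z, gam ((T j).mulVec x - θ • z) ∂((μ j Set.univ)⁻¹ • μ j)) ^ p j := by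
    intro j x
    rw [← ENNReal.mul_rpow_of_nonneg _ _ (hp j).le, lintegral_smul_measure, smul_eq_mul, ← mul_assoc,
      ENNReal.mul_inv_cancel (hz j) (hfin j), one_mul]
  simp_rw [e1, Finset.prod_mul_distrib]
  rw [lintegral_const_mul' _ _ (ENNReal.prod_ne_top fun j _ =>
    ENNReal.rpow_ne_top_of_nonneg (hp j).le (hfin j)), mul_comm]
  gcongr

theorem geometric_brascampLieb (hp : ∀ j, 0 < p j) (hp1 : ∀ j, p j ≤ 1)
    (hT : ∀ x, ∑ j, p j * nsq ((T j).mulVec x) = nsq x)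
    (hT1 : ∀ j x, nsq ((T j).mulVec x) ≤ nsq x) {S : ℝ} (hS0 : 0 ≤ S)
    (μ : ∀ j, Measure (Fin (d j) → ℝ)) (hμ : ∀ j, IsFiniteMeasure (μ j))
    (hS : ∀ j, ∀ᵐ z ∂μ j, ∀ i, |z i| ≤ S) :
    ∫⁻ x, ∏ j, (∫⁻ z, gam ((T j).mulVec x - z) ∂μ j) ^ p j ≤ ∏ j, (μ j Set.univ) ^ p j := by
  obtain ⟨K, hK⟩ := gaussBound_small hp hp1 hT hT1 hS0
  have h2 : (0 : ℝ) < √2 := by positivity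
  have h2' : (1 : ℝ) ≤ √2 := Real.one_le_sqrt.2 (by norm_num)
  have h4 : ((√2)⁻¹) ^ 4 = (1 / 4 : ℝ) := by
    rw [inv_pow, show (4 : ℕ) = 2 * 2 from rfl, pow_mul, Real.sq_sqrt (by norm_num)]; norm_num
  have key : ∀ k : ℕ, ∀ θ, 0 ≤ θ → θ ≤ 1 → GaussBound T p S θ (K * θ ^ 4 * (1 / 2) ^ k) := by
    intro k
    induction k with
    | zero => intro θ h0 h1; simpa using hK θ h0 h1
    | succ k ih =>
      intro θ h0 h1
      have := (ih ((√2)⁻¹ * θ) (by positivity)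
        (mul_le_one₀ (inv_le_one_of_one_le₀ h2') h0 h1)).double (fun j => (hp j).le) hT
      convert this using 1
      rw [mul_pow, h4, pow_succ]; ring
  have hlim : Filter.Tendsto (fun k : ℕ => ENNReal.ofReal (Real.exp (K * 1 ^ 4 * (1 / 2) ^ k)) *
      ∏ j, (μ j Set.univ) ^ p j) Filter.atTop (nhds (1 * ∏ j, (μ j Set.univ) ^ p j)) := by
    apply ENNReal.Tendsto.mul_const
    · rw [← ENNReal.ofReal_one, ← Real.exp_zero]
      apply ENNReal.tendsto_ofReal
      apply (Real.continuous_exp.tendsto _).comp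
      have := (tendsto_pow_atTop_nhds_zero_of_lt_one (r := (1 / 2 : ℝ)) (by norm_num)
        (by norm_num)).const_mul (K * 1 ^ 4)
      simpa using this
    · left; simp
  rw [one_mul] at hlim
  refine ge_of_tendsto' hlim fun k => ?_
  have := key k 1 zero_le_one le_rfl μ hμ hS
  simpa using this

end geom

lemma lintegral_comp_mulVec {k : ℕ} (f : (Fin k → ℝ) → ℝ≥0∞) (hf : Measurable f)
    (Y : Matrix (Fin k) (Fin k) ℝ) (hY : Y.det ≠ 0) :
    ∫⁻ x, f (Y.mulVec x) = ENNReal.ofReal |Y.det|⁻¹ * ∫⁻ x, f x := by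
  have h := Real.map_matrix_volume_pi_eq_smul_volume_pi hY
  have hm : Measurable (Matrix.toLin' Y) :=
    (by fun_prop : Continuous fun x => Y.mulVec x).measurable
  have h2 := lintegral_map (μ := volume) hf hm
  rw [h, lintegral_smul_measure] at h2
  simp only [Matrix.toLin'_apply] at h2
  rw [← h2, abs_inv, smul_eq_mul]

lemma gam_fin_one_interval {R y : ℝ} (hy : |y| ≤ R - 1) :
    ENNReal.ofReal (2 * Real.exp (-Real.pi)) ≤
      ∫⁻ z, gam ((fun _ : Fin 1 => y) - z) ∂(volume.restrict {z : Fin 1 → ℝ | ∀ i, |z i| ≤ R}) := by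
  set B : Set (Fin 1 → ℝ) := Set.Icc (fun _ => y - 1) (fun _ => y + 1) with hB
  have hBs : B ⊆ {z : Fin 1 → ℝ | ∀ i, |z i| ≤ R} := by
    intro z hz i
    have h1 := hz.1 i
    have h2 := hz.2 i
    simp only at h1 h2
    rw [abs_le] at hy ⊢
    constructor <;> linarith
  have hv : volume B = ENNReal.ofReal 2 := by
    rw [hB, Real.volume_Icc_pi]
    simp only [Finset.univ_unique, Finset.prod_singleton]
    congr 1; ring
  calc _ = ∫⁻ z in B, ENNReal.ofReal (Real.exp (-Real.pi)) := by
        rw [setLIntegral_const, hv, ← ENNReal.ofReal_mul (Real.exp_pos _).le, mul_comm]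
    _ ≤ ∫⁻ z in B, gam ((fun _ : Fin 1 => y) - z) := by
        refine setLIntegral_mono' measurableSet_Icc fun z hz => ?_
        apply ENNReal.ofReal_le_ofReal
        apply Real.exp_le_exp.2
        have h1 := hz.1 default
        have h2 := hz.2 default
        simp only at h1 h2
        have : nsq ((fun _ : Fin 1 => y) - z) ≤ 1 := by
          simp only [nsq, Finset.univ_unique, Finset.sum_singleton, Pi.sub_apply]
          have : |y - z default| ≤ 1 := by
            rw [abs_le]; constructor <;> linarith
          rw [← sq_abs]; exact pow_le_one₀ (abs_nonneg _) this
        have := Real.pi_pos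
        nlinarith
    _ ≤ _ := lintegral_mono_set hBs

theorem geometric_brascampLieb_local {ι : Type*} [Fintype ι] {n : ℕ} {d : ι → ℕ}
    {T : ∀ j, Matrix (Fin (d j)) (Fin n) ℝ} {p : ι → ℝ} (hp : ∀ j, 0 < p j) (hp1 : ∀ j, p j ≤ 1)
    {q : ℝ} (hq : 0 < q) (hq1 : q ≤ 1)
    (hT : ∀ x, ∑ j, p j * nsq ((T j).mulVec x) = (1 - q) * nsq x)
    (hT1 : ∀ j x, nsq ((T j).mulVec x) ≤ nsq x) {S : ℝ}
    (μ : ∀ j, Measure (Fin (d j) → ℝ)) (hμ : ∀ j, IsFiniteMeasure (μ j))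
    (hS : ∀ j, ∀ᵐ z ∂μ j, ∀ i, |z i| ≤ S) {R : ℝ} (hR : 1 ≤ R) :
    ∫⁻ x in {x : Fin n → ℝ | ∀ i, |x i| ≤ R - 1},
      ∏ j, (∫⁻ z, gam ((T j).mulVec x - z) ∂μ j) ^ p j ≤
        ENNReal.ofReal (Real.exp (n * q * (Real.pi + Real.log R))) * ∏ j, (μ j Set.univ) ^ p j := by
  classical
  let d' : ι ⊕ Fin n → ℕ := Sum.elim d (fun _ => 1)
  let p' : ι ⊕ Fin n → ℝ := Sum.elim p (fun _ => q)
  let T' : ∀ j, Matrix (Fin (d' j)) (Fin n) ℝ := fun j =>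
    Sum.rec (motive := fun j => Matrix (Fin (d' j)) (Fin n) ℝ) T
      (fun i => (Matrix.of fun (_ : Fin 1) k => if k = i then (1 : ℝ) else 0)) j
  let μ' : ∀ j, Measure (Fin (d' j) → ℝ) := fun j =>
    Sum.rec (motive := fun j => Measure (Fin (d' j) → ℝ)) μ
      (fun _ => (volume.restrict {z : Fin 1 → ℝ | ∀ i, |z i| ≤ R})) j
  have hTr : ∀ (i : Fin n) (x : Fin n → ℝ), (T' (Sum.inr i)).mulVec x = fun _ => x i := by
    intro i x
    ext a
    change (Matrix.of fun (_ : Fin 1) k => if k = i then (1 : ℝ) else 0).mulVec x a = x i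
    change ∑ k, (if k = i then (1 : ℝ) else 0) * x k = x i
    simp
  have hset : {z : Fin 1 → ℝ | ∀ i, |z i| ≤ R} = Set.Icc (fun _ => -R) (fun _ => R) := by
    ext z
    simp [abs_le, Set.mem_Icc, Pi.le_def]
  have hvol : volume {z : Fin 1 → ℝ | ∀ i, |z i| ≤ R} = ENNReal.ofReal (2 * R) := by
    rw [hset, Real.volume_Icc_pi]
    simp only [Finset.univ_unique, Finset.prod_singleton]
    congr 1; ring
  have hgeo := geometric_brascampLieb (T := T') (p := p') (S := max S R)
    (by rintro (j | j); exacts [hp j, hq]) (by rintro (j | j); exacts [hp1 j, hq1])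
    (by
      intro x
      rw [Fintype.sum_sum_type]
      have h1 : ∑ i : Fin n, p' (Sum.inr i) * nsq ((T' (Sum.inr i)).mulVec x) = q * nsq x := by
        simp_rw [hTr]
        have : ∀ i : Fin n, nsq (k := d' (Sum.inr i)) (fun _ => x i) = x i ^ 2 := by
          intro i
          change nsq (k := 1) (fun _ => x i) = _
          simp [nsq]
        simp_rw [this, nsq, Finset.mul_sum]
        rfl
      rw [h1]
      have := hT x
      change ∑ j, p j * nsq ((T j).mulVec x) + _ = _
      rw [this]; ring)
    (by
      rintro (j | i) x
      · exact hT1 j x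
      · rw [hTr]
        change nsq (k := 1) (fun _ => x i) ≤ _
        simp only [nsq, Finset.univ_unique, Finset.sum_const, Finset.card_singleton, one_smul]
        exact Finset.single_le_sum (f := fun i => x i ^ 2) (fun _ _ => sq_nonneg _) (Finset.mem_univ i))
    (by positivity) μ'
    (by
      rintro (j | j)
      · exact hμ j
      · refine ⟨?_⟩
        change (volume.restrict {z : Fin 1 → ℝ | ∀ i, |z i| ≤ R}) Set.univ < ∞
        rw [Measure.restrict_apply_univ, hvol]
        exact ENNReal.ofReal_lt_top)
    (by
      rintro (j | j)
      · exact (hS j).mono fun z hz i => (hz i).trans (le_max_left _ _)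
      · change ∀ᵐ z ∂(volume.restrict {z : Fin 1 → ℝ | ∀ i, |z i| ≤ R}), ∀ i, |z i| ≤ max S R
        rw [ae_restrict_iff' (by rw [hset]; exact measurableSet_Icc)]
        exact Filter.Eventually.of_forall fun z hz i => (hz i).trans (le_max_right _ _))
  rw [Fintype.prod_sum_type] at hgeo
  have hmass : ∏ i : Fin n, (μ' (Sum.inr i) Set.univ) ^ p' (Sum.inr i) =
      ENNReal.ofReal ((2 * R) ^ (n * q)) := by
    have : ∀ i : Fin n, (μ' (Sum.inr i) Set.univ) ^ p' (Sum.inr i) = ENNReal.ofReal (2 * R) ^ q := by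
      intro i
      change (volume.restrict {z : Fin 1 → ℝ | ∀ i, |z i| ≤ R}) Set.univ ^ q = _
      rw [Measure.restrict_apply_univ, hvol]
    simp_rw [this]
    rw [Finset.prod_const, Finset.card_univ, Fintype.card_fin, ← ENNReal.rpow_natCast,
      ← ENNReal.rpow_mul, ENNReal.ofReal_rpow_of_pos (by linarith), mul_comm q]
  rw [hmass] at hgeo
  set c := ENNReal.ofReal ((2 * Real.exp (-Real.pi)) ^ (n * q)) with hc
  have hc0 : c ≠ 0 := by
    rw [hc]; simp only [ne_eq, ENNReal.ofReal_eq_zero, not_le]; positivity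
  have hlow : c * ∫⁻ x in {x : Fin n → ℝ | ∀ i, |x i| ≤ R - 1},
      ∏ j, (∫⁻ z, gam ((T j).mulVec x - z) ∂μ j) ^ p j ≤
      ∫⁻ x, ∏ j, (∫⁻ z, gam ((T' j).mulVec x - z) ∂μ' j) ^ p' j := by
    rw [← lintegral_const_mul' _ _ ENNReal.ofReal_ne_top]
    refine le_trans ?_ (setLIntegral_le_lintegral {x : Fin n → ℝ | ∀ i, |x i| ≤ R - 1} _)
    have hms : MeasurableSet {x : Fin n → ℝ | ∀ i, |x i| ≤ R - 1} := by
      simp only [Set.ofPred_forall]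
      exact MeasurableSet.iInter fun i =>
        measurableSet_le (measurable_pi_apply i).abs measurable_const
    refine setLIntegral_mono' hms fun x hx => ?_
    rw [Fintype.prod_sum_type, mul_comm]
    refine mul_le_mul' le_rfl ?_
    have : ∀ i : Fin n, ENNReal.ofReal (2 * Real.exp (-Real.pi)) ^ q ≤
        (∫⁻ z, gam ((T' (Sum.inr i)).mulVec x - z) ∂μ' (Sum.inr i)) ^ p' (Sum.inr i) := by
      intro i
      rw [hTr]
      exact ENNReal.rpow_le_rpow (gam_fin_one_interval (hx i)) hq.le
    refine le_trans (le_of_eq ?_) (Finset.prod_le_prod' fun i _ => this i)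
    rw [Finset.prod_const, Finset.card_univ, Fintype.card_fin, ← ENNReal.rpow_natCast,
      ← ENNReal.rpow_mul, ENNReal.ofReal_rpow_of_pos (by positivity), mul_comm q]
  have h1 := hlow.trans hgeo
  have hR0 : 0 < R := by linarith
  have hexp : ENNReal.ofReal (Real.exp (n * q * (Real.pi + Real.log R))) =
      c⁻¹ * ENNReal.ofReal ((2 * R) ^ (n * q)) := by
    rw [hc, ← ENNReal.ofReal_inv_of_pos (by positivity), ← ENNReal.ofReal_mul (by positivity)]
    congr 1
    rw [← Real.inv_rpow (by positivity), ← Real.mul_rpow (by positivity) (by positivity),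
      mul_comm (n * q : ℝ), Real.exp_mul, Real.exp_add, Real.exp_log hR0]
    congr 1
    rw [Real.exp_neg]; field_simp
  rw [hexp, mul_assoc, mul_comm (ENNReal.ofReal _)]
  calc _ = c⁻¹ * (c * ∫⁻ x in {x : Fin n → ℝ | ∀ i, |x i| ≤ R - 1},
      ∏ j, (∫⁻ z, gam ((T j).mulVec x - z) ∂μ j) ^ p j) := by
        rw [← mul_assoc, ENNReal.inv_mul_cancel hc0 ENNReal.ofReal_ne_top, one_mul]
    _ ≤ _ := mul_le_mul' le_rfl h1

/-- The linear inequality for Gaussian-smoothed measures at a nearly critical Gaussian datum. -/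
theorem nearCritical_bound {ι : Type*} [Fintype ι] {n : ℕ} {d : ι → ℕ}
    {L : ∀ j, Matrix (Fin (d j)) (Fin n) ℝ} {V : ∀ j, Matrix (Fin (d j)) (Fin (d j)) ℝ} {p : ι → ℝ}
    (hp : ∀ j, 0 < p j) (hp1 : ∀ j, p j ≤ 1) {X : Matrix (Fin n) (Fin n) ℝ} (hX : X.det ≠ 0)
    (hVX : ∀ x, ∑ j, p j * nsq ((V j).mulVec ((L j).mulVec x)) = nsq (X.mulVec x))
    {η : ℝ} (hη : 0 < η) (hη1 : η ≤ 1)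
    (hV : ∀ j x, nsq ((V j).mulVec ((L j).mulVec x)) ≤ (1 + η) * nsq (X.mulVec x)) {S : ℝ}
    (μ : ∀ j, Measure (Fin (d j) → ℝ)) (hμ : ∀ j, IsFiniteMeasure (μ j))
    (hS : ∀ j, ∀ᵐ z ∂μ j, ∀ i, |z i| ≤ S) {P : ℝ} (hP : 0 ≤ P) :
    ∫⁻ x in {x : Fin n → ℝ | ∀ i, |X.mulVec x i| ≤ P},
      ∏ j, (∫⁻ v, gam ((V j).mulVec ((L j).mulVec x - v)) ∂μ j) ^ p j ≤
        ENNReal.ofReal (|X.det|⁻¹ * Real.exp (n * η * (Real.pi + Real.log (2 * P + 1)))) *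
          ∏ j, (μ j Set.univ) ^ p j := by
  classical
  set s := √(1 + η) with hs
  have hs2 : s ^ 2 = 1 + η := Real.sq_sqrt (by linarith)
  have hs1 : 1 ≤ s := Real.one_le_sqrt.2 (by linarith)
  have hs3 : s ≤ 2 := by
    rw [hs, Real.sqrt_le_left (by norm_num)]; linarith
  have hu : IsUnit X.det := hX.isUnit
  set T : ∀ j, Matrix (Fin (d j)) (Fin n) ℝ := fun j => s⁻¹ • (V j * L j * X⁻¹) with hTd
  have hTX : ∀ j x, (T j).mulVec (s • X.mulVec x) = (V j).mulVec ((L j).mulVec x) := by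
    intro j x
    simp only [hTd]
    rw [Matrix.smul_mulVec, Matrix.mulVec_smul, smul_smul, inv_mul_cancel₀ (by positivity), one_smul,
      Matrix.mulVec_mulVec, Matrix.mul_assoc, Matrix.nonsing_inv_mul _ hu, Matrix.mul_one,
      Matrix.mulVec_mulVec]
  have hsurj : ∀ y : Fin n → ℝ, ∃ x, y = s • X.mulVec x := by
    intro y
    refine ⟨s⁻¹ • X⁻¹.mulVec y, ?_⟩
    rw [Matrix.mulVec_smul, smul_smul, mul_inv_cancel₀ (by positivity), one_smul,
      Matrix.mulVec_mulVec, Matrix.mul_nonsing_inv _ hu, Matrix.one_mulVec]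
  have hq : 1 - η / (1 + η) = (s ^ 2)⁻¹ := by rw [hs2]; field_simp; ring
  have hVc : ∀ j, Continuous fun v => (V j).mulVec v := fun j => by fun_prop
  set C := (∑ j, ∑ i, ∑ k, |V j i k|) * |S| with hC

  have key := geometric_brascampLieb_local (T := T) (S := C) hp hp1 (q := η / (1 + η)) (by positivity)
    (by rw [div_le_one (by linarith)]; linarith)
    (by
      intro y
      obtain ⟨x, rfl⟩ := hsurj y
      simp_rw [hTX, hVX, nsq_smul]
      rw [hq]; field_simp)
    (by
      intro j y
      obtain ⟨x, rfl⟩ := hsurj y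
      rw [hTX, nsq_smul, hs2]
      exact hV j x)
    (fun j => (μ j).map (V j).mulVec) (fun j => inferInstance)
    (by
      intro j
      rw [ae_map_iff (hVc j).measurable.aemeasurable]
      · filter_upwards [hS j] with v hv i
        have h1 : |(V j).mulVec v i| ≤ ∑ k, |V j i k| * |S| := by
          change |∑ k, V j i k * v k| ≤ _
          refine (Finset.abs_sum_le_sum_abs _ _).trans (Finset.sum_le_sum fun k _ => ?_)
          rw [abs_mul]
          exact mul_le_mul_of_nonneg_left ((hv k).trans (le_abs_self _)) (abs_nonneg _)
        refine h1.trans ?_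
        rw [← Finset.sum_mul, hC]
        gcongr
        calc ∑ k, |V j i k| ≤ ∑ i, ∑ k, |V j i k| :=
              Finset.single_le_sum (f := fun i => ∑ k, |V j i k|)
                (fun _ _ => Finset.sum_nonneg fun _ _ => abs_nonneg _) (Finset.mem_univ i)
          _ ≤ _ := Finset.single_le_sum (f := fun j => ∑ i, ∑ k, |V j i k|)
                (fun _ _ => Finset.sum_nonneg fun _ _ => Finset.sum_nonneg fun _ _ => abs_nonneg _)
                (Finset.mem_univ j)
      · simp only [Set.ofPred_forall]
        exact MeasurableSet.iInter fun i =>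
          measurableSet_le (measurable_pi_apply i).abs measurable_const)
    (R := 2 * P + 1) (by linarith)
  set F : (Fin n → ℝ) → ℝ≥0∞ := fun y =>
    ∏ j, (∫⁻ z, gam ((T j).mulVec y - z) ∂((μ j).map (V j).mulVec)) ^ p j with hF
  have hFm : Measurable F := by
    refine Finset.measurable_prod _ fun j _ => Measurable.pow_const ?_ _
    simpa using measurable_smoothed (T j) 1 ((μ j).map (V j).mulVec)
  set Q := {x : Fin n → ℝ | ∀ i, |x i| ≤ 2 * P + 1 - 1} with hQ
  have hQm : MeasurableSet Q := by
    simp only [hQ, Set.ofPred_forall]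
    exact MeasurableSet.iInter fun i =>
      measurableSet_le (measurable_pi_apply i).abs measurable_const
  have e1 : ∀ x, ∏ j, (∫⁻ v, gam ((V j).mulVec ((L j).mulVec x - v)) ∂μ j) ^ p j =
      F (s • X.mulVec x) := by
    intro x
    simp only [hF]
    refine Finset.prod_congr rfl fun j _ => ?_
    rw [lintegral_map (by fun_prop) (hVc j).measurable]
    simp_rw [hTX, Matrix.mulVec_sub]
  have hsX : ∀ x, s • X.mulVec x = (s • X).mulVec x := fun x => by rw [Matrix.smul_mulVec]
  have hdet : (s • X).det ≠ 0 := by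
    rw [Matrix.det_smul]; exact mul_ne_zero (by positivity) hX
  have hQm' : MeasurableSet {x : Fin n → ℝ | ∀ i, |X.mulVec x i| ≤ P} := by
    simp only [Set.ofPred_forall]
    refine MeasurableSet.iInter fun i => measurableSet_le (Measurable.abs ?_) measurable_const
    exact (by fun_prop : Continuous fun x => X.mulVec x i).measurable
  calc _ = ∫⁻ x in {x : Fin n → ℝ | ∀ i, |X.mulVec x i| ≤ P}, F (s • X.mulVec x) := by simp_rw [e1]
    _ ≤ ∫⁻ x, Q.indicator F ((s • X).mulVec x) := by
      rw [← lintegral_indicator hQm']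
      refine lintegral_mono fun x => ?_
      by_cases hx : x ∈ {x : Fin n → ℝ | ∀ i, |X.mulVec x i| ≤ P}
      · rw [Set.indicator_of_mem hx, Set.indicator_of_mem, hsX]
        rw [← hsX]
        intro i
        rw [Pi.smul_apply, smul_eq_mul, abs_mul, abs_of_pos (by linarith)]
        have := hx i
        have := abs_nonneg (X.mulVec x i)
        nlinarith
      · rw [Set.indicator_of_notMem hx]; exact zero_le
    _ = ENNReal.ofReal |(s • X).det|⁻¹ * ∫⁻ y in Q, F y := by
      rw [lintegral_comp_mulVec _ (hFm.indicator hQm) _ hdet, lintegral_indicator hQm]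
    _ ≤ ENNReal.ofReal |X.det|⁻¹ * (ENNReal.ofReal (Real.exp (n * η * (Real.pi +
          Real.log (2 * P + 1)))) * ∏ j, (μ j Set.univ) ^ p j) := by
      refine mul_le_mul' (ENNReal.ofReal_le_ofReal (inv_anti₀ (abs_pos.2 hX) ?_)) ?_
      · rw [Matrix.det_smul, abs_mul, Fintype.card_fin, abs_of_nonneg (pow_nonneg (by linarith) n : 0 ≤ s ^ n)]
        exact le_mul_of_one_le_left (abs_nonneg _) (one_le_pow₀ hs1)
      · refine key.trans ?_
        have h1 : ∀ j, ((μ j).map (V j).mulVec) Set.univ = μ j Set.univ := fun j => by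
          rw [Measure.map_apply (hVc j).measurable MeasurableSet.univ, Set.preimage_univ]
        simp_rw [h1]
        gcongr
        · have := Real.pi_pos
          have := Real.log_nonneg (by linarith : (1 : ℝ) ≤ 2 * P + 1)
          positivity
        · exact div_le_self hη.le (by linarith)
    _ = _ := by rw [← mul_assoc, ← ENNReal.ofReal_mul (by positivity)]

lemma exists_bounded_dominated_aux {V : Type*} [NormedAddCommGroup V] [NormedSpace ℝ V]
    [FiniteDimensional ℝ V] {I : Type*} [Finite I] (w : I → V →ₗ[ℝ] ℝ) :
    ∃ C : ℝ, ∀ s : V, ∃ s' : V, ‖s'‖ ≤ C ∧ ∀ i, w i s' ≤ max (w i s) (-1) := by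
  classical
  have := Fintype.ofFinite I
  by_contra! hcon
  choose s hs using fun k : ℕ => hcon k
  set U : Ultrafilter ℕ := Filter.hyperfilter ℕ with hU
  have hUtop : (U : Filter ℕ) ≤ Filter.atTop := Nat.hyperfilter_le_atTop
  let P : Type _ := {i : I // ∃ C, ∀ᶠ k in (U : Filter ℕ), |w i (s k)| ≤ C}
  have hbig : ∀ i, (∃ C, ∀ᶠ k in (U : Filter ℕ), |w i (s k)| ≤ C) ∨
      (∀ C, ∀ᶠ k in (U : Filter ℕ), C ≤ w i (s k)) ∨ (∀ C, ∀ᶠ k in (U : Filter ℕ), w i (s k) ≤ C) := by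
    intro i
    by_cases h1 : ∀ C, ∀ᶠ k in (U : Filter ℕ), C ≤ w i (s k)
    · exact Or.inr (Or.inl h1)
    by_cases h2 : ∀ C, ∀ᶠ k in (U : Filter ℕ), w i (s k) ≤ C
    · exact Or.inr (Or.inr h2)
    push Not at h1 h2
    obtain ⟨C1, h1⟩ := h1
    obtain ⟨C2, h2⟩ := h2
    left
    refine ⟨max |C1| |C2|, ?_⟩
    filter_upwards [h1, h2] with k hk1 hk2
    rw [abs_le]
    constructor
    · have := neg_abs_le C2
      have := le_max_right |C1| |C2|
      linarith
    · have := le_abs_self C1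
      have := le_max_left |C1| |C2|
      linarith
  let A : V →ₗ[ℝ] (P → ℝ) := LinearMap.pi fun i => w i.1
  obtain ⟨g, hg⟩ := A.rangeRestrict.exists_rightInverse_of_surjective A.range_rangeRestrict
  let G := LinearMap.toContinuousLinearMap g
  set t : ℕ → V := fun k => g (A.rangeRestrict (s k)) with ht
  have hAt : ∀ k (i : P), w i.1 (t k) = w i.1 (s k) := by
    intro k i
    have h1 : A.rangeRestrict (t k) = A.rangeRestrict (s k) :=
      LinearMap.congr_fun hg (A.rangeRestrict (s k))
    have h2 := congrArg Subtype.val h1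
    exact congrFun h2 i
  obtain ⟨T, hT⟩ : ∃ T, ∀ᶠ k in (U : Filter ℕ), ‖t k‖ ≤ T := by
    choose C hC using fun i : P => i.2
    refine ⟨‖G‖ * (∑ i, |C i|), ?_⟩
    have : ∀ᶠ k in (U : Filter ℕ), ∀ i : P, |w i.1 (s k)| ≤ C i :=
      Filter.eventually_all.2 hC
    filter_upwards [this] with k hk
    refine (G.le_opNorm _).trans ?_
    refine mul_le_mul_of_nonneg_left ?_ (norm_nonneg _)
    rw [Submodule.coe_norm, pi_norm_le_iff_of_nonneg (by positivity)]
    intro i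
    change |w i.1 (s k)| ≤ _
    refine (hk i).trans ((le_abs_self _).trans ?_)
    exact Finset.single_le_sum (f := fun i => |C i|) (fun _ _ => abs_nonneg _) (Finset.mem_univ i)
  have hwb : ∀ i, ∃ c, ∀ v, |w i v| ≤ c * ‖v‖ := fun i =>
    ⟨‖LinearMap.toContinuousLinearMap (w i)‖, fun v => (LinearMap.toContinuousLinearMap (w i)).le_opNorm v⟩
  choose c hc using hwb
  have hcT : ∀ i, ∀ᶠ k in (U : Filter ℕ), |w i (t k)| ≤ |c i| * |T| := by
    intro i
    filter_upwards [hT] with k hk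
    refine (hc i _).trans (mul_le_mul (le_abs_self _) (hk.trans (le_abs_self _)) (norm_nonneg _)
      (abs_nonneg _))
  -- a fixed direction that is very negative on the functionals tending to `-∞`
  obtain ⟨k0, hk0⟩ : ∃ k0, ∀ i, (∃ C, ∀ᶠ k in (U : Filter ℕ), |w i (s k)| ≤ C) ∨
      (∀ C, ∀ᶠ k in (U : Filter ℕ), C ≤ w i (s k)) ∨ w i (s k0 - t k0) ≤ -1 - |c i| * |T| := by
    have : ∀ᶠ k in (U : Filter ℕ), ∀ i, (∃ C, ∀ᶠ k in (U : Filter ℕ), |w i (s k)| ≤ C) ∨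
      (∀ C, ∀ᶠ k in (U : Filter ℕ), C ≤ w i (s k)) ∨ w i (s k - t k) ≤ -1 - |c i| * |T| := by
      refine Filter.eventually_all.2 fun i => ?_
      rcases hbig i with h | h | h
      · exact Filter.Eventually.of_forall fun k => Or.inl h
      · exact Filter.Eventually.of_forall fun k => Or.inr (Or.inl h)
      · filter_upwards [h (-1 - |c i| * |T| - |c i| * |T|), hcT i] with k h1 h2
        right; right
        rw [map_sub]
        have := abs_le.1 h2
        linarith
    exact this.exists
  have hfin : ∀ᶠ k in (U : Filter ℕ), ∀ i, w i (t k + (s k0 - t k0)) ≤ max (w i (s k)) (-1) := by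
    refine Filter.eventually_all.2 fun i => ?_
    rcases hk0 i with h | h | h
    · refine Filter.Eventually.of_forall fun k => ?_
      have h1 := hAt k ⟨i, h⟩
      have h2 := hAt k0 ⟨i, h⟩
      simp only at h1 h2
      rw [map_add, map_sub, h1, h2, sub_self, add_zero]
      exact le_max_left _ _
    · filter_upwards [h (|c i| * |T| + w i (s k0 - t k0)), hcT i] with k h1 h2
      rw [map_add]
      refine le_trans ?_ (le_max_left _ _)
      have := abs_le.1 h2
      linarith
    · filter_upwards [hcT i] with k h2
      rw [map_add]
      refine le_trans ?_ (le_max_right _ _)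
      have := abs_le.1 h2
      linarith
  obtain ⟨N, hN⟩ := exists_nat_ge (T + ‖s k0 - t k0‖)
  obtain ⟨k, h1, h2, h3⟩ := ((hT.and (hfin.and (hUtop (Filter.eventually_ge_atTop N)))).exists)
  obtain ⟨i, hi⟩ := hs k (t k + (s k0 - t k0)) (by
    refine (norm_add_le _ _).trans ?_
    have : (N : ℝ) ≤ k := by exact_mod_cast h3
    linarith)
  exact absurd (h2 i) (not_le.2 hi)

/-- Any point can be replaced by one of norm `O(ℓ)` without increasing finitely many given linear
functionals above `max (old value) (-ℓ)`. -/
lemma exists_bounded_dominated {V : Type*} [NormedAddCommGroup V] [NormedSpace ℝ V]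
    [FiniteDimensional ℝ V] {I : Type*} [Finite I] (w : I → V →ₗ[ℝ] ℝ) :
    ∃ C : ℝ, 0 ≤ C ∧ ∀ (s : V) (l : ℝ), 0 < l →
      ∃ s' : V, ‖s'‖ ≤ C * l ∧ ∀ i, w i s' ≤ max (w i s) (-l) := by
  obtain ⟨C, hC⟩ := exists_bounded_dominated_aux w
  have hC0 : 0 ≤ C := by
    obtain ⟨s', h, -⟩ := hC 0
    exact (norm_nonneg _).trans h
  refine ⟨C, hC0, fun s l hl => ?_⟩
  obtain ⟨s', h1, h2⟩ := hC (l⁻¹ • s)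
  refine ⟨l • s', ?_, fun i => ?_⟩
  · rw [norm_smul, Real.norm_of_nonneg hl.le, mul_comm]
    gcongr
  · have := mul_le_mul_of_nonneg_left (h2 i) hl.le
    rw [mul_max_of_nonneg _ _ hl.le, map_smul, smul_eq_mul, mul_inv_cancel_left₀ hl.ne'] at this
    rw [map_smul, smul_eq_mul]
    simpa using this

lemma factorial_mul_det_sum_vecMulVec {n : ℕ} {K : Type*} [Fintype K] (c : K → ℝ)
    (v : K → Fin n → ℝ) :
    (n.factorial : ℝ) * (∑ k, c k • Matrix.vecMulVec (v k) (v k)).det =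
      ∑ κ : Fin n → K, (∏ a, c (κ a)) * (Matrix.of fun a => v (κ a)).det ^ 2 := by
  classical
  have h1 : (∑ k, c k • Matrix.vecMulVec (v k) (v k)).det =
      ∑ κ : Fin n → K, (∏ a, (c (κ a) * v (κ a) a)) * (Matrix.of fun a => v (κ a)).det := by
    have : (∑ k, c k • Matrix.vecMulVec (v k) (v k)) =
        fun a => ∑ k, (c k * v k a) • v k := by
      ext a b
      simp only [Matrix.sum_apply, Finset.sum_apply, Matrix.smul_apply, Matrix.vecMulVec_apply,
        Pi.smul_apply, smul_eq_mul]
      exact Finset.sum_congr rfl fun k _ => by ring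
    rw [this]
    change Matrix.detRowAlternating (fun a => ∑ k, (c k * v k a) • v k) = _
    rw [← AlternatingMap.coe_multilinearMap, MultilinearMap.map_sum]
    refine Finset.sum_congr rfl fun κ _ => ?_
    rw [MultilinearMap.map_smul_univ]
    rfl
  have h2 : ∀ σ : Equiv.Perm (Fin n), (∑ k, c k • Matrix.vecMulVec (v k) (v k)).det =
      ∑ κ : Fin n → K, (∏ a, c (κ a)) * ((∏ a, v (κ (σ a)) a) * (Equiv.Perm.sign σ : ℝ)) *
        (Matrix.of fun a => v (κ a)).det := by
    intro σ
    rw [h1, ← Equiv.sum_comp (Equiv.arrowCongr σ (Equiv.refl K)).symm]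
    refine Finset.sum_congr rfl fun κ _ => ?_
    have e : ∀ a, (Equiv.arrowCongr σ (Equiv.refl K)).symm κ a = κ (σ a) := fun a => rfl
    simp_rw [e]
    have hd : (Matrix.of fun a => v (κ (σ a))).det =
        (Equiv.Perm.sign σ : ℝ) * (Matrix.of fun a => v (κ a)).det := by
      have := Matrix.det_permute σ (Matrix.of fun a => v (κ a))
      exact this
    rw [hd, Finset.prod_mul_distrib, Equiv.prod_comp σ (fun a => c (κ a))]
    ring
  have h3 : (n.factorial : ℝ) * (∑ k, c k • Matrix.vecMulVec (v k) (v k)).det =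
      ∑ _σ : Equiv.Perm (Fin n), (∑ k, c k • Matrix.vecMulVec (v k) (v k)).det := by
    rw [Finset.sum_const, Finset.card_univ, Fintype.card_perm, Fintype.card_fin, nsmul_eq_mul]
  rw [h3, Finset.sum_congr rfl fun σ _ => h2 σ, Finset.sum_comm]
  refine Finset.sum_congr rfl fun κ _ => ?_
  rw [← Finset.sum_mul, ← Finset.mul_sum, sq, mul_assoc]
  congr 2
  rw [Matrix.det_apply']
  refine Finset.sum_congr rfl fun σ _ => ?_
  rw [mul_comm]
  rfl

lemma exists_orthogonal_diagonalization {k : ℕ} (A : Matrix (Fin k) (Fin k) ℝ) (hA : A.transpose = A)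
    (hpos : ∀ x, x ≠ 0 → 0 < x ⬝ᵥ A.mulVec x) :
    ∃ (lam : Fin k → ℝ) (R : Matrix (Fin k) (Fin k) ℝ), (∀ i, 0 < lam i) ∧
      R * R.transpose = 1 ∧ A = R.transpose * Matrix.diagonal lam * R := by
  have hH : A.IsHermitian := by
    rw [Matrix.IsHermitian, Matrix.conjTranspose_eq_transpose_of_trivial]; exact hA
  have hP : A.PosDef := Matrix.PosDef.of_dotProduct_mulVec_pos hH fun x hx => by
    simpa using hpos x hx
  refine ⟨hP.1.eigenvalues, (hP.1.eigenvectorUnitary : Matrix (Fin k) (Fin k) ℝ).transpose,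
    hP.eigenvalues_pos, ?_, ?_⟩
  · have := Unitary.coe_star_mul_self hP.1.eigenvectorUnitary
    rw [Matrix.star_eq_conjTranspose, Matrix.conjTranspose_eq_transpose_of_trivial] at this
    rw [Matrix.transpose_transpose]
    exact this
  · have := hP.1.spectral_theorem
    rw [Unitary.conjStarAlgAut_apply, Matrix.star_eq_conjTranspose,
      Matrix.conjTranspose_eq_transpose_of_trivial] at this
    rw [Matrix.transpose_transpose]
    exact this

lemma dot_transpose_mul_self {k l : ℕ} (A : Matrix (Fin k) (Fin l) ℝ) (x : Fin l → ℝ) :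
    x ⬝ᵥ (A.transpose * A).mulVec x = nsq (A.mulVec x) := by
  rw [nsq_eq_dot, ← Matrix.mulVec_mulVec, Matrix.dotProduct_mulVec, Matrix.vecMul_transpose]

lemma nsq_pos {k : ℕ} {x : Fin k → ℝ} (hx : x ≠ 0) : 0 < nsq x := by
  obtain ⟨i, hi⟩ := Function.ne_iff.1 hx
  exact Finset.sum_pos' (fun _ _ => sq_nonneg _) ⟨i, Finset.mem_univ i, by
    have : x i ≠ 0 := hi
    positivity⟩

lemma mulVec_ne_zero_of_det {k : ℕ} {A : Matrix (Fin k) (Fin k) ℝ} (hA : A.det ≠ 0) {x : Fin k → ℝ}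
    (hx : x ≠ 0) : A.mulVec x ≠ 0 := fun h => hx (Matrix.eq_zero_of_mulVec_eq_zero hA h)

section
variable {ι : Type*} [Fintype ι] {n : ℕ} {d : ι → ℕ}

/-- The matrix of the quadratic form `x ↦ ∑ p_j |W_j L_j x|²`. -/
noncomputable def quadM (p : ι → ℝ) (L : ∀ j, Matrix (Fin (d j)) (Fin n) ℝ)
    (W : ∀ j, Matrix (Fin (d j)) (Fin (d j)) ℝ) : Matrix (Fin n) (Fin n) ℝ :=
  ∑ j, p j • ((W j * L j).transpose * (W j * L j))

/-- The (inverse square of the) Brascamp–Lieb functional on centred Gaussians. -/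
noncomputable def Phi (p : ι → ℝ) (L : ∀ j, Matrix (Fin (d j)) (Fin n) ℝ)
    (W : ∀ j, Matrix (Fin (d j)) (Fin (d j)) ℝ) : ℝ :=
  (quadM p L W).det * ∏ j, ((W j).det ^ 2) ^ (-p j)

/-- The matrices `diag(exp(s/2)) R_j`. -/
noncomputable def diagW (s : (Σ j, Fin (d j)) → ℝ) (R : ∀ j, Matrix (Fin (d j)) (Fin (d j)) ℝ) :
    ∀ j, Matrix (Fin (d j)) (Fin (d j)) ℝ :=
  fun j => Matrix.diagonal (fun i => Real.exp (s ⟨j, i⟩ / 2)) * R j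

/-- The exponents occurring in the expansion of `Phi`. -/
noncomputable def expo (p : ι → ℝ) (κ : Fin n → (Σ j, Fin (d j))) :
    ((Σ j, Fin (d j)) → ℝ) →ₗ[ℝ] ℝ :=
  (∑ a, LinearMap.proj (κ a)) - ∑ k : (Σ j, Fin (d j)), p k.1 • LinearMap.proj k

/-- The coefficients occurring in the expansion of `Phi`. -/
noncomputable def coef (p : ι → ℝ) (L : ∀ j, Matrix (Fin (d j)) (Fin n) ℝ)
    (R : ∀ j, Matrix (Fin (d j)) (Fin (d j)) ℝ) (κ : Fin n → (Σ j, Fin (d j))) : ℝ :=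
  (n.factorial : ℝ)⁻¹ * ((∏ a, p (κ a).1) *
    (Matrix.of fun a => (R (κ a).1 * L (κ a).1) (κ a).2).det ^ 2)

lemma dot_quadM (p : ι → ℝ) (L : ∀ j, Matrix (Fin (d j)) (Fin n) ℝ)
    (W : ∀ j, Matrix (Fin (d j)) (Fin (d j)) ℝ) (x : Fin n → ℝ) :
    x ⬝ᵥ (quadM p L W).mulVec x = ∑ j, p j * nsq ((W j).mulVec ((L j).mulVec x)) := by
  rw [quadM, Matrix.sum_mulVec, dotProduct_sum]
  refine Finset.sum_congr rfl fun j _ => ?_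
  rw [Matrix.smul_mulVec, dotProduct_smul, dot_transpose_mul_self, smul_eq_mul,
    Matrix.mulVec_mulVec]

lemma quadM_transpose (p : ι → ℝ) (L : ∀ j, Matrix (Fin (d j)) (Fin n) ℝ)
    (W : ∀ j, Matrix (Fin (d j)) (Fin (d j)) ℝ) : (quadM p L W).transpose = quadM p L W := by
  simp only [quadM, Matrix.transpose_sum, Matrix.transpose_smul, Matrix.transpose_mul,
    Matrix.transpose_transpose]

lemma Phi_congr (p : ι → ℝ) (L : ∀ j, Matrix (Fin (d j)) (Fin n) ℝ)
    {W W' : ∀ j, Matrix (Fin (d j)) (Fin (d j)) ℝ}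
    (h : ∀ j, (W j).transpose * W j = (W' j).transpose * W' j) : Phi p L W = Phi p L W' := by
  have h1 : quadM p L W = quadM p L W' := by
    refine Finset.sum_congr rfl fun j _ => ?_
    rw [Matrix.transpose_mul, Matrix.transpose_mul, Matrix.mul_assoc, ← Matrix.mul_assoc (W j).transpose,
      h, Matrix.mul_assoc, Matrix.mul_assoc]
  have h2 : ∀ j, (W j).det ^ 2 = (W' j).det ^ 2 := fun j => by
    have := congrArg Matrix.det (h j)
    rwa [Matrix.det_mul, Matrix.det_mul, Matrix.det_transpose, Matrix.det_transpose, ← sq, ← sq] at this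
  rw [Phi, Phi, h1]
  simp_rw [h2]

lemma exists_diagW (W : ∀ j, Matrix (Fin (d j)) (Fin (d j)) ℝ) (hW : ∀ j, (W j).det ≠ 0) :
    ∃ (s : (Σ j, Fin (d j)) → ℝ) (R : ∀ j, Matrix (Fin (d j)) (Fin (d j)) ℝ),
      (∀ j, R j * (R j).transpose = 1) ∧
      ∀ j, (W j).transpose * W j = (diagW s R j).transpose * diagW s R j := by
  choose lam R hlam hR hWR using fun j => exists_orthogonal_diagonalization
    ((W j).transpose * W j) (by rw [Matrix.transpose_mul, Matrix.transpose_transpose])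
    (fun x hx => by
      rw [dot_transpose_mul_self]; exact nsq_pos (mulVec_ne_zero_of_det (hW j) hx))
  refine ⟨fun k => Real.log (lam k.1 k.2), R, hR, fun j => ?_⟩
  rw [hWR, diagW, Matrix.transpose_mul, Matrix.diagonal_transpose, Matrix.mul_assoc, Matrix.mul_assoc,
    ← Matrix.mul_assoc (Matrix.diagonal _) (Matrix.diagonal _), Matrix.diagonal_mul_diagonal]
  congr 3
  ext i
  rw [← Real.exp_add, add_halves, Real.exp_log (hlam j i)]

lemma det_sq_of_orthogonal {k : ℕ} {R : Matrix (Fin k) (Fin k) ℝ} (hR : R * R.transpose = 1) :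
    R.det ^ 2 = 1 := by
  have := congrArg Matrix.det hR
  rwa [Matrix.det_mul, Matrix.det_transpose, Matrix.det_one, ← sq] at this

lemma det_diagW (s : (Σ j, Fin (d j)) → ℝ) {R : ∀ j, Matrix (Fin (d j)) (Fin (d j)) ℝ}
    (hR : ∀ j, R j * (R j).transpose = 1) (j : ι) :
    (diagW s R j).det ^ 2 = Real.exp (∑ i, s ⟨j, i⟩) := by
  rw [diagW, Matrix.det_mul, mul_pow, det_sq_of_orthogonal (hR j), mul_one, Matrix.det_diagonal,
    ← Real.exp_sum, ← Real.exp_nat_mul]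
  congr 1
  rw [← Finset.sum_div]; push_cast; ring

lemma Phi_diagW (p : ι → ℝ) (L : ∀ j, Matrix (Fin (d j)) (Fin n) ℝ) (s : (Σ j, Fin (d j)) → ℝ)
    {R : ∀ j, Matrix (Fin (d j)) (Fin (d j)) ℝ} (hR : ∀ j, R j * (R j).transpose = 1) :
    Phi p L (diagW s R) = ∑ κ, coef p L R κ * Real.exp (expo (n := n) p κ s) := by
  have h1 : quadM p L (diagW s R) = ∑ k : (Σ j, Fin (d j)), (p k.1 * Real.exp (s k)) •
      Matrix.vecMulVec ((R k.1 * L k.1) k.2) ((R k.1 * L k.1) k.2) := by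
    ext a b
    rw [quadM, Matrix.sum_apply, Matrix.sum_apply, Fintype.sum_sigma]
    refine Finset.sum_congr rfl fun j _ => ?_
    rw [Matrix.smul_apply, Matrix.mul_apply, smul_eq_mul, Finset.mul_sum]
    refine Finset.sum_congr rfl fun i _ => ?_
    rw [Matrix.transpose_apply, diagW, Matrix.mul_assoc, Matrix.diagonal_mul, Matrix.diagonal_mul,
      Matrix.smul_apply, Matrix.vecMulVec_apply, smul_eq_mul]
    have : Real.exp (s ⟨j, i⟩) = Real.exp (s ⟨j, i⟩ / 2) * Real.exp (s ⟨j, i⟩ / 2) := by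
      rw [← Real.exp_add, add_halves]
    rw [this]; ring
  have h2 : ∏ j, ((diagW s R j).det ^ 2) ^ (-p j) =
      Real.exp (-∑ k : (Σ j, Fin (d j)), p k.1 * s k) := by
    simp_rw [det_diagW s hR, ← Real.exp_mul]
    rw [← Real.exp_sum, Fintype.sum_sigma, ← Finset.sum_neg_distrib]
    congr 1
    refine Finset.sum_congr rfl fun j _ => ?_
    rw [Finset.sum_mul, ← Finset.sum_neg_distrib]
    exact Finset.sum_congr rfl fun i _ => by ring
  have h3 := factorial_mul_det_sum_vecMulVec (fun k : (Σ j, Fin (d j)) => p k.1 * Real.exp (s k))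
    (fun k => (R k.1 * L k.1) k.2)
  rw [← h1] at h3
  have hn : (n.factorial : ℝ) ≠ 0 := by exact_mod_cast n.factorial_ne_zero
  have h4 : (quadM p L (diagW s R)).det = (n.factorial : ℝ)⁻¹ *
      ((n.factorial : ℝ) * (quadM p L (diagW s R)).det) := by field_simp
  rw [Phi, h2, h4, h3, Finset.mul_sum, Finset.sum_mul]
  refine Finset.sum_congr rfl fun κ _ => ?_
  have h5 : Real.exp (expo p κ s) = (∏ a, Real.exp (s (κ a))) *
      Real.exp (-∑ k : (Σ j, Fin (d j)), p k.1 * s k) := by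
    rw [← Real.exp_sum, ← Real.exp_add, expo]
    simp [LinearMap.sum_apply, sub_eq_add_neg]
  rw [h5, coef, Finset.prod_mul_distrib]
  ring

lemma coef_nonneg {p : ι → ℝ} (hp : ∀ j, 0 < p j) (L : ∀ j, Matrix (Fin (d j)) (Fin n) ℝ)
    (R : ∀ j, Matrix (Fin (d j)) (Fin (d j)) ℝ) (κ : Fin n → (Σ j, Fin (d j))) :
    0 ≤ coef p L R κ :=
  mul_nonneg (by positivity) (mul_nonneg (Finset.prod_nonneg fun a _ => (hp _).le) (sq_nonneg _))

lemma abs_le_one_of_orthogonal {k : ℕ} {R : Matrix (Fin k) (Fin k) ℝ} (hR : R * R.transpose = 1)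
    (i j : Fin k) : |R i j| ≤ 1 := by
  have h : ∑ j, R i j ^ 2 = 1 := by
    have := congrFun (congrFun hR i) i
    rw [Matrix.mul_apply, Matrix.one_apply_eq] at this
    rw [← this]
    exact Finset.sum_congr rfl fun j _ => by rw [Matrix.transpose_apply, sq]
  rw [← sq_le_one_iff_abs_le_one, ← h]
  exact Finset.single_le_sum (f := fun j => R i j ^ 2) (fun _ _ => sq_nonneg _) (Finset.mem_univ j)

lemma continuous_coef (p : ι → ℝ) (κ : Fin n → (Σ j, Fin (d j))) :
    Continuous fun z : (∀ j, Matrix (Fin (d j)) (Fin n) ℝ) × (∀ j, Matrix (Fin (d j)) (Fin (d j)) ℝ) =>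
      coef p z.1 z.2 κ := by
  unfold coef
  refine continuous_const.mul (continuous_const.mul ((Continuous.matrix_det ?_).pow 2))
  refine continuous_matrix fun a b => ?_
  change Continuous fun z : (∀ j, Matrix (Fin (d j)) (Fin n) ℝ) × (∀ j, Matrix (Fin (d j)) (Fin (d j)) ℝ) =>
    (z.2 (κ a).1 * z.1 (κ a).1) (κ a).2 b
  simp only [Matrix.mul_apply]
  refine continuous_finsetSum _ fun i _ => ?_
  fun_prop

end

lemma det_one_sub_smul_vecMulVec {k : ℕ} (c : ℝ) (u : Fin k → ℝ) :
    (1 - c • Matrix.vecMulVec u u).det = 1 - c * nsq u := by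
  have h := Matrix.det_one_add_replicateCol_mul_replicateRow (ι := Unit) (-c • u) u
  rw [nsq_eq_dot, sub_eq_add_neg, sub_eq_add_neg]
  have e1 : (-(c • Matrix.vecMulVec u u)) = Matrix.replicateCol Unit (-c • u) *
      Matrix.replicateRow Unit u := by
    ext a b
    simp [Matrix.vecMulVec_apply, Matrix.mul_apply, mul_assoc]
  rw [e1, h, dotProduct_smul, smul_eq_mul]; ring

section
variable {ι : Type*} [Fintype ι] {n : ℕ} {d : ι → ℕ}

/-- Shrinking the `j`-th Gaussian in one direction `u`. -/
lemma Phi_shrink [DecidableEq ι] {p : ι → ℝ} {L : ∀ j, Matrix (Fin (d j)) (Fin n) ℝ}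
    {W : ∀ j, Matrix (Fin (d j)) (Fin (d j)) ℝ} {X : Matrix (Fin n) (Fin n) ℝ}
    (hX : quadM p L W = X.transpose * X) (j : ι) {u : Fin (d j) → ℝ} (hu : nsq u = 1)
    {t : ℝ} (ht : t < 1) {e : Fin n → ℝ}
    (he : X.transpose.mulVec e = (W j * L j).transpose.mulVec u) :
    Phi p L (Function.update W j ((1 - (1 - √(1 - t)) • Matrix.vecMulVec u u) * W j)) =
      Phi p L W * (1 - p j * t * nsq e) * (1 - t) ^ (-p j) := by
  set σ := 1 - √(1 - t) with hσ
  set Y := (1 - σ • Matrix.vecMulVec u u) with hY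
  set W' := Function.update W j (Y * W j) with hW'
  have hs : √(1 - t) ^ 2 = 1 - t := Real.sq_sqrt (by linarith)
  have huu : Matrix.vecMulVec u u * Matrix.vecMulVec u u = Matrix.vecMulVec u u := by
    rw [Matrix.vecMulVec_mul_vecMulVec, ← nsq_eq_dot, hu, one_smul]
  have hYt : Y.transpose = Y := by
    rw [hY, Matrix.transpose_sub, Matrix.transpose_one, Matrix.transpose_smul,
      Matrix.transpose_vecMulVec]
  have hYY : Y.transpose * Y = 1 - t • Matrix.vecMulVec u u := by
    rw [hYt, hY, Matrix.sub_mul, Matrix.one_mul, Matrix.mul_sub, Matrix.mul_one, Matrix.smul_mul,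
      Matrix.mul_smul, huu, smul_smul, sub_sub, ← add_sub_assoc, ← add_smul, ← sub_smul]
    congr 2
    rw [hσ]; linear_combination -hs
  have hWj : W' j = Y * W j := Function.update_self _ _ _
  have hWi : ∀ i, i ≠ j → W' i = W i := fun i hi => Function.update_of_ne hi _ _
  have hM : quadM p L W' = X.transpose * (1 - (p j * t) • Matrix.vecMulVec e e) * X := by
    have h1 : quadM p L W' - quadM p L W = -(p j * t) •
        Matrix.vecMulVec ((W j * L j).transpose.mulVec u) ((W j * L j).transpose.mulVec u) := by
      rw [quadM, quadM, ← Finset.sum_sub_distrib, Finset.sum_eq_single j]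
      · rw [hWj, Matrix.mul_assoc, Matrix.transpose_mul Y, Matrix.mul_assoc _ Y.transpose,
          ← Matrix.mul_assoc Y.transpose, hYY, Matrix.sub_mul, Matrix.one_mul, Matrix.mul_sub,
          smul_sub, sub_sub_cancel_left, Matrix.smul_mul, Matrix.mul_smul, smul_smul, neg_smul,
          Matrix.vecMulVec_mul, Matrix.mul_vecMulVec, Matrix.mulVec_transpose]
      · intro i _ hi
        rw [hWi i hi, sub_self]
      · simp
    rw [← sub_add_cancel (quadM p L W') (quadM p L W), h1, hX, Matrix.mul_sub, Matrix.sub_mul,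
      Matrix.mul_one, Matrix.mul_smul, Matrix.smul_mul, Matrix.mul_vecMulVec, Matrix.vecMulVec_mul,
      ← Matrix.mulVec_transpose, he, neg_smul]
    abel
  have hprod : ∏ i, ((W' i).det ^ 2) ^ (-p i) = (1 - t) ^ (-p j) * ∏ i, ((W i).det ^ 2) ^ (-p i) := by
    rw [← Finset.mul_prod_erase _ _ (Finset.mem_univ j), ← Finset.mul_prod_erase _ (fun i =>
      ((W i).det ^ 2) ^ (-p i)) (Finset.mem_univ j), ← mul_assoc]
    congr 1
    · rw [hWj, Matrix.det_mul, hY, det_one_sub_smul_vecMulVec, hu, mul_pow, hσ, mul_one, sub_sub_cancel,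
        hs, Real.mul_rpow (by linarith) (sq_nonneg _)]
    · exact Finset.prod_congr rfl fun i hi => by rw [hWi i (Finset.ne_of_mem_erase hi)]
  rw [Phi, Phi, hprod, hM, hX, Matrix.det_mul, Matrix.det_mul, Matrix.det_mul,
    det_one_sub_smul_vecMulVec]
  ring

lemma nearCritical_arith {p η γ : ℝ} (hp : 0 < p) (hp1 : p ≤ 1) (hη : 0 < η) (hη1 : η ≤ 1)
    (h : 1 ≤ (1 + p / 8 * η ^ 2) * ((1 - p * (η / 4) * γ) * (1 - η / 4) ^ (-p))) : γ ≤ 1 + η := by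
  have ht : 0 < 1 - η / 4 := by linarith
  have h0 : 0 < (1 - η / 4) ^ (-p) := Real.rpow_pos_of_pos ht _
  have h1 : (1 - η / 4) ^ (-p) ≤ 1 + p * (η / 4 / (1 - η / 4)) := by
    rw [Real.rpow_neg ht.le, ← Real.inv_rpow ht.le]
    have : (1 - η / 4)⁻¹ = 1 + η / 4 / (1 - η / 4) := by
      rw [eq_comm, inv_eq_one_div, eq_div_iff ht.ne', add_mul, div_mul_cancel₀ _ ht.ne']
      ring
    rw [this]
    exact rpow_one_add_le_one_add_mul_self (by
      have : 0 ≤ η / 4 / (1 - η / 4) := by positivity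
      linarith) hp.le hp1
  have h2 : η / 4 / (1 - η / 4) ≤ η / 4 * (1 + η / 3) := by
    rw [div_le_iff₀ ht]
    nlinarith [mul_pos hη hη]
  by_contra! hγ
  have h3 : 1 - p * (η / 4) * γ ≤ 1 - p * (η / 4) * (1 + η) := by
    have : 0 < p * (η / 4) := by positivity
    nlinarith
  set a := p * (η / 4) with ha
  have ha0 : 0 < a := by positivity
  have ha1 : a ≤ 1 / 4 := by nlinarith
  have h4 : (1 - η / 4) ^ (-p) ≤ 1 + a * (1 + η / 3) := h1.trans (by nlinarith)
  have h5 : (1 - a * γ) * (1 - η / 4) ^ (-p) ≤ (1 - a * (1 + η)) * (1 + a * (1 + η / 3)) :=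
    mul_le_mul h3 h4 h0.le (by nlinarith)
  have h6 : (1 - a * (1 + η)) * (1 + a * (1 + η / 3)) ≤ 1 - 2 / 3 * (a * η) := by
    nlinarith [mul_pos ha0 hη, mul_pos ha0 ha0, mul_pos (mul_pos ha0 ha0) hη,
      mul_pos (mul_pos ha0 ha0) (mul_pos hη hη)]
  have h7 : p / 8 * η ^ 2 = a * η / 2 := by rw [ha]; ring
  rw [h7] at h
  have h8 : (1 + a * η / 2) * ((1 - a * γ) * (1 - η / 4) ^ (-p)) ≤
      (1 + a * η / 2) * (1 - 2 / 3 * (a * η)) :=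
    mul_le_mul_of_nonneg_left (h5.trans h6) (by positivity)
  nlinarith [mul_pos ha0 hη]

lemma nearCritical_of_nearMax {p : ι → ℝ} (hp : ∀ j, 0 < p j) (hp1 : ∀ j, p j ≤ 1)
    {L : ∀ j, Matrix (Fin (d j)) (Fin n) ℝ} {W : ∀ j, Matrix (Fin (d j)) (Fin (d j)) ℝ}
    (hW : ∀ j, (W j).det ≠ 0) {X : Matrix (Fin n) (Fin n) ℝ} (hXd : X.det ≠ 0)
    (hX : quadM p L W = X.transpose * X) {η : ℝ} (hη : 0 < η) (hη1 : η ≤ 1) (j : ι)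
    (hmax : ∀ W', (∀ j, (W' j).det ≠ 0) → Phi p L W ≤ (1 + p j / 8 * η ^ 2) * Phi p L W')
    (x : Fin n → ℝ) :
    nsq ((W j).mulVec ((L j).mulVec x)) ≤ (1 + η) * nsq (X.mulVec x) := by
  classical
  have hPhi : 0 < Phi p L W := by
    refine mul_pos ?_ (Finset.prod_pos fun i _ => Real.rpow_pos_of_pos (by
      have := hW i; positivity) _)
    rw [hX, Matrix.det_mul, Matrix.det_transpose]
    exact mul_self_pos.2 hXd
  set y := (W j).mulVec ((L j).mulVec x) with hy
  by_cases hy0 : y = 0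
  · rw [hy0]
    have : nsq (0 : Fin (d j) → ℝ) = 0 := by simp [nsq]
    rw [this]
    have := nsq_nonneg (X.mulVec x)
    positivity
  have hny := nsq_pos hy0
  set r := √(nsq y) with hr
  have hr2 : r ^ 2 = nsq y := Real.sq_sqrt hny.le
  have hr0 : 0 < r := Real.sqrt_pos.2 hny
  set u := r⁻¹ • y with hu
  have hu1 : nsq u = 1 := by rw [hu, nsq_smul, ← hr2, inv_pow, inv_mul_cancel₀ (by positivity)]
  set e := X.transpose⁻¹.mulVec ((W j * L j).transpose.mulVec u) with he
  have hXt : IsUnit X.transpose.det := by rw [Matrix.det_transpose]; exact hXd.isUnit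
  have he' : X.transpose.mulVec e = (W j * L j).transpose.mulVec u := by
    rw [he, Matrix.mulVec_mulVec, Matrix.mul_nonsing_inv _ hXt, Matrix.one_mulVec]
  have hγ : nsq e ≤ 1 + η := by
    have h1 := hmax (Function.update W j ((1 - (1 - √(1 - η / 4)) • Matrix.vecMulVec u u) * W j))
      (by
        intro i
        by_cases hi : i = j
        · subst hi
          rw [Function.update_self, Matrix.det_mul, det_one_sub_smul_vecMulVec, hu1, mul_one,
            sub_sub_cancel]
          exact mul_ne_zero (Real.sqrt_pos.2 (by linarith)).ne' (hW _)
        · rw [Function.update_of_ne hi]; exact hW i)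
    rw [Phi_shrink hX j hu1 (by linarith) he'] at h1
    refine nearCritical_arith (hp j) (hp1 j) hη hη1 ?_
    refine le_of_mul_le_mul_left (a := Phi p L W) ?_ hPhi
    rw [mul_one]
    refine h1.trans (le_of_eq ?_)
    ring
  have h2 : u ⬝ᵥ y = e ⬝ᵥ X.mulVec x := by
    have h4 : e ⬝ᵥ X.mulVec x = u ⬝ᵥ (W j * L j).mulVec x := by
      rw [Matrix.dotProduct_mulVec, ← Matrix.mulVec_transpose, he', Matrix.mulVec_transpose,
        ← Matrix.dotProduct_mulVec]
    rw [h4, ← Matrix.mulVec_mulVec]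
  have h3 : (u ⬝ᵥ y) ^ 2 = nsq y := by
    rw [hu, smul_dotProduct, ← nsq_eq_dot, smul_eq_mul, ← hr2]
    field_simp
  rw [← h3, h2]
  exact (dot_sq_le _ _).trans (mul_le_mul_of_nonneg_right hγ (nsq_nonneg _))

end

/-- Families of orthogonal matrices. -/
def orthoSet {ι : Type*} (d : ι → ℕ) : Set (∀ j, Matrix (Fin (d j)) (Fin (d j)) ℝ) :=
  {R | ∀ j, R j * (R j).transpose = 1}

lemma isCompact_orthoSet {ι : Type*} (d : ι → ℕ) : IsCompact (orthoSet d) := by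
  have hK : IsCompact (Set.univ.pi fun j : ι => Set.univ.pi fun _ : Fin (d j) =>
      Set.univ.pi fun _ : Fin (d j) => Set.Icc (-1 : ℝ) 1) :=
    isCompact_univ_pi fun _ => isCompact_univ_pi fun _ => isCompact_univ_pi fun _ => isCompact_Icc
  refine IsCompact.of_isClosed_subset hK ?_ fun R hR j _ i _ k _ => ?_
  · simp only [orthoSet, Set.ofPred_forall]
    refine isClosed_iInter fun j => isClosed_eq ?_ continuous_const
    have : Continuous fun R : ∀ j, Matrix (Fin (d j)) (Fin (d j)) ℝ => R j := continuous_apply j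
    exact this.matrix_mul this.matrix_transpose
  · exact abs_le.1 (abs_le_one_of_orthogonal (hR j) i k)

section
variable {ι : Type*} [Fintype ι] {n : ℕ} {d : ι → ℕ}

lemma coef_close (p : ι → ℝ) (L₀ : ∀ j, Matrix (Fin (d j)) (Fin n) ℝ) {δ : ℝ} (hδ : 0 < δ) :
    ∀ᶠ L in nhds L₀, ∀ R ∈ orthoSet d, ∀ κ, |coef p L R κ - coef p L₀ R κ| < δ := by
  refine (isCompact_orthoSet d).eventually_forall_of_forall_eventually fun R _ => ?_
  refine Filter.eventually_all.2 fun κ => ?_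
  have h1 : Continuous fun z : (∀ j, Matrix (Fin (d j)) (Fin n) ℝ) ×
      (∀ j, Matrix (Fin (d j)) (Fin (d j)) ℝ) => |coef p z.1 z.2 κ - coef p L₀ z.2 κ| :=
    ((continuous_coef p κ).sub ((continuous_coef p κ).comp
      (continuous_const.prodMk continuous_snd))).abs
  refine h1.continuousAt.eventually_lt continuousAt_const ?_
  simpa using hδ

lemma coef_bound (p : ι → ℝ) (L₀ : ∀ j, Matrix (Fin (d j)) (Fin n) ℝ) :
    ∃ D : ℝ, 0 < D ∧ ∀ᶠ L in nhds L₀, ∀ R ∈ orthoSet d, ∑ κ, coef p L R κ ≤ D := by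
  have hc : Continuous fun R : ∀ j, Matrix (Fin (d j)) (Fin (d j)) ℝ => ∑ κ, coef p L₀ R κ :=
    continuous_finsetSum _ fun κ _ => (continuous_coef p κ).comp
      (f := fun R => (L₀, R)) (continuous_const.prodMk continuous_id)
  obtain ⟨D, hD⟩ := (isCompact_orthoSet d).exists_bound_of_continuousOn hc.continuousOn
  refine ⟨|D| + Fintype.card (Fin n → (Σ j, Fin (d j))) + 1, by positivity, ?_⟩
  filter_upwards [coef_close p L₀ one_pos] with L hL R hR
  have h1 : ∑ κ, coef p L R κ ≤ ∑ κ, (coef p L₀ R κ + 1) :=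
    Finset.sum_le_sum fun κ _ => by linarith [(abs_lt.1 (hL R hR κ)).2]
  rw [Finset.sum_add_distrib, Finset.sum_const, Finset.card_univ, nsmul_eq_mul, mul_one] at h1
  have h2 := (le_abs_self _).trans ((hD R hR).trans (le_abs_self D))
  linarith

lemma abs_expo_le (p : ι → ℝ) (κ : Fin n → (Σ j, Fin (d j))) (s : (Σ j, Fin (d j)) → ℝ) :
    |expo p κ s| ≤ (n + ∑ k : (Σ j, Fin (d j)), |p k.1|) * ‖s‖ := by
  have h0 : expo p κ s = (∑ a, s (κ a)) - ∑ k : (Σ j, Fin (d j)), p k.1 * s k := by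
    simp [expo, LinearMap.sum_apply]
  rw [h0, add_mul]
  refine (abs_sub _ _).trans (add_le_add ?_ ?_)
  · refine (Finset.abs_sum_le_sum_abs _ _).trans ?_
    calc _ ≤ ∑ _a : Fin n, ‖s‖ := Finset.sum_le_sum fun a _ => norm_le_pi_norm s (κ a)
      _ = _ := by simp
  · refine (Finset.abs_sum_le_sum_abs _ _).trans ?_
    rw [Finset.sum_mul]
    refine Finset.sum_le_sum fun k _ => ?_
    rw [abs_mul]
    exact mul_le_mul_of_nonneg_left (norm_le_pi_norm s k) (abs_nonneg _)

lemma Phi_dominated {p : ι → ℝ} (hp : ∀ j, 0 < p j) (n : ℕ) (d : ι → ℕ) :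
    ∃ C : ℝ, 0 ≤ C ∧ ∀ (L : ∀ j, Matrix (Fin (d j)) (Fin n) ℝ), ∀ R ∈ orthoSet d, ∀ s l, 0 < l →
      ∃ s', ‖s'‖ ≤ C * l ∧ Phi p L (diagW s' R) ≤ Phi p L (diagW s R) +
        (∑ κ, coef p L R κ) * Real.exp (-l) := by
  obtain ⟨C, hC, h⟩ := exists_bounded_dominated fun κ : Fin n → (Σ j, Fin (d j)) => expo p κ
  refine ⟨C, hC, fun L R hR s l hl => ?_⟩
  obtain ⟨s', h1, h2⟩ := h s l hl
  refine ⟨s', h1, ?_⟩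
  rw [Phi_diagW p L s' hR, Phi_diagW p L s hR, Finset.sum_mul, ← Finset.sum_add_distrib]
  refine Finset.sum_le_sum fun κ _ => ?_
  rw [← mul_add]
  refine mul_le_mul_of_nonneg_left ?_ (coef_nonneg hp L R κ)
  rcases le_max_iff.1 (h2 κ) with h3 | h3
  · have := Real.exp_le_exp.2 h3
    have := Real.exp_pos (-l)
    linarith
  · have := Real.exp_le_exp.2 h3
    have := Real.exp_pos (expo p κ s)
    linarith

lemma diagW_det_ne_zero (s : (Σ j, Fin (d j)) → ℝ) {R : ∀ j, Matrix (Fin (d j)) (Fin (d j)) ℝ}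
    (hR : R ∈ orthoSet d) (j : ι) : (diagW s R j).det ≠ 0 := by
  intro h
  have h1 := det_diagW s hR j
  rw [h] at h1
  have := Real.exp_pos (∑ i, s ⟨j, i⟩)
  rw [← h1] at this
  simp at this

/-- Semicontinuity of the Gaussian Brascamp–Lieb constant. -/
lemma Phi_lower_eventually {p : ι → ℝ} (hp : ∀ j, 0 < p j)
    {L₀ : ∀ j, Matrix (Fin (d j)) (Fin n) ℝ} {m : ℝ}
    (hm : ∀ W, (∀ j, (W j).det ≠ 0) → m ≤ Phi p L₀ W) {θ : ℝ} (hθ : 0 < θ) :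
    ∀ᶠ L in nhds L₀, ∀ W, (∀ j, (W j).det ≠ 0) → m - θ ≤ Phi p L W := by
  obtain ⟨C, hC, hdom⟩ := Phi_dominated hp n d
  obtain ⟨D, hD, hbd⟩ := coef_bound p L₀
  obtain ⟨l, hl0, hl⟩ : ∃ l : ℝ, 0 < l ∧ D * Real.exp (-l) ≤ θ / 2 := by
    have h1 : Filter.Tendsto (fun l : ℝ => D * Real.exp (-l)) Filter.atTop (nhds (D * 0)) :=
      (Real.tendsto_exp_neg_atTop_nhds_zero).const_mul D
    rw [mul_zero] at h1
    exact ((Filter.eventually_gt_atTop 0).and (h1.eventually (ge_mem_nhds (by linarith)))).exists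
  set c := (n + ∑ k : (Σ j, Fin (d j)), |p k.1|) with hc
  have hc0 : 0 ≤ c := by positivity
  set Q : ℝ := Fintype.card (Fin n → (Σ j, Fin (d j))) * Real.exp (c * (C * l)) + 1 with hQ
  have hQ0 : 0 < Q := by positivity
  filter_upwards [hbd, coef_close p L₀ (δ := θ / (2 * Q)) (by positivity)] with L hL hL2 W hW
  obtain ⟨s, R, hR, hWR⟩ := exists_diagW W hW
  rw [Phi_congr p L hWR]
  obtain ⟨s', hs', hs2⟩ := hdom L R hR s l hl0
  have h1 : (∑ κ, coef p L R κ) * Real.exp (-l) ≤ θ / 2 :=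
    (mul_le_mul_of_nonneg_right (hL R hR) (Real.exp_pos _).le).trans hl
  have h2 := hm (diagW s' R) (diagW_det_ne_zero s' hR)
  have h3 : Phi p L₀ (diagW s' R) - Phi p L (diagW s' R) ≤ θ / 2 := by
    rw [Phi_diagW p L s' hR, Phi_diagW p L₀ s' hR, ← Finset.sum_sub_distrib]
    calc _ ≤ ∑ _κ : Fin n → (Σ j, Fin (d j)), θ / (2 * Q) * Real.exp (c * (C * l)) := by
          refine Finset.sum_le_sum fun κ _ => ?_
          rw [← sub_mul]
          refine mul_le_mul ?_ (Real.exp_le_exp.2 ?_) (Real.exp_pos _).le (by positivity)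
          · linarith [(abs_lt.1 (hL2 R hR κ)).1]
          · exact (le_abs_self _).trans ((abs_expo_le p κ s').trans
              (mul_le_mul_of_nonneg_left hs' hc0))
      _ = θ / (2 * Q) * (Q - 1) := by
          rw [Finset.sum_const, Finset.card_univ, nsmul_eq_mul, hQ]; ring
      _ ≤ θ / (2 * Q) * Q := by gcongr; linarith
      _ = θ / 2 := by field_simp
  linarith

lemma nsq_diagW (s : (Σ j, Fin (d j)) → ℝ) (R : ∀ j, Matrix (Fin (d j)) (Fin (d j)) ℝ)
    (j : ι) (u : Fin (d j) → ℝ) :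
    nsq ((diagW s R j).mulVec u) = ∑ i, Real.exp (s ⟨j, i⟩) * ((R j).mulVec u i) ^ 2 := by
  rw [diagW, ← Matrix.mulVec_mulVec, nsq]
  refine Finset.sum_congr rfl fun i _ => ?_
  rw [Matrix.mulVec_diagonal, mul_pow, ← Real.exp_nat_mul]
  congr 2
  push_cast; ring

lemma nsq_of_orthogonal {k : ℕ} {R : Matrix (Fin k) (Fin k) ℝ} (hR : R * R.transpose = 1)
    (u : Fin k → ℝ) : nsq (R.mulVec u) = nsq u := by
  rw [← dot_transpose_mul_self, mul_eq_one_comm.1 hR, Matrix.one_mulVec, nsq_eq_dot]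

lemma nsq_diagW_bounds (s : (Σ j, Fin (d j)) → ℝ) {R : ∀ j, Matrix (Fin (d j)) (Fin (d j)) ℝ}
    (hR : R ∈ orthoSet d) (j : ι) (u : Fin (d j) → ℝ) :
    Real.exp (-‖s‖) * nsq u ≤ nsq ((diagW s R j).mulVec u) ∧
      nsq ((diagW s R j).mulVec u) ≤ Real.exp ‖s‖ * nsq u := by
  rw [nsq_diagW, ← nsq_of_orthogonal (hR j) u]
  simp only [nsq, Finset.mul_sum]
  have h : ∀ i, |s ⟨j, i⟩| ≤ ‖s‖ := fun i => norm_le_pi_norm s ⟨j, i⟩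
  constructor
  · exact Finset.sum_le_sum fun i _ => mul_le_mul_of_nonneg_right
      (Real.exp_le_exp.2 (abs_le.1 (h i)).1) (sq_nonneg _)
  · exact Finset.sum_le_sum fun i _ => mul_le_mul_of_nonneg_right
      (Real.exp_le_exp.2 (abs_le.1 (h i)).2) (sq_nonneg _)

end

lemma exists_sqrt {k : ℕ} (A : Matrix (Fin k) (Fin k) ℝ) (hA : A.transpose = A)
    (hpos : ∀ x, x ≠ 0 → 0 < x ⬝ᵥ A.mulVec x) :
    ∃ X : Matrix (Fin k) (Fin k) ℝ, X.det ≠ 0 ∧ A = X.transpose * X := by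
  obtain ⟨lam, R, hlam, hR, h⟩ := exists_orthogonal_diagonalization A hA hpos
  refine ⟨Matrix.diagonal (fun i => √(lam i)) * R, ?_, ?_⟩
  · rw [Matrix.det_mul, Matrix.det_diagonal]
    refine mul_ne_zero (Finset.prod_ne_zero_iff.2 fun i _ => (Real.sqrt_pos.2 (hlam i)).ne') ?_
    intro h0
    have := det_sq_of_orthogonal hR
    rw [h0] at this; norm_num at this
  · rw [h, Matrix.transpose_mul, Matrix.diagonal_transpose, Matrix.mul_assoc, Matrix.mul_assoc,
      ← Matrix.mul_assoc (Matrix.diagonal _) (Matrix.diagonal _), Matrix.diagonal_mul_diagonal]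
    congr 3
    ext i
    exact (Real.mul_self_sqrt (hlam i).le).symm

lemma nsq_zero {k : ℕ} : nsq (0 : Fin k → ℝ) = 0 := by simp [nsq]

section
variable {ι : Type*} [Fintype ι] {n : ℕ} {d : ι → ℕ}

lemma exists_sqrt_quadM {p : ι → ℝ} (hp : ∀ j, 0 < p j) {L : ∀ j, Matrix (Fin (d j)) (Fin n) ℝ}
    {c : ℝ} (hc : 0 < c) (hL : ∀ x, c * nsq x ≤ ∑ j, p j * nsq ((L j).mulVec x))
    {W : ∀ j, Matrix (Fin (d j)) (Fin (d j)) ℝ} (hW : ∀ j, (W j).det ≠ 0) :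
    ∃ X : Matrix (Fin n) (Fin n) ℝ, X.det ≠ 0 ∧ quadM p L W = X.transpose * X := by
  refine exists_sqrt _ (quadM_transpose _ _ _) fun x hx => ?_
  rw [dot_quadM]
  have h1 : 0 < ∑ j, p j * nsq ((L j).mulVec x) := (mul_pos hc (nsq_pos hx)).trans_le (hL x)
  obtain ⟨j, -, hj⟩ := Finset.exists_ne_zero_of_sum_ne_zero h1.ne'
  refine Finset.sum_pos' (fun i _ => mul_nonneg (hp i).le (nsq_nonneg _)) ⟨j, Finset.mem_univ j, ?_⟩
  refine mul_pos (hp j) (nsq_pos (mulVec_ne_zero_of_det (hW j) fun h0 => hj ?_))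
  rw [h0, nsq_zero, mul_zero]

lemma quad_bounds_eventually {p : ι → ℝ} (hp : ∀ j, 0 < p j)
    {L₀ : ∀ j, Matrix (Fin (d j)) (Fin n) ℝ} {m : ℝ} (hm0 : 0 < m)
    (hm : ∀ W, (∀ j, (W j).det ≠ 0) → m ≤ Phi p L₀ W) :
    ∃ c : ℝ, 0 < c ∧ ∀ᶠ L in nhds L₀, ∀ x, c * nsq x ≤ ∑ j, p j * nsq ((L j).mulVec x) ∧
      ∑ j, p j * nsq ((L j).mulVec x) ≤ c⁻¹ * nsq x := by
  set K : Set (Fin n → ℝ) := {x | nsq x = 1} with hKd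
  have hK : IsCompact K := by
    refine IsCompact.of_isClosed_subset (isCompact_univ_pi fun _ => isCompact_Icc (a := (-1 : ℝ))
      (b := 1)) (isClosed_eq continuous_nsq continuous_const) fun x hx i _ => abs_le.1 ?_
    have hx' : nsq x = 1 := hx
    rw [← sq_le_one_iff_abs_le_one, ← hx']
    exact Finset.single_le_sum (f := fun j => x j ^ 2) (fun _ _ => sq_nonneg _) (Finset.mem_univ i)
  set F : (∀ j, Matrix (Fin (d j)) (Fin n) ℝ) × (Fin n → ℝ) → ℝ :=
    fun z => ∑ j, p j * nsq ((z.1 j).mulVec z.2) with hF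
  have hFc : Continuous F := by
    refine continuous_finsetSum _ fun j _ => continuous_const.mul (continuous_nsq.comp ?_)
    have : Continuous fun z : (∀ j, Matrix (Fin (d j)) (Fin n) ℝ) × (Fin n → ℝ) => z.1 j :=
      (continuous_apply j).comp continuous_fst
    exact this.matrix_mulVec continuous_snd
  have hF0 : Continuous fun x => F (L₀, x) := hFc.comp (continuous_const.prodMk continuous_id)
  have hpos : ∀ x ∈ K, 0 < F (L₀, x) := by
    intro x hx
    have hx0 : x ≠ 0 := by
      rintro rfl
      have : nsq (0 : Fin n → ℝ) = 1 := hx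
      rw [nsq_zero] at this; norm_num at this
    refine lt_of_le_of_ne (Finset.sum_nonneg fun j _ => mul_nonneg (hp j).le (nsq_nonneg _)) ?_
    intro h0
    have h1 : ∀ j, (L₀ j).mulVec x = 0 := by
      intro j
      have := (Finset.sum_eq_zero_iff_of_nonneg fun j _ =>
        mul_nonneg (hp j).le (nsq_nonneg _)).1 h0.symm j (Finset.mem_univ j)
      by_contra hne
      exact (mul_pos (hp j) (nsq_pos hne)).ne' this
    have h2 : (quadM p L₀ fun _ => 1).mulVec x = 0 := by
      rw [quadM, Matrix.sum_mulVec]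
      refine Finset.sum_eq_zero fun j _ => ?_
      rw [Matrix.smul_mulVec, ← Matrix.mulVec_mulVec, Matrix.one_mul, h1, Matrix.mulVec_zero, smul_zero]
    have h3 : (quadM p L₀ fun _ => 1).det = 0 :=
      Matrix.exists_mulVec_eq_zero_iff.1 ⟨x, hx0, h2⟩
    have h4 := hm (fun _ => 1) (fun j => by rw [Matrix.det_one]; exact one_ne_zero)
    rw [Phi, h3, zero_mul] at h4
    linarith
  obtain ⟨c, hc, hcK⟩ := hK.exists_forall_le' hF0.continuousOn hpos
  obtain ⟨C, hC⟩ := hK.exists_bound_of_continuousOn hF0.continuousOn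
  have e1 : ∀ᶠ L in nhds L₀, ∀ x ∈ K, c / 2 < F (L, x) := by
    refine hK.eventually_forall_of_forall_eventually (P := fun L x => c / 2 < F (L, x)) fun x hx => ?_
    exact continuousAt_const.eventually_lt hFc.continuousAt (by linarith [hcK x hx])
  have e2 : ∀ᶠ L in nhds L₀, ∀ x ∈ K, F (L, x) < |C| + 1 := by
    refine hK.eventually_forall_of_forall_eventually (P := fun L x => F (L, x) < |C| + 1) fun x hx => ?_
    refine hFc.continuousAt.eventually_lt continuousAt_const ?_
    have := (le_abs_self _).trans ((hC x hx).trans (le_abs_self C))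
    linarith
  refine ⟨min (c / 2) (|C| + 1)⁻¹, by positivity, ?_⟩
  filter_upwards [e1, e2] with L h1 h2 x
  change _ ≤ F (L, x) ∧ F (L, x) ≤ _
  by_cases hx : x = 0
  · have : F (L, x) = 0 := by
      simp [hF, hx, nsq_zero]
    rw [this, hx, nsq_zero]; simp
  have hr2 : √(nsq x) ^ 2 = nsq x := Real.sq_sqrt (nsq_nonneg x)
  have hr0 : 0 < √(nsq x) := Real.sqrt_pos.2 (nsq_pos hx)
  have hxK : (√(nsq x))⁻¹ • x ∈ K := by
    change nsq _ = 1
    rw [nsq_smul, inv_pow, hr2, inv_mul_cancel₀ (nsq_pos hx).ne']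
  have hFx : F (L, x) = nsq x * F (L, (√(nsq x))⁻¹ • x) := by
    simp only [hF, Matrix.mulVec_smul, nsq_smul, Finset.mul_sum, inv_pow, hr2]
    refine Finset.sum_congr rfl fun j _ => ?_
    have := (nsq_pos hx).ne'
    field_simp
  have g1 := h1 _ hxK
  have g2 := h2 _ hxK
  rw [hFx]
  have hn := nsq_nonneg x
  constructor
  · rw [mul_comm]
    exact mul_le_mul_of_nonneg_left ((min_le_left _ _).trans g1.le) hn
  · rw [mul_comm _ (nsq x)]
    refine mul_le_mul_of_nonneg_left (g2.le.trans ?_) hn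
    rw [le_inv_comm₀ (by positivity) (by positivity)]
    exact min_le_right _ _

/-- Testing the Brascamp–Lieb inequality on Gaussians. -/
lemma Phi_lower_of_gaussian {p : ι → ℝ} (hp : ∀ j, 0 < p j)
    {L : ∀ j, Matrix (Fin (d j)) (Fin n) ℝ} {b : ℝ} (hb : 0 < b)
    {W : ∀ j, Matrix (Fin (d j)) (Fin (d j)) ℝ} (hW : ∀ j, (W j).det ≠ 0)
    (h : ∫⁻ x, ∏ j, gam ((W j).mulVec ((L j).mulVec x)) ^ p j ≤
      ENNReal.ofReal b * ∏ j, (∫⁻ u, gam ((W j).mulVec u)) ^ p j) :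
    (b ^ 2)⁻¹ ≤ Phi p L W := by
  have hg : ∀ j, ∫⁻ u, gam ((W j).mulVec u) = ENNReal.ofReal |(W j).det|⁻¹ := fun j => by
    rw [lintegral_comp_mulVec _ measurable_gam _ (hW j), lintegral_gam, mul_one]
  set π' := ∏ j, |(W j).det| ^ (-p j) with hπ
  have hdp : ∀ j, 0 < |(W j).det| := fun j => abs_pos.2 (hW j)
  have hπ0 : 0 < π' := Finset.prod_pos fun j _ => Real.rpow_pos_of_pos (hdp j) _
  have hR : ∏ j, (∫⁻ u, gam ((W j).mulVec u)) ^ p j = ENNReal.ofReal π' := by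
    rw [hπ, ENNReal.ofReal_prod_of_nonneg fun j _ => (Real.rpow_pos_of_pos (hdp j) _).le]
    refine Finset.prod_congr rfl fun j _ => ?_
    rw [hg, ENNReal.ofReal_rpow_of_pos (inv_pos.2 (hdp j)), Real.inv_rpow (hdp j).le,
      Real.rpow_neg (hdp j).le]
  have hπ2 : π' ^ 2 = ∏ j, ((W j).det ^ 2) ^ (-p j) := by
    rw [hπ, ← Finset.prod_pow]
    refine Finset.prod_congr rfl fun j _ => ?_
    rw [← sq_abs (W j).det, ← Real.rpow_natCast, ← Real.rpow_natCast, ← Real.rpow_mul (hdp j).le,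
      ← Real.rpow_mul (hdp j).le, mul_comm]
  have key : ∀ δ : ℝ, 0 < δ → (b ^ 2)⁻¹ ≤ (quadM p L W + δ • 1).det * π' ^ 2 := by
    intro δ hδ
    have hdot : ∀ x, x ⬝ᵥ (quadM p L W + δ • 1).mulVec x =
        (∑ j, p j * nsq ((W j).mulVec ((L j).mulVec x))) + δ * nsq x := by
      intro x
      rw [Matrix.add_mulVec, dotProduct_add, dot_quadM, Matrix.smul_mulVec, Matrix.one_mulVec,
        dotProduct_smul, nsq_eq_dot, smul_eq_mul]
    obtain ⟨X, hX, hXM⟩ := exists_sqrt (quadM p L W + δ • 1) (by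
      rw [Matrix.transpose_add, quadM_transpose, Matrix.transpose_smul, Matrix.transpose_one])
      (fun x hx => by
        rw [hdot]
        have := mul_pos hδ (nsq_pos hx)
        have h2 : 0 ≤ ∑ j, p j * nsq ((W j).mulVec ((L j).mulVec x)) :=
          Finset.sum_nonneg fun j _ => mul_nonneg (hp j).le (nsq_nonneg _)
        linarith)
    have h1 : ENNReal.ofReal |X.det|⁻¹ ≤ ENNReal.ofReal (b * π') := by
      rw [ENNReal.ofReal_mul hb.le, ← hR]
      refine le_trans ?_ h
      have := lintegral_comp_mulVec gam measurable_gam X hX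
      rw [lintegral_gam, mul_one] at this
      rw [← this]
      refine lintegral_mono fun x => ?_
      rw [prod_gam_rpow, gam]
      refine ENNReal.ofReal_le_ofReal (Real.exp_le_exp.2 ?_)
      have h2 := hdot x
      rw [hXM, dot_transpose_mul_self] at h2
      rw [h2]
      have := mul_nonneg hδ.le (nsq_nonneg x)
      nlinarith [Real.pi_pos]
    rw [ENNReal.ofReal_le_ofReal_iff (by positivity)] at h1
    have hXp := abs_pos.2 hX
    have h3 : (quadM p L W + δ • 1).det = |X.det| ^ 2 := by
      rw [hXM, Matrix.det_mul, Matrix.det_transpose, sq_abs, sq]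
    rw [h3, ← mul_pow, ← inv_pow]
    refine pow_le_pow_left₀ (by positivity) ?_ 2
    rw [inv_le_iff_one_le_mul₀ hb]
    rw [inv_le_iff_one_le_mul₀ hXp] at h1
    linarith
  have hcont : Continuous fun δ : ℝ => (quadM p L W + δ • (1 : Matrix (Fin n) (Fin n) ℝ)).det * π' ^ 2 :=
    (Continuous.matrix_det (by fun_prop)).mul continuous_const
  have hlim : Filter.Tendsto (fun δ : ℝ => (quadM p L W + δ • (1 : Matrix (Fin n) (Fin n) ℝ)).det * π' ^ 2)
      (nhdsWithin 0 (Set.Ioi 0)) (nhds ((quadM p L W + (0 : ℝ) • 1).det * π' ^ 2)) :=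
    hcont.continuousAt.tendsto.mono_left nhdsWithin_le_nhds
  have := ge_of_tendsto hlim (Filter.eventually_of_mem self_mem_nhdsWithin fun δ hδ => key δ hδ)
  rwa [zero_smul, add_zero, hπ2] at this

end

section
variable {ι : Type*} [Fintype ι] {n : ℕ} {d : ι → ℕ}

/-- Near-extremising Gaussian data of controlled eccentricity. -/
structure GoodData (p : ι → ℝ) (L : ∀ j, Matrix (Fin (d j)) (Fin n) ℝ) (N : ℕ) (η : ℝ)
    (W : ∀ j, Matrix (Fin (d j)) (Fin (d j)) ℝ) (X : Matrix (Fin n) (Fin n) ℝ) : Prop where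
  det_W : ∀ j, (W j).det ≠ 0
  det_X : X.det ≠ 0
  quad : quadM p L W = X.transpose * X
  sum_eq : ∀ x, ∑ j, p j * nsq ((W j).mulVec ((L j).mulVec x)) = nsq (X.mulVec x)
  near : ∀ j x, nsq ((W j).mulVec ((L j).mulVec x)) ≤ (1 + η) * nsq (X.mulVec x)
  W_lower : ∀ j u, η ^ N * nsq u ≤ nsq ((W j).mulVec u)
  W_upper : ∀ j u, nsq ((W j).mulVec u) ≤ (η ^ N)⁻¹ * nsq u
  X_lower : ∀ x, η ^ N * nsq x ≤ nsq (X.mulVec x)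
  X_upper : ∀ x, nsq (X.mulVec x) ≤ (η ^ N)⁻¹ * nsq x

lemma exists_goodData {p : ι → ℝ} (hp : ∀ j, 0 < p j) (hp1 : ∀ j, p j ≤ 1)
    {L₀ : ∀ j, Matrix (Fin (d j)) (Fin n) ℝ} {m θ : ℝ} (hθ : 0 < θ) (hθm : θ < m)
    (hm : ∀ W, (∀ j, (W j).det ≠ 0) → m ≤ Phi p L₀ W) :
    ∃ N : ℕ, ∃ η₀ : ℝ, 0 < η₀ ∧ η₀ ≤ 1 ∧ ∀ᶠ L in nhds L₀,
      (∀ W, (∀ j, (W j).det ≠ 0) → m - θ ≤ Phi p L W) ∧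
      ∀ η, 0 < η → η < η₀ → ∃ W X, GoodData p L N η W X := by
  obtain ⟨D, hD, hDev⟩ := coef_bound p L₀
  obtain ⟨c0, hc0, hc0ev⟩ := quad_bounds_eventually hp (hθ.trans hθm) hm
  obtain ⟨C, hC0, hC⟩ := Phi_dominated hp n d
  have hm1 : 0 < m - θ := sub_pos.2 hθm
  set c : ℝ := 1 / (8 * (1 + ∑ j, 1 / p j)) with hc
  have hsum : 0 ≤ ∑ j, 1 / p j := Finset.sum_nonneg fun j _ => (one_div_pos.2 (hp j)).le
  have hcpos : 0 < c := by positivity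
  have hcp : ∀ j, c ≤ p j / 8 := fun j => by
    have h1 : 1 / p j ≤ ∑ j, 1 / p j :=
      Finset.single_le_sum (f := fun j => 1 / p j) (fun j _ => (one_div_pos.2 (hp j)).le)
        (Finset.mem_univ j)
    have h2 : 1 ≤ p j * (1 + ∑ j, 1 / p j) := by
      have := mul_le_mul_of_nonneg_left h1 (hp j).le
      rw [mul_one_div_cancel (hp j).ne'] at this
      nlinarith [hp j]
    rw [hc, div_le_div_iff₀ (by positivity) (by norm_num)]
    nlinarith
  set K : ℕ := ⌈3 * C⌉₊ with hK
  refine ⟨K + 1, min (min 1 c0) (c * (m - θ) / (3 * D)), by positivity,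
    (min_le_left _ _).trans (min_le_left _ _), ?_⟩
  filter_upwards [hDev, hc0ev, Phi_lower_eventually hp hm hθ] with L hD' hq hlow
  refine ⟨hlow, fun η hη hη0 => ?_⟩
  have hη1 : η < 1 := hη0.trans_le ((min_le_left _ _).trans (min_le_left _ _))
  have hηc : η ≤ c0 := (hη0.trans_le ((min_le_left _ _).trans (min_le_right _ _))).le
  have hηD : D * η ≤ c * (m - θ) / 3 := by
    have := (hη0.trans_le (min_le_right _ _)).le
    rw [le_div_iff₀ (by positivity)] at this
    linarith
  set S : Set ℝ := {y | ∃ W, (∀ j, (W j).det ≠ 0) ∧ y = Phi p L W} with hS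
  have hSne : S.Nonempty := ⟨_, fun _ => 1, fun j => by rw [Matrix.det_one]; exact one_ne_zero, rfl⟩
  have hSb : BddBelow S := ⟨m - θ, by rintro _ ⟨W, hW, rfl⟩; exact hlow W hW⟩
  set I := sInf S with hI
  have hIm : m - θ ≤ I := le_csInf hSne (by rintro _ ⟨W, hW, rfl⟩; exact hlow W hW)
  have hI0 : 0 < I := hm1.trans_le hIm
  have hIle : ∀ W, (∀ j, (W j).det ≠ 0) → I ≤ Phi p L W := fun W hW => csInf_le hSb ⟨W, hW, rfl⟩
  have hlt : I < I * (1 + c / 3 * η ^ 2) := by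
    have : 0 < I * (c / 3 * η ^ 2) := by positivity
    linarith
  obtain ⟨_, ⟨W, hW, rfl⟩, hWlt⟩ := exists_lt_of_csInf_lt hSne hlt
  obtain ⟨s, R, hR, hWR⟩ := exists_diagW W hW
  have hl : 0 < -(3 * Real.log η) := by
    have := Real.log_neg hη hη1
    linarith
  obtain ⟨s', hs', hPhi⟩ := hC L R hR s _ hl
  rw [← Phi_congr p L hWR, neg_neg] at hPhi
  have he3 : Real.exp (3 * Real.log η) = η ^ 3 := by
    rw [← Real.rpow_natCast η 3, Real.rpow_def_of_pos hη]; push_cast; ring_nf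
  rw [he3] at hPhi
  set W' := diagW s' R with hW'
  have hdet : ∀ j, (W' j).det ≠ 0 := diagW_det_ne_zero s' hR
  have hmax : Phi p L W' ≤ (1 + c * η ^ 2) * I := by
    have h1 : (∑ κ, coef p L R κ) * η ^ 3 ≤ D * η ^ 3 :=
      mul_le_mul_of_nonneg_right (hD' R hR) (by positivity)
    have h2 : D * η ^ 3 ≤ c / 3 * η ^ 2 * I := by
      have := mul_le_mul_of_nonneg_right hηD (sq_nonneg η)
      have h3 : c * (m - θ) / 3 * η ^ 2 ≤ c / 3 * η ^ 2 * I := by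
        have := mul_le_mul_of_nonneg_left hIm (by positivity : 0 ≤ c / 3 * η ^ 2)
        linarith
      linarith
    have h3 : 0 < c * η ^ 2 * I := by positivity
    linarith
  obtain ⟨X, hX, hXM⟩ := exists_sqrt_quadM (L := L) hp hc0 (fun x => (hq x).1) hdet
  have hsum_eq : ∀ x, ∑ j, p j * nsq ((W' j).mulVec ((L j).mulVec x)) = nsq (X.mulVec x) := by
    intro x; rw [← dot_quadM, hXM, dot_transpose_mul_self]
  have hnorm : Real.exp ‖s'‖ ≤ (η ^ K)⁻¹ := by
    rw [← Real.rpow_natCast, ← Real.rpow_neg hη.le, Real.rpow_def_of_pos hη]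
    refine Real.exp_le_exp.2 (hs'.trans ?_)
    have := Nat.le_ceil (3 * C)
    have hlog := (Real.log_neg hη hη1).le
    nlinarith
  have hηK : 0 < η ^ K := by positivity
  have hnorm' : η ^ K ≤ Real.exp (-‖s'‖) := by
    rw [Real.exp_neg]; exact (le_inv_comm₀ (Real.exp_pos _) hηK).1 hnorm
  have hb := fun j u => nsq_diagW_bounds s' hR j u
  have hηK1 : η ^ (K + 1) ≤ η ^ K := pow_le_pow_of_le_one hη.le hη1.le (Nat.le_succ K)
  have hηK1' : (η ^ K)⁻¹ ≤ (η ^ (K + 1))⁻¹ := inv_anti₀ (by positivity) hηK1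
  refine ⟨W', X, hdet, hX, hXM, hsum_eq, fun j x => ?_, fun j u => ?_, fun j u => ?_, fun x => ?_,
    fun x => ?_⟩
  · refine nearCritical_of_nearMax hp hp1 hdet hX hXM hη hη1.le j (fun V hV => hmax.trans ?_) x
    have h1 : c * η ^ 2 ≤ p j / 8 * η ^ 2 := mul_le_mul_of_nonneg_right (hcp j) (sq_nonneg η)
    exact mul_le_mul (by linarith) (hIle V hV) hI0.le
      (by have := hp j; positivity)
  · exact (mul_le_mul_of_nonneg_right (hηK1.trans hnorm') (nsq_nonneg u)).trans (hb j u).1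
  · exact (hb j u).2.trans (mul_le_mul_of_nonneg_right (hnorm.trans hηK1') (nsq_nonneg u))
  · rw [← hsum_eq]
    calc η ^ (K + 1) * nsq x ≤ Real.exp (-‖s'‖) * (c0 * nsq x) := by
          rw [pow_succ, mul_assoc]
          have := nsq_nonneg x
          gcongr
      _ ≤ Real.exp (-‖s'‖) * ∑ j, p j * nsq ((L j).mulVec x) := by
          have := (hq x).1
          gcongr
      _ ≤ _ := by
          rw [Finset.mul_sum]
          refine Finset.sum_le_sum fun j _ => ?_
          rw [mul_left_comm]
          exact mul_le_mul_of_nonneg_left (hb j _).1 (hp j).le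
  · rw [← hsum_eq]
    calc ∑ j, p j * nsq ((W' j).mulVec ((L j).mulVec x))
        ≤ Real.exp ‖s'‖ * ∑ j, p j * nsq ((L j).mulVec x) := by
          rw [Finset.mul_sum]
          refine Finset.sum_le_sum fun j _ => ?_
          rw [mul_left_comm]
          exact mul_le_mul_of_nonneg_left (hb j _).2 (hp j).le
      _ ≤ (η ^ K)⁻¹ * (c0⁻¹ * nsq x) := mul_le_mul hnorm (hq x).2
          (Finset.sum_nonneg fun j _ => mul_nonneg (hp j).le (nsq_nonneg _)) (by positivity)
      _ ≤ _ := by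
          rw [pow_succ, mul_inv, mul_assoc]
          have := nsq_nonneg x
          have : c0⁻¹ ≤ η⁻¹ := inv_anti₀ hη hηc
          gcongr

/-- The Gaussian constant is controlled by a lower bound of `Phi`. -/
lemma inv_det_le_of_Phi_lower {p : ι → ℝ} {L : ∀ j, Matrix (Fin (d j)) (Fin n) ℝ} {b : ℝ} (hb : 0 < b)
    {W : ∀ j, Matrix (Fin (d j)) (Fin (d j)) ℝ} (hW : ∀ j, (W j).det ≠ 0)
    {X : Matrix (Fin n) (Fin n) ℝ} (hX : X.det ≠ 0) (hXM : quadM p L W = X.transpose * X)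
    (h : (b ^ 2)⁻¹ ≤ Phi p L W) :
    |X.det|⁻¹ ≤ b * ∏ j, (|(W j).det|⁻¹) ^ p j := by
  have hdp : ∀ j, 0 < |(W j).det| := fun j => abs_pos.2 (hW j)
  set π' := ∏ j, (|(W j).det|⁻¹) ^ p j with hπ
  have hπ0 : 0 < π' := Finset.prod_pos fun j _ => Real.rpow_pos_of_pos (inv_pos.2 (hdp j)) _
  have hπ2 : π' ^ 2 = ∏ j, ((W j).det ^ 2) ^ (-p j) := by
    rw [hπ, ← Finset.prod_pow]
    refine Finset.prod_congr rfl fun j _ => ?_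
    rw [← sq_abs (W j).det, ← Real.rpow_natCast, ← Real.rpow_natCast, Real.inv_rpow (hdp j).le,
      ← Real.rpow_neg (hdp j).le, ← Real.rpow_mul (hdp j).le,
      ← Real.rpow_mul (hdp j).le, mul_comm]
  rw [Phi, ← hπ2, hXM, Matrix.det_mul, Matrix.det_transpose, ← sq, ← sq_abs X.det, ← mul_pow,
    ← inv_pow] at h
  have h1 := (pow_le_pow_iff_left₀ (by positivity) (by positivity) two_ne_zero).1 h
  have hXp := abs_pos.2 hX
  rw [inv_le_iff_one_le_mul₀ hXp]
  rw [inv_le_iff_one_le_mul₀ hb] at h1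
  linarith

end

lemma sq_norm_le_nsq {k : ℕ} (x : Fin k → ℝ) : ‖x‖ ^ 2 ≤ nsq x := by
  have h : ‖x‖ ≤ √(nsq x) := by
    refine (pi_norm_le_iff_of_nonneg (Real.sqrt_nonneg _)).2 fun i => ?_
    rw [Real.norm_eq_abs]
    refine Real.abs_le_sqrt ?_
    exact Finset.single_le_sum (f := fun j => x j ^ 2) (fun _ _ => sq_nonneg _) (Finset.mem_univ i)
  calc ‖x‖ ^ 2 ≤ √(nsq x) ^ 2 := pow_le_pow_left₀ (norm_nonneg _) h 2
    _ = nsq x := Real.sq_sqrt (nsq_nonneg x)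

lemma nsq_le_norm_sq {k : ℕ} (x : Fin k → ℝ) : nsq x ≤ k * ‖x‖ ^ 2 :=
  nsq_le_of_abs_le fun i => norm_le_pi_norm x i

/-- Comparison of a quadratic form at two points. -/
lemma nsq_mulVec_le {k l : ℕ} {W : Matrix (Fin l) (Fin k) ℝ} {Q : ℝ} (hQ : 0 ≤ Q)
    (hW : ∀ u, nsq (W.mulVec u) ≤ Q * nsq u) (a b : Fin k → ℝ) :
    nsq (W.mulVec b) ≤ nsq (W.mulVec a) + Q * k * (‖b - a‖ * (‖a‖ + ‖b‖)) := by
  have h1 : nsq (W.mulVec b) = nsq (W.mulVec a) + W.mulVec (b - a) ⬝ᵥ W.mulVec (b + a) := by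
    rw [Matrix.mulVec_sub, Matrix.mulVec_add]
    simp only [nsq, dotProduct, Pi.sub_apply, Pi.add_apply]
    rw [← Finset.sum_add_distrib]
    exact Finset.sum_congr rfl fun i _ => by ring
  rw [h1]
  refine add_le_add_right (le_trans (abs_le_of_sq_le_sq' ?_ (by positivity)).2 le_rfl) _
  calc (W.mulVec (b - a) ⬝ᵥ W.mulVec (b + a)) ^ 2
      ≤ nsq (W.mulVec (b - a)) * nsq (W.mulVec (b + a)) := dot_sq_le _ _
    _ ≤ (Q * (k * ‖b - a‖ ^ 2)) * (Q * (k * (‖a‖ + ‖b‖) ^ 2)) := by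
        refine mul_le_mul ((hW _).trans ?_) ((hW _).trans ?_) (nsq_nonneg _) (by positivity)
        · exact mul_le_mul_of_nonneg_left (nsq_le_norm_sq _) hQ
        · refine mul_le_mul_of_nonneg_left ((nsq_le_norm_sq _).trans ?_) hQ
          have : ‖b + a‖ ≤ ‖a‖ + ‖b‖ := (norm_add_le _ _).trans (add_comm _ _).le
          gcongr
    _ = (Q * k * (‖b - a‖ * (‖a‖ + ‖b‖))) ^ 2 := by ring

lemma gam_mulVec_le {k l : ℕ} {W : Matrix (Fin l) (Fin k) ℝ} {Q : ℝ} (hQ : 0 ≤ Q)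
    (hW : ∀ u, nsq (W.mulVec u) ≤ Q * nsq u) {a b : Fin k → ℝ} {e : ℝ}
    (he : ‖b - a‖ * (‖a‖ + ‖b‖) ≤ e) :
    gam (W.mulVec a) ≤ ENNReal.ofReal (Real.exp (Real.pi * (Q * k * e))) * gam (W.mulVec b) := by
  rw [gam, gam, ← ENNReal.ofReal_mul (Real.exp_pos _).le, ← Real.exp_add]
  refine ENNReal.ofReal_le_ofReal (Real.exp_le_exp.2 ?_)
  have h1 := nsq_mulVec_le hQ hW a b
  have h2 : Q * k * (‖b - a‖ * (‖a‖ + ‖b‖)) ≤ Q * k * e := by gcongr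
  nlinarith [Real.pi_pos]

lemma lintegral_gam_mulVec {k : ℕ} {Y : Matrix (Fin k) (Fin k) ℝ} (hY : Y.det ≠ 0) :
    ∫⁻ u, gam (Y.mulVec u) = ENNReal.ofReal |Y.det|⁻¹ := by
  rw [lintegral_comp_mulVec _ measurable_gam _ hY, lintegral_gam, mul_one]

/-- A Gaussian carries most of its mass on a large ball. -/
lemma gaussian_tail {k : ℕ} {Y : Matrix (Fin k) (Fin k) ℝ} (hY : Y.det ≠ 0) {q r τ : ℝ} (hq : 0 ≤ q)
    (hr : 0 ≤ r) (hYq : ∀ u, q * nsq u ≤ nsq (Y.mulVec u))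
    (hτ : 2 ^ k * Real.exp (-(Real.pi * (q * r ^ 2) / 2)) ≤ τ) :
    ENNReal.ofReal (1 - τ) * ENNReal.ofReal |Y.det|⁻¹ ≤
      ∫⁻ u in Metric.closedBall 0 r, gam (Y.mulVec u) := by
  have hYp := inv_pos.2 (abs_pos.2 hY)
  have hdet2 : ((1 / 2 : ℝ) • Y).det ≠ 0 := by
    rw [Matrix.det_smul]; exact mul_ne_zero (by positivity) hY
  have h2 : ∫⁻ u in (Metric.closedBall 0 r)ᶜ, gam (Y.mulVec u) ≤ ENNReal.ofReal (τ * |Y.det|⁻¹) := by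
    calc ∫⁻ u in (Metric.closedBall 0 r)ᶜ, gam (Y.mulVec u)
        ≤ ∫⁻ u in (Metric.closedBall 0 r)ᶜ, ENNReal.ofReal (Real.exp (-(Real.pi * (q * r ^ 2) / 2))) *
            gam (((1 / 2 : ℝ) • Y).mulVec u) := by
          refine setLIntegral_mono' Metric.isClosed_closedBall.measurableSet.compl fun u hu => ?_
          rw [Set.mem_compl_iff, Metric.mem_closedBall, dist_zero_right, not_le] at hu
          rw [Matrix.smul_mulVec, gam, gam, ← ENNReal.ofReal_mul (Real.exp_pos _).le, ← Real.exp_add,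
            nsq_smul]
          refine ENNReal.ofReal_le_ofReal (Real.exp_le_exp.2 ?_)
          have h3 : q * r ^ 2 ≤ nsq (Y.mulVec u) := by
            refine le_trans ?_ (hYq u)
            have := sq_norm_le_nsq u
            have : r ^ 2 ≤ ‖u‖ ^ 2 := pow_le_pow_left₀ hr hu.le 2
            gcongr
            linarith
          have h4 := nsq_nonneg (Y.mulVec u)
          nlinarith [Real.pi_pos]
      _ ≤ ∫⁻ u, ENNReal.ofReal (Real.exp (-(Real.pi * (q * r ^ 2) / 2))) *
            gam (((1 / 2 : ℝ) • Y).mulVec u) := setLIntegral_le_lintegral _ _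
      _ = ENNReal.ofReal (Real.exp (-(Real.pi * (q * r ^ 2) / 2))) *
            ENNReal.ofReal (2 ^ k * |Y.det|⁻¹) := by
          rw [lintegral_const_mul' _ _ ENNReal.ofReal_ne_top, lintegral_gam_mulVec hdet2,
            Matrix.det_smul, abs_mul, mul_inv, Fintype.card_fin, abs_of_pos (by positivity), one_div,
            inv_pow, inv_inv]
      _ ≤ _ := by
          rw [← ENNReal.ofReal_mul (Real.exp_pos _).le]
          refine ENNReal.ofReal_le_ofReal ?_
          rw [← mul_assoc, mul_comm (Real.exp _)]
          exact mul_le_mul_of_nonneg_right hτ hYp.le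
  have h5 := lintegral_add_compl (μ := volume) (fun u => gam (Y.mulVec u))
    (Metric.isClosed_closedBall (x := (0 : Fin k → ℝ)) (ε := r)).measurableSet
  rw [lintegral_gam_mulVec hY] at h5
  have hτ0 : 0 ≤ τ := le_trans (by positivity) hτ
  rw [← ENNReal.ofReal_mul' hYp.le, sub_mul, one_mul, ENNReal.ofReal_sub _ (by positivity), ← h5]
  exact tsub_le_iff_right.2 (add_le_add_right h2 _)

section
variable {ι : Type*} [Fintype ι] {n : ℕ} {d : ι → ℕ}

/-- A family of maps with uniformly controlled first order Taylor expansions near `x₀`. -/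
structure LocalModel (B : ∀ j, (Fin n → ℝ) → (Fin (d j) → ℝ))
    (A : (Fin n → ℝ) → ∀ j, Matrix (Fin (d j)) (Fin n) ℝ) (x₀ : Fin n → ℝ) (ρ H : ℝ) : Prop where
  one_le : 1 ≤ H
  meas : ∀ j, Measurable (B j)
  lip : ∀ j, ∀ x ∈ Metric.closedBall x₀ ρ, ∀ y ∈ Metric.closedBall x₀ ρ,
    ‖B j x - B j y‖ ≤ H * ‖x - y‖
  lin : ∀ j, ∀ z ∈ Metric.closedBall x₀ ρ, ∀ u, ‖(A z j).mulVec u‖ ≤ H * ‖u‖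
  taylor : ∀ j, ∀ z ∈ Metric.closedBall x₀ ρ, ∀ x ∈ Metric.closedBall x₀ ρ,
    ∀ y ∈ Metric.closedBall x₀ ρ,
    ‖B j x - B j y - (A z j).mulVec (x - y)‖ ≤ H * max ‖x - z‖ ‖y - z‖ * ‖x - y‖

/-- Near-extremising Gaussian data, localised at a certain scale. -/
structure ScaledData (p : ι → ℝ) (A : ∀ j, Matrix (Fin (d j)) (Fin n) ℝ) (η q Q : ℝ)
    (V : ∀ j, Matrix (Fin (d j)) (Fin (d j)) ℝ) (Y : Matrix (Fin n) (Fin n) ℝ) : Prop where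
  det_V : ∀ j, (V j).det ≠ 0
  det_Y : Y.det ≠ 0
  sum_eq : ∀ x, ∑ j, p j * nsq ((V j).mulVec ((A j).mulVec x)) = nsq (Y.mulVec x)
  near : ∀ j x, nsq ((V j).mulVec ((A j).mulVec x)) ≤ (1 + η) * nsq (Y.mulVec x)
  V_lower : ∀ j u, q * nsq u ≤ nsq ((V j).mulVec u)
  V_upper : ∀ j u, nsq ((V j).mulVec u) ≤ Q * nsq u
  Y_lower : ∀ x, q * nsq x ≤ nsq (Y.mulVec x)
  Y_upper : ∀ x, nsq (Y.mulVec x) ≤ Q * nsq x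

lemma prod_gam_eq {p : ι → ℝ} {A : ∀ j, Matrix (Fin (d j)) (Fin n) ℝ} {η q Q : ℝ}
    {V : ∀ j, Matrix (Fin (d j)) (Fin (d j)) ℝ} {Y : Matrix (Fin n) (Fin n) ℝ}
    (S : ScaledData p A η q Q V Y) (x : Fin n → ℝ) :
    ∏ j, gam ((V j).mulVec ((A j).mulVec x)) ^ p j = gam (Y.mulVec x) := by
  rw [prod_gam_rpow, S.sum_eq, gam]

/-- Product form of pointwise comparisons with exponential losses. -/
lemma prod_rpow_le_exp {p : ι → ℝ} (hp : ∀ j, 0 < p j) {F G : ι → ℝ≥0∞} {w : ι → ℝ}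
    (h : ∀ j, F j ≤ ENNReal.ofReal (Real.exp (w j)) * G j) :
    ∏ j, F j ^ p j ≤ ENNReal.ofReal (Real.exp (∑ j, p j * w j)) * ∏ j, G j ^ p j := by
  calc ∏ j, F j ^ p j ≤ ∏ j, (ENNReal.ofReal (Real.exp (w j)) * G j) ^ p j :=
        Finset.prod_le_prod' fun j _ => ENNReal.rpow_le_rpow (h j) (hp j).le
    _ = _ := by
      simp_rw [ENNReal.mul_rpow_of_nonneg _ _ (hp _).le]
      rw [Finset.prod_mul_distrib, Real.exp_sum,
        ENNReal.ofReal_prod_of_nonneg fun j _ => (Real.exp_pos _).le]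
      congr 1
      refine Finset.prod_congr rfl fun j _ => ?_
      rw [ENNReal.ofReal_rpow_of_pos (Real.exp_pos _), ← Real.exp_mul, mul_comm]

end

section
variable {ι : Type*} [Fintype ι] {n : ℕ} {d : ι → ℕ}

/-- Averaging against a Gaussian concentrated on a small ball. -/
lemma gaussian_average_le {Y : Matrix (Fin n) (Fin n) ℝ} {F : (Fin n → ℝ) → ℝ≥0∞} (hF : Measurable F)
    (z : Fin n → ℝ) (R r : ℝ) :
    (∫⁻ w in Metric.closedBall 0 r, gam (Y.mulVec w)) * ∫⁻ x in Metric.closedBall z R, F x ≤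
      ∫⁻ y in Metric.closedBall z (R + r), ∫⁻ x in Metric.closedBall y r,
        F x * gam (Y.mulVec (x - y)) := by
  have hG : Measurable fun w : Fin n → ℝ => gam (Y.mulVec w) :=
    measurable_gam.comp (by fun_prop : Continuous fun w => Y.mulVec w).measurable
  set k : (Fin n → ℝ) → ℝ≥0∞ := (Metric.closedBall 0 r).indicator fun w => gam (Y.mulVec w) with hk
  have hkm : Measurable k := hG.indicator Metric.isClosed_closedBall.measurableSet
  have hB : MeasurableSet (Metric.closedBall z R) := Metric.isClosed_closedBall.measurableSet
  have hB' : MeasurableSet (Metric.closedBall z (R + r)) := Metric.isClosed_closedBall.measurableSet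
  calc (∫⁻ w in Metric.closedBall 0 r, gam (Y.mulVec w)) * ∫⁻ x in Metric.closedBall z R, F x
      = ∫⁻ x, (Metric.closedBall z R).indicator F x * ∫⁻ y, k (x - y) := by
        have h1 : ∀ x, ∫⁻ y, k (x - y) = ∫⁻ w in Metric.closedBall 0 r, gam (Y.mulVec w) := by
          intro x
          rw [lintegral_sub_left_eq_self k x, hk,
            lintegral_indicator Metric.isClosed_closedBall.measurableSet]
        simp_rw [h1]
        rw [lintegral_mul_const _ (hF.indicator hB), lintegral_indicator hB, mul_comm]
    _ = ∫⁻ x, ∫⁻ y, (Metric.closedBall z R).indicator F x * k (x - y) := by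
        refine lintegral_congr fun x => ?_
        rw [lintegral_const_mul]
        exact hkm.comp (measurable_const.sub measurable_id)
    _ = ∫⁻ y, ∫⁻ x, (Metric.closedBall z R).indicator F x * k (x - y) := by
        refine lintegral_lintegral_swap (Measurable.aemeasurable ?_)
        exact ((hF.indicator hB).comp measurable_fst).mul (hkm.comp (measurable_fst.sub measurable_snd))
    _ ≤ ∫⁻ y, (Metric.closedBall z (R + r)).indicator (fun y => ∫⁻ x in Metric.closedBall y r,
          F x * gam (Y.mulVec (x - y))) y := by
        refine lintegral_mono fun y => ?_
        by_cases hy : y ∈ Metric.closedBall z (R + r)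
        · rw [Set.indicator_of_mem hy, ← lintegral_indicator Metric.isClosed_closedBall.measurableSet]
          refine lintegral_mono fun x => ?_
          by_cases hx : x - y ∈ Metric.closedBall (0 : Fin n → ℝ) r
          · have hx' : x ∈ Metric.closedBall y r := by
              rwa [Metric.mem_closedBall, dist_eq_norm, ← dist_zero_right]
            simp only [hk]
            rw [Set.indicator_of_mem hx, Set.indicator_of_mem hx']
            exact mul_le_mul_left (Set.indicator_le_self _ _ _) _
          · simp only [hk]
            rw [Set.indicator_of_notMem hx, mul_zero]
            exact zero_le
        · rw [Set.indicator_of_notMem hy, nonpos_iff_eq_zero]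
          refine (lintegral_congr fun x => ?_).trans lintegral_zero
          by_cases hx : x ∈ Metric.closedBall z R
          · have hx' : x - y ∉ Metric.closedBall (0 : Fin n → ℝ) r := by
              intro h
              apply hy
              rw [Metric.mem_closedBall, dist_zero_right, ← dist_eq_norm] at h
              rw [Metric.mem_closedBall] at hx ⊢
              have := dist_triangle y x z
              rw [dist_comm y x] at this
              linarith
            simp only [hk]
            rw [Set.indicator_of_notMem hx', mul_zero]
          · rw [Set.indicator_of_notMem hx, zero_mul]
    _ = _ := by rw [lintegral_indicator hB']

/-- The large scale part of the multiscale step. -/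
lemma multiscale_outer {p : ι → ℝ} (hp : ∀ j, 0 < p j) (hp1 : ∀ j, p j ≤ 1)
    {B : ∀ j, (Fin n → ℝ) → (Fin (d j) → ℝ)} {A : (Fin n → ℝ) → ∀ j, Matrix (Fin (d j)) (Fin n) ℝ}
    {x₀ : Fin n → ℝ} {ρ H : ℝ} (M : LocalModel B A x₀ ρ H) {z : Fin n → ℝ} {R r : ℝ} (hr : 0 < r)
    (hrR : 2 * r ≤ R) (hz : ‖z - x₀‖ + 4 * R ≤ ρ) {η q Q : ℝ}
    {V : ∀ j, Matrix (Fin (d j)) (Fin (d j)) ℝ} {Y : Matrix (Fin n) (Fin n) ℝ}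
    (S : ScaledData p (A z) η q Q V Y) (hη : 0 < η) (hη1 : η ≤ 1) (hQ : 0 ≤ Q)
    {f : ∀ j, (Fin (d j) → ℝ) → ℝ≥0∞} (hf : ∀ j, Measurable (f j))
    (hfin : ∀ j, ∫⁻ u in Metric.closedBall (B j z) (4 * H * R), f j u ≠ ⊤) {P : ℝ} (hP : 0 ≤ P)
    (hPQ : Q * (n * (2 * R) ^ 2) ≤ P ^ 2) :
    ∫⁻ y in Metric.closedBall z (R + r), ∏ j, (∫⁻ u in Metric.closedBall (B j z) (4 * H * R),
        f j u * gam ((V j).mulVec (u - B j y))) ^ p j ≤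
      ENNReal.ofReal (|Y.det|⁻¹ * Real.exp (Real.pi * (36 * H ^ 2 * Q * R ^ 3) * ∑ j, p j * d j +
        n * η * (Real.pi + Real.log (2 * P + 1)))) *
        ∏ j, (∫⁻ u in Metric.closedBall (B j z) (4 * H * R), f j u) ^ p j := by
  have hH := M.one_le
  have hR : 0 < R := by linarith
  have hzρ : z ∈ Metric.closedBall x₀ ρ := by
    rw [Metric.mem_closedBall, dist_eq_norm]; linarith
  set e2 := Real.exp (Real.pi * (36 * H ^ 2 * Q * R ^ 3) * ∑ j, p j * d j) with he2
  set μ : ∀ j, Measure (Fin (d j) → ℝ) := fun j =>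
    ((volume.restrict (Metric.closedBall (B j z) (4 * H * R))).withDensity (f j)).map
      (fun u => u - B j z) with hμ
  have hsub : ∀ j, Measurable fun u : Fin (d j) → ℝ => u - B j z := fun j =>
    measurable_id.sub measurable_const
  have hVm : ∀ j (c : Fin (d j) → ℝ), Measurable fun v => gam ((V j).mulVec (c - v)) := fun j c =>
    measurable_gam.comp (by fun_prop : Continuous fun v => (V j).mulVec (c - v)).measurable
  have hμint : ∀ j g, Measurable g → ∫⁻ v, g v ∂μ j =
      ∫⁻ u in Metric.closedBall (B j z) (4 * H * R), f j u * g (u - B j z) := by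
    intro j g hg
    rw [hμ, lintegral_map hg (hsub j), lintegral_withDensity_eq_lintegral_mul _ (hf j)
      (g := fun u => g (u - B j z)) (hg.comp (hsub j))]
    rfl
  have hμuniv : ∀ j, μ j Set.univ = ∫⁻ u in Metric.closedBall (B j z) (4 * H * R), f j u := by
    intro j
    rw [hμ, Measure.map_apply (hsub j) MeasurableSet.univ, Set.preimage_univ,
      withDensity_apply _ MeasurableSet.univ, Measure.restrict_univ]
  have hμfin : ∀ j, IsFiniteMeasure (μ j) := fun j => ⟨by
    rw [hμuniv]; exact lt_top_iff_ne_top.2 (hfin j)⟩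
  have hμS : ∀ j, ∀ᵐ v ∂μ j, ∀ i, |v i| ≤ 4 * H * R := by
    intro j
    rw [hμ, ae_map_iff (hsub j).aemeasurable]
    · refine (withDensity_absolutelyContinuous _ _).ae_le ?_
      filter_upwards [ae_restrict_mem Metric.isClosed_closedBall.measurableSet] with u hu i
      rw [Metric.mem_closedBall, dist_eq_norm] at hu
      exact (norm_le_pi_norm (u - B j z) i).trans hu
    · simp only [Set.ofPred_forall]
      exact MeasurableSet.iInter fun i => measurableSet_le
        ((measurable_pi_apply i).abs) measurable_const
  have hNC := nearCritical_bound hp hp1 S.det_Y S.sum_eq hη hη1 S.near μ hμfin hμS hP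
  have hpt : ∀ y ∈ Metric.closedBall z (R + r), ∏ j, (∫⁻ u in Metric.closedBall (B j z) (4 * H * R),
        f j u * gam ((V j).mulVec (u - B j y))) ^ p j ≤ ENNReal.ofReal e2 *
        ∏ j, (∫⁻ v, gam ((V j).mulVec ((A z j).mulVec (y - z) - v)) ∂μ j) ^ p j := by
    intro y hy
    rw [Metric.mem_closedBall, dist_eq_norm] at hy
    have hyρ : y ∈ Metric.closedBall x₀ ρ := by
      rw [Metric.mem_closedBall, dist_eq_norm]
      calc ‖y - x₀‖ = ‖(y - z) + (z - x₀)‖ := by rw [sub_add_sub_cancel]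
        _ ≤ ‖y - z‖ + ‖z - x₀‖ := norm_add_le _ _
        _ ≤ ρ := by linarith
    have := prod_rpow_le_exp hp (F := fun j => ∫⁻ u in Metric.closedBall (B j z) (4 * H * R),
        f j u * gam ((V j).mulVec (u - B j y)))
      (G := fun j => ∫⁻ v, gam ((V j).mulVec ((A z j).mulVec (y - z) - v)) ∂μ j)
      (w := fun j => Real.pi * (Q * d j * (36 * H ^ 2 * R ^ 3))) (fun j => ?_)
    · refine this.trans (le_of_eq ?_)
      rw [he2, Finset.mul_sum]
      congr 3
      exact Finset.sum_congr rfl fun j _ => by ring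
    · rw [hμint j _ (hVm j _), ← lintegral_const_mul' _ _ ENNReal.ofReal_ne_top]
      refine setLIntegral_mono' Metric.isClosed_closedBall.measurableSet fun u hu => ?_
      rw [Metric.mem_closedBall, dist_eq_norm] at hu
      rw [mul_left_comm]
      refine mul_le_mul_right ?_ _
      have hsym : gam ((V j).mulVec ((A z j).mulVec (y - z) - (u - B j z))) =
          gam ((V j).mulVec (u - B j z - (A z j).mulVec (y - z))) := by
        rw [← neg_sub (u - B j z), Matrix.mulVec_neg]
        simp [gam, nsq]
      rw [hsym]
      refine gam_mulVec_le hQ (S.V_upper j) ?_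
      have t1 : ‖u - B j z - (A z j).mulVec (y - z) - (u - B j y)‖ ≤ H * (3 / 2 * R) ^ 2 := by
        have h := M.taylor j z hzρ y hyρ z hzρ
        rw [sub_self, norm_zero, max_eq_left (norm_nonneg _)] at h
        have e : u - B j z - (A z j).mulVec (y - z) - (u - B j y) =
          B j y - B j z - (A z j).mulVec (y - z) := by abel
        rw [e]
        have hy' : ‖y - z‖ ≤ 3 / 2 * R := by linarith
        calc _ ≤ H * ‖y - z‖ * ‖y - z‖ := h
          _ = H * ‖y - z‖ ^ 2 := by ring
          _ ≤ _ := by gcongr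
      have t2 : ‖u - B j y‖ ≤ 6 * H * R := by
        have h := M.lip j z hzρ y hyρ
        rw [norm_sub_rev z y] at h
        calc ‖u - B j y‖ = ‖(u - B j z) + (B j z - B j y)‖ := by rw [sub_add_sub_cancel]
          _ ≤ 4 * H * R + H * ‖y - z‖ := (norm_add_le _ _).trans (add_le_add hu h)
          _ ≤ 6 * H * R := by nlinarith
      have t3 : ‖u - B j z - (A z j).mulVec (y - z)‖ ≤ 6 * H * R := by
        have h := M.lin j z hzρ (y - z)
        calc _ ≤ 4 * H * R + H * ‖y - z‖ := (norm_sub_le _ _).trans (add_le_add hu h)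
          _ ≤ 6 * H * R := by nlinarith
      calc _ ≤ H * (3 / 2 * R) ^ 2 * (6 * H * R + 6 * H * R) :=
            mul_le_mul t1 (by linarith) (by positivity) (by positivity)
        _ ≤ _ := by
          have : 0 < H ^ 2 * R ^ 3 := by positivity
          nlinarith
  calc _ ≤ ∫⁻ y in Metric.closedBall z (R + r), ENNReal.ofReal e2 *
        ∏ j, (∫⁻ v, gam ((V j).mulVec ((A z j).mulVec (y - z) - v)) ∂μ j) ^ p j :=
        setLIntegral_mono' Metric.isClosed_closedBall.measurableSet hpt
    _ = ENNReal.ofReal e2 * ∫⁻ y in Metric.closedBall z (R + r),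
        ∏ j, (∫⁻ v, gam ((V j).mulVec ((A z j).mulVec (y - z) - v)) ∂μ j) ^ p j :=
        lintegral_const_mul' _ _ ENNReal.ofReal_ne_top
    _ ≤ ENNReal.ofReal e2 * ∫⁻ x in {x : Fin n → ℝ | ∀ i, |Y.mulVec x i| ≤ P},
        ∏ j, (∫⁻ v, gam ((V j).mulVec ((A z j).mulVec x - v)) ∂μ j) ^ p j := by
        refine mul_le_mul_right ?_ _
        have hms : MeasurableSet {x : Fin n → ℝ | ∀ i, |Y.mulVec x i| ≤ P} := by
          simp only [Set.ofPred_forall]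
          refine MeasurableSet.iInter fun i => measurableSet_le (Measurable.abs ?_) measurable_const
          exact (measurable_pi_apply i).comp (by fun_prop : Continuous fun w => Y.mulVec w).measurable
        rw [← lintegral_indicator Metric.isClosed_closedBall.measurableSet, ← lintegral_indicator hms]
        conv_rhs => rw [← lintegral_sub_right_eq_self _ z]
        refine lintegral_mono fun y => ?_
        by_cases hy : y ∈ Metric.closedBall z (R + r)
        · rw [Set.indicator_of_mem hy, Set.indicator_of_mem]
          rw [Metric.mem_closedBall, dist_eq_norm] at hy
          intro i
          refine abs_le_of_sq_le_sq' ?_ hP |> abs_le.2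
          calc (Y.mulVec (y - z) i) ^ 2 ≤ nsq (Y.mulVec (y - z)) :=
                Finset.single_le_sum (f := fun j => (Y.mulVec (y - z) j) ^ 2) (fun _ _ => sq_nonneg _)
                  (Finset.mem_univ i)
            _ ≤ Q * (n * ‖y - z‖ ^ 2) := (S.Y_upper _).trans
                (mul_le_mul_of_nonneg_left (nsq_le_norm_sq _) hQ)
            _ ≤ Q * (n * (2 * R) ^ 2) := by
                have : ‖y - z‖ ≤ 2 * R := by linarith
                gcongr
            _ ≤ _ := hPQ
        · rw [Set.indicator_of_notMem hy]; exact zero_le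
    _ ≤ _ := by
        refine (mul_le_mul_right hNC _).trans (le_of_eq ?_)
        simp_rw [hμuniv]
        rw [← mul_assoc, ← ENNReal.ofReal_mul (Real.exp_pos _).le, Real.exp_add]
        congr 2
        ring

end

section
variable {ι : Type*} [Fintype ι] {n : ℕ} {d : ι → ℕ}

lemma mem_closedBall_of_le {k : ℕ} {x₀ z y : Fin k → ℝ} {a ρ : ℝ} (hy : y ∈ Metric.closedBall z a)
    (h : ‖z - x₀‖ + a ≤ ρ) : y ∈ Metric.closedBall x₀ ρ := by
  rw [Metric.mem_closedBall] at hy ⊢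
  rw [← dist_eq_norm] at h
  linarith [dist_triangle y z x₀]

lemma LocalModel.compare {B : ∀ j, (Fin n → ℝ) → (Fin (d j) → ℝ)}
    {A : (Fin n → ℝ) → ∀ j, Matrix (Fin (d j)) (Fin n) ℝ}
    {x₀ : Fin n → ℝ} {ρ H : ℝ} (M : LocalModel B A x₀ ρ H) {z : Fin n → ℝ} {R r : ℝ} (hr : 0 < r)
    (hrR : 2 * r ≤ R) (hz : ‖z - x₀‖ + 4 * R ≤ ρ) (j : ι) {x y : Fin n → ℝ}
    (hy : y ∈ Metric.closedBall z (R + r)) (hx : x ∈ Metric.closedBall y r) :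
    ‖(B j x - B j y) - (A z j).mulVec (x - y)‖ *
      (‖(A z j).mulVec (x - y)‖ + ‖B j x - B j y‖) ≤ 4 * H ^ 2 * R ^ 3 ∧ ‖B j x - B j y‖ ≤ H * r := by
  have hH := M.one_le
  have hR : 0 < R := by linarith
  have hzρ : z ∈ Metric.closedBall x₀ ρ := by
    rw [Metric.mem_closedBall, dist_eq_norm]; linarith
  have hyρ : y ∈ Metric.closedBall x₀ ρ := mem_closedBall_of_le hy (by linarith)
  have hxz : x ∈ Metric.closedBall z (2 * R) := by
    rw [Metric.mem_closedBall] at hx hy ⊢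
    linarith [dist_triangle x y z]
  have hxρ : x ∈ Metric.closedBall x₀ ρ := mem_closedBall_of_le hxz (by linarith)
  rw [Metric.mem_closedBall, dist_eq_norm] at hx hy hxz
  have t1 := M.taylor j z hzρ x hxρ y hyρ
  have t2 := M.lin j z hzρ (x - y)
  have t3 := M.lip j x hxρ y hyρ
  have hm : max ‖x - z‖ ‖y - z‖ ≤ 2 * R := max_le hxz (by linarith)
  have t1' : ‖(B j x - B j y) - (A z j).mulVec (x - y)‖ ≤ H * (2 * R) * r := t1.trans (by gcongr)
  have t2' : ‖(A z j).mulVec (x - y)‖ ≤ H * r := t2.trans (by gcongr)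
  have t3' : ‖B j x - B j y‖ ≤ H * r := t3.trans (by gcongr)
  refine ⟨?_, t3'⟩
  calc _ ≤ H * (2 * R) * r * (H * r + H * r) :=
        mul_le_mul t1' (by linarith) (by positivity) (by positivity)
    _ = 4 * H ^ 2 * R * r ^ 2 := by ring
    _ ≤ 4 * H ^ 2 * R * R ^ 2 := by
        have : r ≤ R := by linarith
        gcongr
    _ = _ := by ring

/-- The passage from scale `r` to scale `R`. -/
lemma multiscale_step {p : ι → ℝ} (hp : ∀ j, 0 < p j) (hp1 : ∀ j, p j ≤ 1)
    {B : ∀ j, (Fin n → ℝ) → (Fin (d j) → ℝ)} {A : (Fin n → ℝ) → ∀ j, Matrix (Fin (d j)) (Fin n) ℝ}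
    {x₀ : Fin n → ℝ} {ρ H : ℝ} (M : LocalModel B A x₀ ρ H) {z : Fin n → ℝ} {R r : ℝ} (hr : 0 < r)
    (hrR : 2 * r ≤ R) (hz : ‖z - x₀‖ + 4 * R ≤ ρ) {η q Q τ : ℝ}
    {V : ∀ j, Matrix (Fin (d j)) (Fin (d j)) ℝ} {Y : Matrix (Fin n) (Fin n) ℝ}
    (S : ScaledData p (A z) η q Q V Y) (hη : 0 < η) (hη1 : η ≤ 1) (hq : 0 ≤ q) (hQ : 0 ≤ Q)
    (hτ : 2 ^ n * Real.exp (-(Real.pi * (q * r ^ 2) / 2)) ≤ τ)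
    {f : ∀ j, (Fin (d j) → ℝ) → ℝ≥0∞} (hf : ∀ j, Measurable (f j))
    (hfin : ∀ j, ∫⁻ u in Metric.closedBall (B j z) (4 * H * R), f j u ≠ ⊤) {P : ℝ} (hP : 0 ≤ P)
    (hPQ : Q * (n * (2 * R) ^ 2) ≤ P ^ 2) {c : ℝ} (hc : 0 ≤ c)
    (hloc : ∀ y ∈ Metric.closedBall z (R + r),
      ∫⁻ x in Metric.closedBall y r, ∏ j, (f j (B j x) * gam ((V j).mulVec (B j x - B j y))) ^ p j ≤
        ENNReal.ofReal c * ∏ j, (∫⁻ u in Metric.closedBall (B j y) (4 * H * r),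
          f j u * gam ((V j).mulVec (u - B j y))) ^ p j) :
    ENNReal.ofReal (1 - τ) * ∫⁻ x in Metric.closedBall z R, ∏ j, f j (B j x) ^ p j ≤
      ENNReal.ofReal (c * Real.exp (Real.pi * (40 * H ^ 2 * Q * R ^ 3) * ∑ j, p j * d j +
        n * η * (Real.pi + Real.log (2 * P + 1)))) *
        ∏ j, (∫⁻ u in Metric.closedBall (B j z) (4 * H * R), f j u) ^ p j := by
  have hH := M.one_le
  have hR : 0 < R := by linarith
  have hDp := inv_pos.2 (abs_pos.2 S.det_Y)
  have hzρ : z ∈ Metric.closedBall x₀ ρ := by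
    rw [Metric.mem_closedBall, dist_eq_norm]; linarith
  have hFm : Measurable fun x => ∏ j, f j (B j x) ^ p j :=
    Finset.measurable_prod _ fun j _ => ((hf j).comp (M.meas j)).pow_const _
  set e1 := Real.exp (Real.pi * (4 * H ^ 2 * Q * R ^ 3) * ∑ j, p j * d j) with he1
  set Pr := ∏ j, (∫⁻ u in Metric.closedBall (B j z) (4 * H * R), f j u) ^ p j with hPr
  have hpt : ∀ y ∈ Metric.closedBall z (R + r), ∫⁻ x in Metric.closedBall y r,
      (∏ j, f j (B j x) ^ p j) * gam (Y.mulVec (x - y)) ≤ ENNReal.ofReal (e1 * c) *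
        ∏ j, (∫⁻ u in Metric.closedBall (B j z) (4 * H * R),
          f j u * gam ((V j).mulVec (u - B j y))) ^ p j := by
    intro y hy
    have hyρ : y ∈ Metric.closedBall x₀ ρ := mem_closedBall_of_le hy (by linarith)
    calc ∫⁻ x in Metric.closedBall y r, (∏ j, f j (B j x) ^ p j) * gam (Y.mulVec (x - y))
        ≤ ∫⁻ x in Metric.closedBall y r, ENNReal.ofReal e1 *
          ∏ j, (f j (B j x) * gam ((V j).mulVec (B j x - B j y))) ^ p j := by
          refine setLIntegral_mono' Metric.isClosed_closedBall.measurableSet fun x hx => ?_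
          rw [← prod_gam_eq S, ← Finset.prod_mul_distrib]
          simp_rw [← ENNReal.mul_rpow_of_nonneg _ _ (hp _).le]
          refine (prod_rpow_le_exp hp (G := fun j => f j (B j x) * gam ((V j).mulVec (B j x - B j y)))
            (w := fun j => Real.pi * (Q * d j * (4 * H ^ 2 * R ^ 3))) fun j => ?_).trans (le_of_eq ?_)
          · rw [mul_left_comm]
            exact mul_le_mul_right (gam_mulVec_le hQ (S.V_upper j) (M.compare hr hrR hz j hy hx).1) _
          · rw [he1, Finset.mul_sum]
            congr 3
            exact Finset.sum_congr rfl fun j _ => by ring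
      _ = ENNReal.ofReal e1 * ∫⁻ x in Metric.closedBall y r,
          ∏ j, (f j (B j x) * gam ((V j).mulVec (B j x - B j y))) ^ p j :=
          lintegral_const_mul' _ _ ENNReal.ofReal_ne_top
      _ ≤ ENNReal.ofReal e1 * (ENNReal.ofReal c * ∏ j, (∫⁻ u in Metric.closedBall (B j y) (4 * H * r),
          f j u * gam ((V j).mulVec (u - B j y))) ^ p j) := mul_le_mul_right (hloc y hy) _
      _ ≤ _ := by
          rw [← mul_assoc, ← ENNReal.ofReal_mul (Real.exp_pos _).le]
          refine mul_le_mul_right (Finset.prod_le_prod' fun j _ => ENNReal.rpow_le_rpow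
            (lintegral_mono_set (Metric.closedBall_subset_closedBall' ?_)) (hp j).le) _
          have h := M.lip j y hyρ z hzρ
          rw [Metric.mem_closedBall, dist_eq_norm] at hy
          rw [dist_eq_norm]
          nlinarith
  have key : ENNReal.ofReal |Y.det|⁻¹ * (ENNReal.ofReal (1 - τ) *
      ∫⁻ x in Metric.closedBall z R, ∏ j, f j (B j x) ^ p j) ≤ ENNReal.ofReal |Y.det|⁻¹ *
      (ENNReal.ofReal (c * Real.exp (Real.pi * (40 * H ^ 2 * Q * R ^ 3) * ∑ j, p j * d j +
        n * η * (Real.pi + Real.log (2 * P + 1)))) * Pr) := by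
    calc ENNReal.ofReal |Y.det|⁻¹ * (ENNReal.ofReal (1 - τ) *
          ∫⁻ x in Metric.closedBall z R, ∏ j, f j (B j x) ^ p j)
        = (ENNReal.ofReal (1 - τ) * ENNReal.ofReal |Y.det|⁻¹) *
          ∫⁻ x in Metric.closedBall z R, ∏ j, f j (B j x) ^ p j := by
          rw [← mul_assoc, mul_comm (ENNReal.ofReal |Y.det|⁻¹)]
      _ ≤ (∫⁻ w in Metric.closedBall 0 r, gam (Y.mulVec w)) *
          ∫⁻ x in Metric.closedBall z R, ∏ j, f j (B j x) ^ p j :=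
          mul_le_mul_left (gaussian_tail S.det_Y hq hr.le S.Y_lower hτ) _
      _ ≤ ∫⁻ y in Metric.closedBall z (R + r), ∫⁻ x in Metric.closedBall y r,
          (∏ j, f j (B j x) ^ p j) * gam (Y.mulVec (x - y)) := gaussian_average_le hFm z R r
      _ ≤ ∫⁻ y in Metric.closedBall z (R + r), ENNReal.ofReal (e1 * c) *
          ∏ j, (∫⁻ u in Metric.closedBall (B j z) (4 * H * R),
            f j u * gam ((V j).mulVec (u - B j y))) ^ p j :=
          setLIntegral_mono' Metric.isClosed_closedBall.measurableSet hpt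
      _ = ENNReal.ofReal (e1 * c) * ∫⁻ y in Metric.closedBall z (R + r),
          ∏ j, (∫⁻ u in Metric.closedBall (B j z) (4 * H * R),
            f j u * gam ((V j).mulVec (u - B j y))) ^ p j :=
          lintegral_const_mul' _ _ ENNReal.ofReal_ne_top
      _ ≤ ENNReal.ofReal (e1 * c) * _ :=
          mul_le_mul_right (multiscale_outer hp hp1 M hr hrR hz S hη hη1 hQ hf hfin hP hPQ) _
      _ = _ := by
          rw [← mul_assoc (ENNReal.ofReal (e1 * c)), ← mul_assoc (ENNReal.ofReal |Y.det|⁻¹),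
            ← ENNReal.ofReal_mul (by positivity), ← ENNReal.ofReal_mul hDp.le, he1]
          congr 2
          have : Real.pi * (40 * H ^ 2 * Q * R ^ 3) * ∑ j, p j * (d j : ℝ) =
            Real.pi * (4 * H ^ 2 * Q * R ^ 3) * ∑ j, p j * (d j : ℝ) +
            Real.pi * (36 * H ^ 2 * Q * R ^ 3) * ∑ j, p j * (d j : ℝ) := by ring
          rw [this, add_assoc, Real.exp_add (Real.pi * (4 * H ^ 2 * Q * R ^ 3) * _)]
          ring
  exact (ENNReal.mul_le_mul_iff_right (ENNReal.ofReal_pos.2 hDp).ne' ENNReal.ofReal_ne_top).1 key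

end

/-- Functions whose logarithm is Lipschitz on a set. -/
def LogLip {k : ℕ} (lam : ℝ) (s : Set (Fin k → ℝ)) (f : (Fin k → ℝ) → ℝ≥0∞) : Prop :=
  ∀ u ∈ s, ∀ v ∈ s, f u ≤ ENNReal.ofReal (Real.exp (lam * ‖u - v‖)) * f v

lemma LogLip.mono {k : ℕ} {lam lam' : ℝ} {s s' : Set (Fin k → ℝ)} {f : (Fin k → ℝ) → ℝ≥0∞}
    (h : LogLip lam s f) (hl : lam ≤ lam') (hs : s' ⊆ s) : LogLip lam' s' f := fun u hu v hv =>
  (h u (hs hu) v (hs hv)).trans (mul_le_mul_left (ENNReal.ofReal_le_ofReal (Real.exp_le_exp.2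
    (mul_le_mul_of_nonneg_right hl (norm_nonneg _)))) _)

lemma LogLip.mul {k : ℕ} {a b : ℝ} {s : Set (Fin k → ℝ)} {f g : (Fin k → ℝ) → ℝ≥0∞}
    (hf : LogLip a s f) (hg : LogLip b s g) : LogLip (a + b) s fun u => f u * g u := by
  intro u hu v hv
  rw [add_mul, Real.exp_add, ENNReal.ofReal_mul (Real.exp_pos _).le, mul_mul_mul_comm]
  exact mul_le_mul' (hf u hu v hv) (hg u hu v hv)

lemma logLip_gam {k l : ℕ} {W : Matrix (Fin l) (Fin k) ℝ} {Q : ℝ} (hQ : 0 ≤ Q)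
    (hW : ∀ u, nsq (W.mulVec u) ≤ Q * nsq u) (b : Fin k → ℝ) {a : ℝ} :
    LogLip (Real.pi * (Q * k * (2 * a))) (Metric.closedBall b a) fun u => gam (W.mulVec (u - b)) := by
  intro u hu v hv
  rw [Metric.mem_closedBall, dist_eq_norm] at hu hv
  refine (gam_mulVec_le hQ hW (b := v - b) (e := ‖u - v‖ * (2 * a)) ?_).trans (le_of_eq ?_)
  · rw [sub_sub_sub_cancel_right, norm_sub_rev v u]
    exact mul_le_mul_of_nonneg_left (by linarith) (norm_nonneg _)
  · congr 3; ring

lemma inv_one_sub_le_exp {τ : ℝ} (h0 : 0 ≤ τ) (h : τ ≤ 1 / 2) : Real.exp (-(2 * τ)) ≤ 1 - τ := by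
  rw [Real.exp_neg, inv_le_iff_one_le_mul₀ (Real.exp_pos _)]
  have := Real.add_one_le_exp (2 * τ)
  nlinarith

lemma le_exp_mul_of_sub_mul_le {τ : ℝ} (h0 : 0 ≤ τ) (h : τ ≤ 1 / 2) {a b : ℝ≥0∞}
    (hab : ENNReal.ofReal (1 - τ) * a ≤ b) : a ≤ ENNReal.ofReal (Real.exp (2 * τ)) * b := by
  calc a = ENNReal.ofReal (Real.exp (2 * τ)) * (ENNReal.ofReal (Real.exp (-(2 * τ))) * a) := by
        rw [← mul_assoc, ← ENNReal.ofReal_mul (Real.exp_pos _).le, ← Real.exp_add, add_neg_cancel,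
          Real.exp_zero, ENNReal.ofReal_one, one_mul]
    _ ≤ _ := mul_le_mul_right ((mul_le_mul_left (ENNReal.ofReal_le_ofReal
        (inv_one_sub_le_exp h0 h)) _).trans hab) _

section
variable {ι : Type*} [Fintype ι] {n : ℕ} {d : ι → ℕ}

/-- The inequality at scale `R` for inputs with logarithmic Lipschitz constant `lam`. -/
def ScaleIneq (p : ι → ℝ) (B : ∀ j, (Fin n → ℝ) → (Fin (d j) → ℝ)) (x₀ : Fin n → ℝ)
    (ρ H lam R C : ℝ) : Prop :=
  ∀ z, ‖z - x₀‖ + 4 * R ≤ ρ → ∀ f : ∀ j, (Fin (d j) → ℝ) → ℝ≥0∞, (∀ j, Measurable (f j)) →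
    (∀ j u, f j u ≠ ⊤) → (∀ j, LogLip lam (Metric.closedBall (B j z) (4 * H * R)) (f j)) →
    ∫⁻ x in Metric.closedBall z R, ∏ j, f j (B j x) ^ p j ≤
      ENNReal.ofReal C * ∏ j, (∫⁻ u in Metric.closedBall (B j z) (4 * H * R), f j u) ^ p j

lemma LogLip.lintegral_closedBall_ne_top {k : ℕ} {lam a : ℝ} {b : Fin k → ℝ} (ha : 0 ≤ a)
    (hlam : 0 ≤ lam) {f : (Fin k → ℝ) → ℝ≥0∞} (hf : LogLip lam (Metric.closedBall b a) f)
    (hfin : f b ≠ ⊤) : ∫⁻ u in Metric.closedBall b a, f u ≠ ⊤ := by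
  refine ne_top_of_le_ne_top (b := ENNReal.ofReal (Real.exp (lam * a)) * f b *
    volume (Metric.closedBall b a)) ?_ ?_
  · exact ENNReal.mul_ne_top (ENNReal.mul_ne_top ENNReal.ofReal_ne_top hfin)
      (isCompact_closedBall b a).measure_lt_top.ne
  · rw [← setLIntegral_const]
    refine setLIntegral_mono' Metric.isClosed_closedBall.measurableSet fun u hu => ?_
    refine (hf u hu b (Metric.mem_closedBall_self ha)).trans (mul_le_mul_left
      (ENNReal.ofReal_le_ofReal (Real.exp_le_exp.2 (mul_le_mul_of_nonneg_left ?_ hlam))) _)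
    rwa [Metric.mem_closedBall, dist_eq_norm] at hu

/-- The loss incurred in passing between consecutive scales. -/
noncomputable def stepLoss (p : ι → ℝ) (n : ℕ) (d : ι → ℕ) (H R η Q τ P : ℝ) : ℝ :=
  2 * τ + (Real.pi * (40 * H ^ 2 * Q * R ^ 3) * ∑ j, p j * d j +
    n * η * (Real.pi + Real.log (2 * P + 1)))

variable {p : ι → ℝ} {B : ∀ j, (Fin n → ℝ) → (Fin (d j) → ℝ)}
  {A : (Fin n → ℝ) → ∀ j, Matrix (Fin (d j)) (Fin n) ℝ} {x₀ : Fin n → ℝ} {ρ H : ℝ}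

lemma multiscale_step' (hp : ∀ j, 0 < p j) (hp1 : ∀ j, p j ≤ 1)
    (M : LocalModel B A x₀ ρ H) {z : Fin n → ℝ} {R r : ℝ} (hr : 0 < r)
    (hrR : 2 * r ≤ R) (hz : ‖z - x₀‖ + 4 * R ≤ ρ) {η q Q τ : ℝ}
    {V : ∀ j, Matrix (Fin (d j)) (Fin (d j)) ℝ} {Y : Matrix (Fin n) (Fin n) ℝ}
    (S : ScaledData p (A z) η q Q V Y) (hη : 0 < η) (hη1 : η ≤ 1) (hq : 0 ≤ q) (hQ : 0 ≤ Q)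
    (hτ : 2 ^ n * Real.exp (-(Real.pi * (q * r ^ 2) / 2)) ≤ τ) (hτ1 : τ ≤ 1 / 2)
    {f : ∀ j, (Fin (d j) → ℝ) → ℝ≥0∞} (hf : ∀ j, Measurable (f j))
    (hfin : ∀ j, ∫⁻ u in Metric.closedBall (B j z) (4 * H * R), f j u ≠ ⊤) {P : ℝ} (hP : 0 ≤ P)
    (hPQ : Q * (n * (2 * R) ^ 2) ≤ P ^ 2) {c : ℝ} (hc : 0 ≤ c)
    (hloc : ∀ y ∈ Metric.closedBall z (R + r),
      ∫⁻ x in Metric.closedBall y r, ∏ j, (f j (B j x) * gam ((V j).mulVec (B j x - B j y))) ^ p j ≤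
        ENNReal.ofReal c * ∏ j, (∫⁻ u in Metric.closedBall (B j y) (4 * H * r),
          f j u * gam ((V j).mulVec (u - B j y))) ^ p j) :
    ∫⁻ x in Metric.closedBall z R, ∏ j, f j (B j x) ^ p j ≤
      ENNReal.ofReal (c * Real.exp (stepLoss p n d H R η Q τ P)) *
        ∏ j, (∫⁻ u in Metric.closedBall (B j z) (4 * H * R), f j u) ^ p j := by
  have h := multiscale_step hp hp1 M hr hrR hz S hη hη1 hq hQ hτ hf hfin hP hPQ hc hloc
  have hτ0 : 0 ≤ τ := le_trans (by positivity) hτ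
  refine (le_exp_mul_of_sub_mul_le hτ0 hτ1 h).trans (le_of_eq ?_)
  rw [← mul_assoc, ← ENNReal.ofReal_mul (Real.exp_pos _).le, stepLoss, Real.exp_add (2 * τ)]
  congr 2
  ring

/-- The inductive step across scales. -/
lemma ScaleIneq.step (hp : ∀ j, 0 < p j) (hp1 : ∀ j, p j ≤ 1)
    (M : LocalModel B A x₀ ρ H) {R r : ℝ} (hr : 0 < r)
    (hrR : 2 * r ≤ R) {η q Q τ : ℝ} (hη : 0 < η) (hη1 : η ≤ 1) (hq : 0 ≤ q) (hQ : 0 ≤ Q)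
    (hS : ∀ z ∈ Metric.closedBall x₀ ρ, ∃ V Y, ScaledData p (A z) η q Q V Y)
    (hτ : 2 ^ n * Real.exp (-(Real.pi * (q * r ^ 2) / 2)) ≤ τ) (hτ1 : τ ≤ 1 / 2)
    {P : ℝ} (hP : 0 ≤ P) (hPQ : Q * (n * (2 * R) ^ 2) ≤ P ^ 2) {c lam lam' : ℝ} (hc : 0 ≤ c)
    (hlam : 0 ≤ lam) (hlam' : ∀ j, lam + Real.pi * (Q * d j * (2 * (4 * H * r))) ≤ lam')
    (h : ScaleIneq p B x₀ ρ H lam' r c) :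
    ScaleIneq p B x₀ ρ H lam R (c * Real.exp (stepLoss p n d H R η Q τ P)) := by
  intro z hz f hf hft hfl
  have hH := M.one_le
  have hR : 0 < R := by linarith
  have hzρ : z ∈ Metric.closedBall x₀ ρ := by
    rw [Metric.mem_closedBall, dist_eq_norm]; linarith
  obtain ⟨V, Y, S⟩ := hS z hzρ
  refine multiscale_step' hp hp1 M hr hrR hz S hη hη1 hq hQ hτ hτ1 hf
    (fun j => (hfl j).lintegral_closedBall_ne_top (by positivity) hlam (hft j _)) hP hPQ hc ?_
  intro y hy
  have hyρ : y ∈ Metric.closedBall x₀ ρ := mem_closedBall_of_le hy (by linarith)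
  have hyz := hy
  rw [Metric.mem_closedBall, dist_eq_norm] at hyz
  refine h y ?_ (fun j u => f j u * gam ((V j).mulVec (u - B j y))) (fun j => ?_) (fun j u => ?_)
    fun j => ?_
  · have : ‖y - x₀‖ ≤ ‖y - z‖ + ‖z - x₀‖ := by
      rw [← sub_add_sub_cancel y z x₀]; exact norm_add_le _ _
    linarith
  · exact (hf j).mul (measurable_gam.comp
      (by fun_prop : Continuous fun u => (V j).mulVec (u - B j y)).measurable)
  · exact ENNReal.mul_ne_top (hft j u) (gam_ne_top _)
  · refine LogLip.mono (((hfl j).mono le_rfl ?_).mul (logLip_gam hQ (S.V_upper j) (B j y))) (hlam' j)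
      subset_rfl
    refine Metric.closedBall_subset_closedBall' ?_
    have h := M.lip j y hyρ z hzρ
    rw [dist_eq_norm]
    nlinarith

/-- The inequality for inputs which are almost constant at the small scale. -/
lemma ScaleIneq.base (hp : ∀ j, 0 < p j) (hp1 : ∀ j, p j ≤ 1)
    (M : LocalModel B A x₀ ρ H) {R r : ℝ} (hr : 0 < r)
    (hrR : 2 * r ≤ R) {η q Q τ b : ℝ} (hb : 0 < b) (hη : 0 < η) (hη1 : η ≤ 1) (hq : 0 ≤ q) (hQ : 0 ≤ Q)
    (hS : ∀ z ∈ Metric.closedBall x₀ ρ, ∃ V Y, ScaledData p (A z) η q Q V Y ∧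
      |Y.det|⁻¹ ≤ b * ∏ j, (|(V j).det|⁻¹) ^ p j)
    (hτ : 2 ^ n * Real.exp (-(Real.pi * (q * r ^ 2) / 2)) ≤ τ)
    (hτd : ∀ j, 2 ^ d j * Real.exp (-(Real.pi * (q * r ^ 2) / 2)) ≤ τ) (hτ1 : τ ≤ 1 / 2)
    {P : ℝ} (hP : 0 ≤ P) (hPQ : Q * (n * (2 * R) ^ 2) ≤ P ^ 2) {lam : ℝ} (hlam : 0 ≤ lam) :
    ScaleIneq p B x₀ ρ H lam R (b * Real.exp (∑ j, p j * (5 * lam * H * r + 2 * τ +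
      Real.pi * (Q * d j * (4 * H ^ 2 * R ^ 3)))) * Real.exp (stepLoss p n d H R η Q τ P)) := by
  intro z hz f hf hft hfl
  have hH := M.one_le
  have hR : 0 < R := by linarith
  have hτ0 : 0 ≤ τ := le_trans (by positivity) hτ
  have hzρ : z ∈ Metric.closedBall x₀ ρ := by
    rw [Metric.mem_closedBall, dist_eq_norm]; linarith
  obtain ⟨V, Y, S, hdet⟩ := hS z hzρ
  refine multiscale_step' hp hp1 M hr hrR hz S hη hη1 hq hQ hτ hτ1 hf
    (fun j => (hfl j).lintegral_closedBall_ne_top (by positivity) hlam (hft j _)) hP hPQ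
    (by positivity) ?_
  intro y hy
  have hyρ : y ∈ Metric.closedBall x₀ ρ := mem_closedBall_of_le hy (by linarith)
  have hsub : ∀ j, Metric.closedBall (B j y) (4 * H * r) ⊆ Metric.closedBall (B j z) (4 * H * R) := by
    intro j
    refine Metric.closedBall_subset_closedBall' ?_
    have h := M.lip j y hyρ z hzρ
    rw [Metric.mem_closedBall, dist_eq_norm] at hy
    rw [dist_eq_norm]
    nlinarith
  have hfy : ∀ j, LogLip lam (Metric.closedBall (B j y) (4 * H * r)) (f j) := fun j =>
    (hfl j).mono le_rfl (hsub j)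
  have hself : ∀ j, B j y ∈ Metric.closedBall (B j y) (4 * H * r) := fun j =>
    Metric.mem_closedBall_self (by positivity)
  -- the Gaussian factors capture the value at the centre
  have hmass : ∀ j, f j (B j y) * ENNReal.ofReal |(V j).det|⁻¹ ≤
      ENNReal.ofReal (Real.exp (4 * lam * H * r + 2 * τ)) *
        ∫⁻ u in Metric.closedBall (B j y) (4 * H * r), f j u * gam ((V j).mulVec (u - B j y)) := by
    intro j
    have h1 := le_exp_mul_of_sub_mul_le hτ0 hτ1
      (gaussian_tail (S.det_V j) hq hr.le (S.V_lower j) (hτd j))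
    have h2 : ∫⁻ u in Metric.closedBall 0 r, gam ((V j).mulVec u) ≤
        ∫⁻ u in Metric.closedBall (B j y) (4 * H * r), gam ((V j).mulVec (u - B j y)) := by
      rw [← lintegral_indicator Metric.isClosed_closedBall.measurableSet,
        ← lintegral_indicator Metric.isClosed_closedBall.measurableSet]
      conv_lhs => rw [← lintegral_sub_right_eq_self _ (B j y)]
      refine lintegral_mono fun u => ?_
      by_cases hu : u - B j y ∈ Metric.closedBall (0 : Fin (d j) → ℝ) r
      · rw [Set.indicator_of_mem hu, Set.indicator_of_mem]
        rw [Metric.mem_closedBall, dist_zero_right] at hu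
        rw [Metric.mem_closedBall, dist_eq_norm]
        nlinarith
      · rw [Set.indicator_of_notMem hu]; exact zero_le
    calc f j (B j y) * ENNReal.ofReal |(V j).det|⁻¹
        ≤ f j (B j y) * (ENNReal.ofReal (Real.exp (2 * τ)) *
          ∫⁻ u in Metric.closedBall (B j y) (4 * H * r), gam ((V j).mulVec (u - B j y))) :=
          mul_le_mul_right (h1.trans (mul_le_mul_right h2 _)) _
      _ = ENNReal.ofReal (Real.exp (2 * τ)) * ∫⁻ u in Metric.closedBall (B j y) (4 * H * r),
            f j (B j y) * gam ((V j).mulVec (u - B j y)) := by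
          rw [lintegral_const_mul' _ _ (hft j _), mul_left_comm]
      _ ≤ ENNReal.ofReal (Real.exp (2 * τ)) * ∫⁻ u in Metric.closedBall (B j y) (4 * H * r),
            ENNReal.ofReal (Real.exp (4 * lam * H * r)) * (f j u * gam ((V j).mulVec (u - B j y))) := by
          refine mul_le_mul_right (setLIntegral_mono' Metric.isClosed_closedBall.measurableSet
            fun u hu => ?_) _
          rw [← mul_assoc]
          refine mul_le_mul_left ((hfy j _ (hself j) u hu).trans (mul_le_mul_left
            (ENNReal.ofReal_le_ofReal (Real.exp_le_exp.2 ?_)) _)) _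
          rw [Metric.mem_closedBall, dist_comm, dist_eq_norm] at hu
          nlinarith
      _ = _ := by
          rw [lintegral_const_mul' _ _ ENNReal.ofReal_ne_top, ← mul_assoc,
            ← ENNReal.ofReal_mul (Real.exp_pos _).le, ← Real.exp_add, add_comm (2 * τ)]
  set w : ι → ℝ := fun j => lam * H * r + Real.pi * (Q * d j * (4 * H ^ 2 * R ^ 3)) with hw
  have hdetp : ∀ j, 0 < |(V j).det|⁻¹ := fun j => inv_pos.2 (abs_pos.2 (S.det_V j))
  calc ∫⁻ x in Metric.closedBall y r, ∏ j, (f j (B j x) * gam ((V j).mulVec (B j x - B j y))) ^ p j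
      ≤ ∫⁻ x in Metric.closedBall y r, ENNReal.ofReal (Real.exp (∑ j, p j * w j)) *
          (∏ j, f j (B j y) ^ p j) * gam (Y.mulVec (x - y)) := by
        refine setLIntegral_mono' Metric.isClosed_closedBall.measurableSet fun x hx => ?_
        rw [← prod_gam_eq S, mul_assoc, ← Finset.prod_mul_distrib]
        simp_rw [← ENNReal.mul_rpow_of_nonneg _ _ (hp _).le]
        refine prod_rpow_le_exp hp fun j => ?_
        obtain ⟨c1, c2⟩ := M.compare hr hrR hz j hy hx
        rw [hw, Real.exp_add, ENNReal.ofReal_mul (Real.exp_pos _).le, mul_mul_mul_comm]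
        refine mul_le_mul' ?_ (gam_mulVec_le hQ (S.V_upper j) ?_)
        · have hxm : B j x ∈ Metric.closedBall (B j y) (4 * H * r) := by
            rw [Metric.mem_closedBall, dist_eq_norm]; nlinarith
          refine (hfy j _ hxm _ (hself j)).trans (mul_le_mul_left
            (ENNReal.ofReal_le_ofReal (Real.exp_le_exp.2 ?_)) _)
          rw [mul_assoc]
          exact mul_le_mul_of_nonneg_left c2 hlam
        · rwa [norm_sub_rev, add_comm]
    _ ≤ ∫⁻ x, ENNReal.ofReal (Real.exp (∑ j, p j * w j)) *
          (∏ j, f j (B j y) ^ p j) * gam (Y.mulVec (x - y)) := setLIntegral_le_lintegral _ _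
    _ = ENNReal.ofReal (Real.exp (∑ j, p j * w j)) *
          (∏ j, f j (B j y) ^ p j) * ENNReal.ofReal |Y.det|⁻¹ := by
        rw [lintegral_const_mul', lintegral_sub_right_eq_self (fun x => gam (Y.mulVec x)),
          lintegral_gam_mulVec S.det_Y]
        exact ENNReal.mul_ne_top ENNReal.ofReal_ne_top (ENNReal.prod_ne_top fun j _ =>
          ENNReal.rpow_ne_top_of_nonneg (hp j).le (hft j _))
    _ ≤ ENNReal.ofReal (Real.exp (∑ j, p j * w j)) *
          (∏ j, f j (B j y) ^ p j) * (ENNReal.ofReal b * ∏ j, ENNReal.ofReal |(V j).det|⁻¹ ^ p j) := by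
        refine mul_le_mul_right ((ENNReal.ofReal_le_ofReal hdet).trans (le_of_eq ?_)) _
        rw [ENNReal.ofReal_mul hb.le, ENNReal.ofReal_prod_of_nonneg fun j _ =>
          (Real.rpow_pos_of_pos (hdetp j) _).le]
        congr 1
        exact Finset.prod_congr rfl fun j _ => (ENNReal.ofReal_rpow_of_pos (hdetp j)).symm
    _ = ENNReal.ofReal (Real.exp (∑ j, p j * w j)) * ENNReal.ofReal b *
          ∏ j, (f j (B j y) * ENNReal.ofReal |(V j).det|⁻¹) ^ p j := by
        simp_rw [ENNReal.mul_rpow_of_nonneg _ _ (hp _).le]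
        rw [Finset.prod_mul_distrib]
        ring
    _ ≤ _ := mul_le_mul_right (prod_rpow_le_exp hp hmass) _
    _ = _ := by
        rw [← mul_assoc, ← ENNReal.ofReal_mul (Real.exp_pos _).le, ← ENNReal.ofReal_mul (by positivity),
          mul_assoc (Real.exp _), mul_comm (Real.exp _), mul_assoc b, ← Real.exp_add, ← Finset.sum_add_distrib]
        congr 4
        exact Finset.sum_congr rfl fun j _ => by rw [hw]; ring

end

section
variable {ι : Type*} [Fintype ι] {n : ℕ} {d : ι → ℕ}

lemma nsq_smul_mulVec {k l : ℕ} (t : ℝ) (W : Matrix (Fin l) (Fin k) ℝ) (u : Fin k → ℝ) :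
    nsq ((t • W).mulVec u) = t ^ 2 * nsq (W.mulVec u) := by
  rw [Matrix.smul_mulVec, nsq_smul]

lemma det_smul_ne_zero {k : ℕ} {t : ℝ} (ht : t ≠ 0) {W : Matrix (Fin k) (Fin k) ℝ}
    (hW : W.det ≠ 0) : (t • W).det ≠ 0 := by
  rw [Matrix.det_smul]
  exact mul_ne_zero (pow_ne_zero _ ht) hW

lemma quadM_smul (p : ι → ℝ) (A : ∀ j, Matrix (Fin (d j)) (Fin n) ℝ) (t : ℝ)
    (W : ∀ j, Matrix (Fin (d j)) (Fin (d j)) ℝ) :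
    quadM p A (fun j => t • W j) = (t * t) • quadM p A W := by
  simp only [quadM, Finset.smul_sum]
  refine Finset.sum_congr rfl fun j _ => ?_
  rw [Matrix.smul_mul, Matrix.transpose_smul, Matrix.smul_mul, Matrix.mul_smul, smul_smul, smul_smul,
    smul_smul]
  congr 1; ring

/-- Rescaling normalised Gaussians. -/
lemma GoodData.scaled {p : ι → ℝ} {A : ∀ j, Matrix (Fin (d j)) (Fin n) ℝ} {N : ℕ} {η : ℝ}
    {W : ∀ j, Matrix (Fin (d j)) (Fin (d j)) ℝ} {X : Matrix (Fin n) (Fin n) ℝ}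
    (G : GoodData p A N η W X) {t q Q : ℝ} (ht : 0 < t) (hq : q ≤ t ^ 2 * η ^ N)
    (hQ : t ^ 2 * (η ^ N)⁻¹ ≤ Q) : ScaledData p A η q Q (fun j => t • W j) (t • X) where
  det_V j := det_smul_ne_zero ht.ne' (G.det_W j)
  det_Y := det_smul_ne_zero ht.ne' G.det_X
  sum_eq x := by
    simp only [nsq_smul_mulVec]
    rw [← G.sum_eq, Finset.mul_sum]
    exact Finset.sum_congr rfl fun j _ => by ring
  near j x := by
    simp only [nsq_smul_mulVec]
    have := mul_le_mul_of_nonneg_left (G.near j x) (sq_nonneg t)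
    linarith
  V_lower j u := by
    simp only [nsq_smul_mulVec]
    have := mul_le_mul_of_nonneg_left (G.W_lower j u) (sq_nonneg t)
    have := mul_le_mul_of_nonneg_right hq (nsq_nonneg u)
    linarith
  V_upper j u := by
    simp only [nsq_smul_mulVec]
    have := mul_le_mul_of_nonneg_left (G.W_upper j u) (sq_nonneg t)
    have := mul_le_mul_of_nonneg_right hQ (nsq_nonneg u)
    linarith
  Y_lower x := by
    simp only [nsq_smul_mulVec]
    have := mul_le_mul_of_nonneg_left (G.X_lower x) (sq_nonneg t)
    have := mul_le_mul_of_nonneg_right hq (nsq_nonneg x)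
    linarith
  Y_upper x := by
    simp only [nsq_smul_mulVec]
    have := mul_le_mul_of_nonneg_left (G.X_upper x) (sq_nonneg t)
    have := mul_le_mul_of_nonneg_right hQ (nsq_nonneg x)
    linarith

lemma GoodData.inv_det_scaled_le {p : ι → ℝ} {A : ∀ j, Matrix (Fin (d j)) (Fin n) ℝ} {N : ℕ} {η : ℝ}
    {W : ∀ j, Matrix (Fin (d j)) (Fin (d j)) ℝ} {X : Matrix (Fin n) (Fin n) ℝ}
    (G : GoodData p A N η W X) {t b : ℝ} (ht : 0 < t) (hb : 0 < b)
    (h : ∀ W, (∀ j, (W j).det ≠ 0) → (b ^ 2)⁻¹ ≤ Phi p A W) :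
    |(t • X).det|⁻¹ ≤ b * ∏ j, (|(t • W j).det|⁻¹) ^ p j := by
  have hdet : ∀ j, (t • W j).det ≠ 0 := fun j => det_smul_ne_zero ht.ne' (G.det_W j)
  refine inv_det_le_of_Phi_lower (L := A) hb hdet (det_smul_ne_zero ht.ne' G.det_X) ?_ (h _ hdet)
  rw [quadM_smul, G.quad, Matrix.transpose_smul, Matrix.smul_mul, Matrix.mul_smul, smul_smul]

lemma rpow_le_of_mul_le_one {K R s e f : ℝ} (hR : 0 < R) (hR1 : R ≤ 1) (hK : 0 ≤ K)
    (h : K * R ^ s ≤ 1) (hef : f + s ≤ e) : K * R ^ e ≤ R ^ f := by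
  calc K * R ^ e ≤ K * R ^ (f + s) :=
        mul_le_mul_of_nonneg_left (Real.rpow_le_rpow_of_exponent_ge hR hR1 hef) hK
    _ = R ^ f * (K * R ^ s) := by rw [Real.rpow_add hR]; ring
    _ ≤ R ^ f * 1 := mul_le_mul_of_nonneg_left h (Real.rpow_nonneg hR.le _)
    _ = _ := mul_one _

lemma exp_neg_le_inv {x : ℝ} (hx : 0 < x) : Real.exp (-x) ≤ x⁻¹ := by
  rw [Real.exp_neg]
  exact inv_anti₀ hx (by linarith [Real.add_one_le_exp x])

/-- The tail parameter chosen at scale `R`. -/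
lemma two_pow_mul_exp_le {R K : ℝ} (hR : 0 < R) {k : ℕ} (hK : 2 ^ k ≤ K) :
    2 ^ k * Real.exp (-(Real.pi * (R ^ (-5 / 2 - 3 / 256 : ℝ) * (R ^ (5 / 4 : ℝ)) ^ 2) / 2)) ≤
      K * R ^ (3 / 256 : ℝ) := by
  have h1 : R ^ (-5 / 2 - 3 / 256 : ℝ) * (R ^ (5 / 4 : ℝ)) ^ 2 = (R ^ (3 / 256 : ℝ))⁻¹ := by
    rw [← Real.rpow_natCast, ← Real.rpow_mul hR.le, ← Real.rpow_add hR, ← Real.rpow_neg hR.le]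
    norm_num
  have h2 : 0 < R ^ (3 / 256 : ℝ) := Real.rpow_pos_of_pos hR _
  rw [h1]
  refine mul_le_mul hK ((exp_neg_le_inv (by positivity)).trans ?_) (Real.exp_pos _).le
    ((by positivity : (0 : ℝ) ≤ 2 ^ k).trans hK)
  rw [inv_div, div_le_iff₀ (by positivity), mul_comm Real.pi, ← mul_assoc, mul_inv_cancel₀ h2.ne', one_mul]
  linarith [Real.pi_gt_three]

lemma log_term_le {R s : ℝ} (hR : 0 < R) (hR1 : R ≤ 1) (hs : 0 < s) (n : ℕ) :
    Real.log (2 * (2 * (n + 1) * R⁻¹) + 1) ≤ (4 * n + 5 + 1 / s) * R ^ (-s) := by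
  have h0 : 1 ≤ R⁻¹ := (one_le_inv₀ hR).2 hR1
  have h1 : 2 * (2 * (n + 1) * R⁻¹) + 1 ≤ (4 * n + 5) * R⁻¹ := by nlinarith
  have h2 : Real.log (4 * n + 5) ≤ 4 * n + 5 := by
    linarith [Real.log_le_sub_one_of_pos (show (0 : ℝ) < 4 * n + 5 by positivity)]
  have h3 : Real.log R⁻¹ ≤ R⁻¹ ^ s / s := Real.log_le_rpow_div (by positivity) hs
  have h4 : 1 ≤ R ^ (-s) := Real.one_le_rpow_of_pos_of_le_one_of_nonpos hR hR1 (by linarith)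
  rw [Real.inv_rpow hR.le, ← Real.rpow_neg hR.le] at h3
  calc _ ≤ Real.log ((4 * n + 5) * R⁻¹) := Real.log_le_log (by positivity) h1
    _ = Real.log (4 * n + 5) + Real.log R⁻¹ := Real.log_mul (by positivity) (by positivity)
    _ ≤ (4 * n + 5) * 1 + R ^ (-s) / s := by linarith
    _ ≤ (4 * n + 5) * R ^ (-s) + R ^ (-s) / s := by gcongr
    _ = _ := by ring

lemma stepLoss_le (p : ι → ℝ) (hp : ∀ j, 0 < p j) (n : ℕ) (d : ι → ℕ) {H R s K : ℝ} 
    (hR : 0 < R) (hR1 : R ≤ 1) (hs : 0 < s) (hs1 : s ≤ 1 / 4096) (hK : 0 ≤ K) :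
    stepLoss p n d H R (R ^ (16 * s)) (R ^ (-5 / 2 - 5 / 256 : ℝ)) (K * R ^ (3 / 256 : ℝ))
      (2 * (n + 1) * R⁻¹) ≤ (2 * K + Real.pi * (40 * H ^ 2) * ∑ j, p j * d j +
        n * (Real.pi + (4 * n + 5 + 1 / s))) * R ^ (8 * s) := by
  have e1 : R ^ (3 / 256 : ℝ) ≤ R ^ (8 * s) :=
    Real.rpow_le_rpow_of_exponent_ge hR hR1 (by linarith)
  have e2 : R ^ (-5 / 2 - 5 / 256 : ℝ) * R ^ 3 ≤ R ^ (8 * s) := by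
    rw [← Real.rpow_natCast, ← Real.rpow_add hR]
    exact Real.rpow_le_rpow_of_exponent_ge hR hR1 (by norm_num; linarith)
  have e3 : R ^ (16 * s) * (Real.pi + Real.log (2 * (2 * (n + 1) * R⁻¹) + 1)) ≤
      (Real.pi + (4 * n + 5 + 1 / s)) * R ^ (8 * s) := by
    have h4 : 1 ≤ R ^ (-s) := Real.one_le_rpow_of_pos_of_le_one_of_nonpos hR hR1 (by linarith)
    calc _ ≤ R ^ (16 * s) * (Real.pi * R ^ (-s) + (4 * n + 5 + 1 / s) * R ^ (-s)) := by
          refine mul_le_mul_of_nonneg_left (add_le_add ?_ (log_term_le hR hR1 hs n))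
            (Real.rpow_nonneg hR.le _)
          nlinarith [Real.pi_pos]
      _ = (Real.pi + (4 * n + 5 + 1 / s)) * R ^ (15 * s) := by
          rw [show 15 * s = 16 * s + -s by ring, Real.rpow_add hR]; ring
      _ ≤ _ := mul_le_mul_of_nonneg_left
          (Real.rpow_le_rpow_of_exponent_ge hR hR1 (by linarith)) (by positivity)
  have hsum : 0 ≤ ∑ j, p j * d j := Finset.sum_nonneg fun j _ => by have := hp j; positivity
  rw [stepLoss]
  have m1 := mul_le_mul_of_nonneg_left e1 (by positivity : 0 ≤ 2 * K)
  have m2 := mul_le_mul_of_nonneg_left e2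
    (by positivity : 0 ≤ Real.pi * (40 * H ^ 2) * ∑ j, p j * d j)
  have m3 := mul_le_mul_of_nonneg_left e3 (by positivity : (0 : ℝ) ≤ n)
  nlinarith [m1, m2, m3]

end

section
variable {ι : Type*} [Fintype ι] {n : ℕ} {d : ι → ℕ}
variable {p : ι → ℝ} {B : ∀ j, (Fin n → ℝ) → (Fin (d j) → ℝ)}
  {A : (Fin n → ℝ) → ∀ j, Matrix (Fin (d j)) (Fin n) ℝ} {x₀ : Fin n → ℝ} {ρ H : ℝ}

lemma ScaleIneq.mono {lam R C C' : ℝ} (h : ScaleIneq p B x₀ ρ H lam R C) (hC : C ≤ C') :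
    ScaleIneq p B x₀ ρ H lam R C' := fun z hz f hf hft hfl =>
  (h z hz f hf hft hfl).trans (mul_le_mul_left (ENNReal.ofReal_le_ofReal hC) _)

lemma exists_forall_mul_rpow_le_one {K s δ : ℝ} (hK : 0 < K) (hs : 0 < s) (hδ : 0 < δ) :
    ∃ R₀, 0 < R₀ ∧ R₀ ≤ δ ∧ ∀ R, 0 < R → R ≤ R₀ → K * R ^ s ≤ 1 := by
  refine ⟨min δ (K⁻¹ ^ s⁻¹), lt_min hδ (by positivity), min_le_left _ _, fun R hR hR0 => ?_⟩
  have : R ^ s ≤ (K⁻¹ ^ s⁻¹) ^ s :=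
    Real.rpow_le_rpow hR.le (hR0.trans (min_le_right _ _)) hs.le
  rw [Real.rpow_inv_rpow (by positivity) hs.ne'] at this
  calc K * R ^ s ≤ K * K⁻¹ := mul_le_mul_of_nonneg_left this hK.le
    _ = 1 := mul_inv_cancel₀ hK.ne'

set_option maxHeartbeats 1000000 in
/-- Iterating the multiscale inequality from fine scales up to a fixed scale. -/
lemma scaleIneq_family (hp : ∀ j, 0 < p j) (hp1 : ∀ j, p j ≤ 1) (M : LocalModel B A x₀ ρ H)
    {b s R₁ : ℝ} (hb : 0 < b) (hs : 0 < s) (hs1 : s ≤ 1 / 4096) (hR₁ : 0 < R₁)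
    (hS : ∀ R, 0 < R → R ≤ R₁ → ∀ z ∈ Metric.closedBall x₀ ρ, ∃ V Y,
      ScaledData p (A z) (R ^ (16 * s)) (R ^ (-5 / 2 - 3 / 256 : ℝ)) (R ^ (-5 / 2 - 5 / 256 : ℝ)) V Y ∧
      |Y.det|⁻¹ ≤ b * ∏ j, (|(V j).det|⁻¹) ^ p j) :
    ∃ R₀, 0 < R₀ ∧ R₀ ≤ R₁ ∧ ∀ lam, 0 ≤ lam → ∀ R, 0 < R → R ≤ R₀ →
      ScaleIneq p B x₀ ρ H (lam + R ^ (-9 / 8 : ℝ)) R (b * Real.exp (2 * R ^ (4 * s))) := by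
  have hH := M.one_le
  set K : ℝ := 2 ^ n + ∑ j, 2 ^ d j with hKdef
  have hKn : (2 : ℝ) ^ n ≤ K := le_add_of_nonneg_right (by positivity)
  have hKd : ∀ j, (2 : ℝ) ^ d j ≤ K := fun j =>
    (Finset.single_le_sum (f := fun j => (2 : ℝ) ^ d j) (fun _ _ => by positivity)
      (Finset.mem_univ j)).trans (le_add_of_nonneg_left (by positivity))
  have hK : 0 ≤ K := by positivity
  set D : ℝ := ∑ j, (d j : ℝ) with hDdef
  have hDd : ∀ j, (d j : ℝ) ≤ D := fun j =>
    Finset.single_le_sum (f := fun j => (d j : ℝ)) (fun _ _ => by positivity) (Finset.mem_univ j)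
  have hD : 0 ≤ D := by positivity
  have hsum : 0 ≤ ∑ j, p j * d j := Finset.sum_nonneg fun j _ => by have := hp j; positivity
  set K1 : ℝ := ∑ j, p j * (10 * H + 2 * K + Real.pi * (d j * (4 * H ^ 2))) with hK1def
  have hK1 : 0 ≤ K1 := Finset.sum_nonneg fun j _ => by have := hp j; positivity
  set K2 : ℝ := 2 * K + Real.pi * (40 * H ^ 2) * ∑ j, p j * d j +
        n * (Real.pi + (4 * n + 5 + 1 / s)) with hK2def
  have hK2 : 0 ≤ K2 := by positivity
  set K3 : ℝ := Real.pi * (D * (8 * H)) with hK3def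
  have hK3 : 0 ≤ K3 := by positivity
  obtain ⟨R₀, hR₀, hR₀1, hR₀K⟩ := exists_forall_mul_rpow_le_one (K := K1 + K2 + K3 + 2 * K + 2)
    (by positivity) hs (lt_min hR₁ one_pos)
  refine ⟨R₀, hR₀, hR₀1.trans (min_le_left _ _), ?_⟩
  -- facts valid at every admissible scale
  have small : ∀ R, 0 < R → R ≤ R₀ → ∀ K', 0 ≤ K' → K' ≤ K1 + K2 + K3 + 2 * K + 2 →
      ∀ e f, f + s ≤ e → K' * R ^ e ≤ R ^ f := by
    intro R hR hRR K' hK'0 hK' e f hef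
    exact rpow_le_of_mul_le_one hR ((hRR.trans hR₀1).trans (min_le_right _ _)) hK'0
      ((mul_le_mul_of_nonneg_right hK' (Real.rpow_nonneg hR.le _)).trans (hR₀K R hR hRR)) hef
  have facts : ∀ R, 0 < R → R ≤ R₀ → R ≤ 1 ∧ R ≤ R₁ ∧ 2 * R ^ (5 / 4 : ℝ) ≤ R ∧
      K * R ^ (3 / 256 : ℝ) ≤ 1 / 2 ∧
      R ^ (-5 / 2 - 5 / 256 : ℝ) * (n * (2 * R) ^ 2) ≤ (2 * (n + 1) * R⁻¹) ^ 2 ∧ 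
      R ^ (16 * s) ≤ 1 := by
    intro R hR hRR
    have hR1 : R ≤ 1 := (hRR.trans hR₀1).trans (min_le_right _ _)
    refine ⟨hR1, (hRR.trans hR₀1).trans (min_le_left _ _), ?_, ?_, ?_, ?_⟩
    · have := small R hR hRR 2 (by norm_num) (by linarith) (5 / 4) 1 (by linarith)
      rwa [Real.rpow_one] at this
    · have := small R hR hRR (2 * K) (by linarith) (by linarith) (3 / 256) 0 (by linarith)
      rw [Real.rpow_zero] at this
      linarith
    · have h1 : R ^ (-5 / 2 - 5 / 256 : ℝ) * R ^ 2 ≤ R⁻¹ ^ 2 := by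
        rw [← Real.rpow_natCast, ← Real.rpow_natCast, ← Real.rpow_add hR, Real.inv_rpow hR.le,
          ← Real.rpow_neg hR.le]
        exact Real.rpow_le_rpow_of_exponent_ge hR hR1 (by norm_num)
      have h2 := mul_le_mul_of_nonneg_left h1 (by positivity : (0 : ℝ) ≤ 4 * n)
      have h3 : 0 ≤ R⁻¹ ^ 2 := by positivity
      have h4 : 0 ≤ (n : ℝ) * R⁻¹ ^ 2 := by positivity
      have h5 : 0 ≤ (n : ℝ) ^ 2 * R⁻¹ ^ 2 := by positivity
      nlinarith
    · exact Real.rpow_le_one hR.le hR1 (by linarith)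
  intro lam hlam
  have main : ∀ k : ℕ, ∀ R, 0 < R → R ≤ R₀ → lam * R ≤ 2 ^ k →
      ScaleIneq p B x₀ ρ H (lam + R ^ (-9 / 8 : ℝ)) R (b * Real.exp (2 * R ^ (4 * s))) := by
    intro k
    induction k with
    | zero =>
      intro R hR hRR hl
      obtain ⟨hR1, hRR₁, hr, hτ1, hP, hη1⟩ := facts R hR hRR
      have hl1 : lam ≤ R ^ (-9 / 8 : ℝ) := by
        have : lam ≤ R⁻¹ := by rw [← one_div, le_div_iff₀ hR]; simpa using hl
        refine this.trans ?_
        rw [← Real.rpow_neg_one]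
        exact Real.rpow_le_rpow_of_exponent_ge hR hR1 (by norm_num)
      refine (ScaleIneq.base hp hp1 M (Real.rpow_pos_of_pos hR _) hr hb (Real.rpow_pos_of_pos hR _)
        hη1 (Real.rpow_nonneg hR.le _) (Real.rpow_nonneg hR.le _) (hS R hR hRR₁)
        (two_pow_mul_exp_le hR hKn) (fun j => two_pow_mul_exp_le hR (hKd j)) hτ1
        (by positivity) hP (by positivity)).mono ?_
      rw [mul_assoc, ← Real.exp_add]
      refine mul_le_mul_of_nonneg_left (Real.exp_le_exp.2 ?_) hb.le
      have hstep := stepLoss_le (H := H) p hp n d hR hR1 hs hs1 hK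
      have hbase : ∑ j, p j * (5 * (lam + R ^ (-9 / 8 : ℝ)) * H * R ^ (5 / 4 : ℝ) +
          2 * (K * R ^ (3 / 256 : ℝ)) +
          Real.pi * (R ^ (-5 / 2 - 5 / 256 : ℝ) * d j * (4 * H ^ 2 * R ^ 3))) ≤ K1 * R ^ (8 * s) := by
        rw [hK1def, Finset.sum_mul]
        refine Finset.sum_le_sum fun j _ => ?_
        rw [mul_assoc (p j)]
        refine mul_le_mul_of_nonneg_left ?_ (hp j).le
        have e0 : R ^ (-9 / 8 : ℝ) * R ^ (5 / 4 : ℝ) ≤ R ^ (8 * s) := by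
          rw [← Real.rpow_add hR]
          exact Real.rpow_le_rpow_of_exponent_ge hR hR1 (by linarith)
        have e1 : R ^ (3 / 256 : ℝ) ≤ R ^ (8 * s) :=
          Real.rpow_le_rpow_of_exponent_ge hR hR1 (by linarith)
        have e2 : R ^ (-5 / 2 - 5 / 256 : ℝ) * R ^ 3 ≤ R ^ (8 * s) := by
          rw [← Real.rpow_natCast, ← Real.rpow_add hR]
          exact Real.rpow_le_rpow_of_exponent_ge hR hR1 (by norm_num; linarith)
        have f0 : (lam + R ^ (-9 / 8 : ℝ)) * R ^ (5 / 4 : ℝ) ≤ 2 * R ^ (8 * s) := by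
          have := mul_le_mul_of_nonneg_right hl1 (Real.rpow_nonneg hR.le (5 / 4))
          linarith
        have m0 := mul_le_mul_of_nonneg_left f0 (by positivity : 0 ≤ 5 * H)
        have m1 := mul_le_mul_of_nonneg_left e1 (by positivity : 0 ≤ 2 * K)
        have m2 := mul_le_mul_of_nonneg_left e2
          (by positivity : 0 ≤ Real.pi * (d j * (4 * H ^ 2)))
        linarith
      have := small R hR hRR (K1 + K2) (by positivity) (by linarith) (8 * s) (4 * s) (by linarith)
      have := Real.rpow_nonneg hR.le (4 * s)
      linarith
    | succ k ih =>
      intro R hR hRR hl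
      obtain ⟨hR1, hRR₁, hr, hτ1, hP, hη1⟩ := facts R hR hRR
      have hr0 : 0 < R ^ (5 / 4 : ℝ) := Real.rpow_pos_of_pos hR _
      have hrR : R ^ (5 / 4 : ℝ) ≤ R₀ := by linarith
      have hih := ih (R ^ (5 / 4 : ℝ)) hr0 hrR (by
        rw [pow_succ] at hl
        nlinarith [mul_le_mul_of_nonneg_left hr hlam])
      rw [← Real.rpow_mul hR.le, ← Real.rpow_mul hR.le] at hih
      refine (ScaleIneq.step hp hp1 M hr0 hr (Real.rpow_pos_of_pos hR _)
        hη1 (Real.rpow_nonneg hR.le _) (Real.rpow_nonneg hR.le _)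
        (fun z hz => (hS R hR hRR₁ z hz).imp fun V h => h.imp fun Y h => h.1)
        (two_pow_mul_exp_le hR hKn) hτ1 (by positivity) hP (by positivity) (by positivity)
        (fun j => ?_) hih).mono ?_
      · have h1 : R ^ (-5 / 2 - 5 / 256 : ℝ) * R ^ (5 / 4 : ℝ) ≤ R ^ (-5 / 4 - 5 / 256 : ℝ) := by
          rw [← Real.rpow_add hR]
          exact Real.rpow_le_rpow_of_exponent_ge hR hR1 (by norm_num)
        have h2 : R ^ (-9 / 8 : ℝ) ≤ R ^ (-5 / 4 - 5 / 256 : ℝ) :=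
          Real.rpow_le_rpow_of_exponent_ge hR hR1 (by norm_num)
        have h3 := small R hR hRR (K3 + 1) (by positivity) (by linarith) (-5 / 4 - 5 / 256)
          (5 / 4 * (-9 / 8)) (by linarith)
        have h4 : Real.pi * (R ^ (-5 / 2 - 5 / 256 : ℝ) * d j * (2 * (4 * H * R ^ (5 / 4 : ℝ)))) ≤
            K3 * R ^ (-5 / 4 - 5 / 256 : ℝ) := by
          calc _ = Real.pi * (d j * (8 * H)) *
                (R ^ (-5 / 2 - 5 / 256 : ℝ) * R ^ (5 / 4 : ℝ)) := by ring
            _ ≤ K3 * R ^ (-5 / 4 - 5 / 256 : ℝ) := by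
                refine mul_le_mul ?_ h1 (by positivity) hK3
                exact mul_le_mul_of_nonneg_left
                  (mul_le_mul_of_nonneg_right (hDd j) (by positivity)) Real.pi_pos.le
        linarith
      · rw [mul_assoc, ← Real.exp_add]
        refine mul_le_mul_of_nonneg_left (Real.exp_le_exp.2 ?_) hb.le
        have hstep := stepLoss_le (H := H) p hp n d hR hR1 hs hs1 hK
        have h1 := small R hR hRR K2 (by positivity) (by linarith) (8 * s) (4 * s) (by linarith)
        have h2 := small R hR hRR 2 (by norm_num) (by linarith) (5 / 4 * (4 * s)) (4 * s)
          (by linarith)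
        linarith
  intro R hR hRR
  obtain ⟨k, hk⟩ := pow_unbounded_of_one_lt (lam * R) (one_lt_two (α := ℝ))
  exact main k R hR hRR hk.le

end

section
variable {ι : Type*} [Fintype ι] {n : ℕ} {d : ι → ℕ}
variable {p : ι → ℝ} {B : ∀ j, (Fin n → ℝ) → (Fin (d j) → ℝ)}
  {A : (Fin n → ℝ) → ∀ j, Matrix (Fin (d j)) (Fin n) ℝ} {x₀ : Fin n → ℝ} {ρ H : ℝ}

/-- The local inequality for inputs with globally Lipschitz logarithm. -/
lemma local_bound_of_logLip (hp : ∀ j, 0 < p j) (hp1 : ∀ j, p j ≤ 1) (hρ : 0 < ρ)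
    (M : LocalModel B A x₀ ρ H) {b η₀ : ℝ} {N : ℕ} (hb : 0 < b) (hη₀ : 0 < η₀)
    (hA : ∀ z ∈ Metric.closedBall x₀ ρ,
      (∀ W, (∀ j, (W j).det ≠ 0) → (b ^ 2)⁻¹ ≤ Phi p (A z) W) ∧
      ∀ η, 0 < η → η < η₀ → ∃ W X, GoodData p (A z) N η W X) {ε : ℝ} (hε : 0 < ε) :
    ∃ R, 0 < R ∧ R ≤ ρ ∧ ∀ lam, 0 ≤ lam → ∀ f : ∀ j, (Fin (d j) → ℝ) → ℝ≥0∞,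
      (∀ j, Measurable (f j)) → (∀ j u, f j u ≠ ⊤) → (∀ j, LogLip lam Set.univ (f j)) →
      ∫⁻ x in Metric.closedBall x₀ R, ∏ j, f j (B j x) ^ p j ≤
        ENNReal.ofReal (b * (1 + ε)) * ∏ j, (∫⁻ u, f j u) ^ p j := by
  set s : ℝ := 1 / (4096 * (N + 1)) with hsdef
  have hs : 0 < s := by positivity
  have hs1 : s ≤ 1 / 4096 := by
    rw [hsdef]
    exact one_div_le_one_div_of_le (by norm_num) (by linarith [(Nat.cast_nonneg N : (0 : ℝ) ≤ N)])
  have hsN : 16 * s * N ≤ 1 / 256 := by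
    rw [hsdef, ← sub_nonneg]
    have : (1 : ℝ) / 256 - 16 * (1 / (4096 * (N + 1))) * N = 1 / (256 * (N + 1)) := by
      field_simp; ring
    rw [this]; positivity
  obtain ⟨R₁, hR₁, hR₁1, hR₁K⟩ := exists_forall_mul_rpow_le_one (K := 2 / η₀) (s := 16 * s)
    (by positivity) (by positivity) one_pos
  obtain ⟨R₀, hR₀, -, hfam⟩ := scaleIneq_family hp hp1 M hb hs hs1 hR₁ (fun R hR hRR z hz => by
    obtain ⟨hPhi, hG⟩ := hA z hz
    have hR1 := hRR.trans hR₁1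
    have hη : R ^ (16 * s) < η₀ := by
      have := hR₁K R hR hRR
      rw [div_mul_eq_mul_div, div_le_one hη₀] at this
      have := Real.rpow_pos_of_pos hR (16 * s)
      linarith
    obtain ⟨W, X, G⟩ := hG _ (Real.rpow_pos_of_pos hR _) hη
    have ht : 0 < R ^ (-5 / 4 - 2 / 256 : ℝ) := Real.rpow_pos_of_pos hR _
    refine ⟨_, _, G.scaled ht ?_ ?_, G.inv_det_scaled_le ht hb hPhi⟩
    · rw [← Real.rpow_natCast, ← Real.rpow_natCast, ← Real.rpow_mul hR.le, ← Real.rpow_mul hR.le,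
        ← Real.rpow_add hR]
      refine Real.rpow_le_rpow_of_exponent_ge hR hR1 ?_
      push_cast; linarith
    · rw [← Real.rpow_natCast, ← Real.rpow_natCast, ← Real.rpow_mul hR.le, ← Real.rpow_mul hR.le,
        ← Real.rpow_neg hR.le, ← Real.rpow_add hR]
      refine Real.rpow_le_rpow_of_exponent_ge hR hR1 ?_
      push_cast; linarith)
  have hlog : 0 < Real.log (1 + ε) := Real.log_pos (by linarith)
  obtain ⟨R, hR, hRm, hRK⟩ := exists_forall_mul_rpow_le_one (K := 2 / Real.log (1 + ε)) (s := 4 * s)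
    (by positivity) (by positivity) (lt_min hR₀ (by positivity : 0 < ρ / 4))
  have hRρ : 4 * R ≤ ρ := by linarith [hRm.trans (min_le_right _ _)]
  refine ⟨R, hR, by linarith, fun lam hlam f hf hft hfl => ?_⟩
  have hexp : Real.exp (2 * R ^ (4 * s)) ≤ 1 + ε := by
    have := hRK R hR le_rfl
    rw [div_mul_eq_mul_div, div_le_one hlog] at this
    rwa [← Real.le_log_iff_exp_le (by linarith)]
  refine (((hfam lam hlam R hR (hRm.trans (min_le_left _ _))).mono
    (mul_le_mul_of_nonneg_left hexp hb.le)) x₀ (by simpa using hRρ) f hf hft fun j =>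
      (hfl j).mono (le_add_of_nonneg_right (Real.rpow_nonneg hR.le _)) (Set.subset_univ _)).trans ?_
  refine mul_le_mul_right (Finset.prod_le_prod' fun j _ => ?_) _
  exact ENNReal.rpow_le_rpow (setLIntegral_le_lintegral _ _) (hp j).le

end

section
variable {ι : Type*} {n : ℕ} {d : ι → ℕ}

/-- The Jacobian matrices of a family of maps. -/
noncomputable def jacobian (B : ∀ j, (Fin n → ℝ) → (Fin (d j) → ℝ)) (z : Fin n → ℝ) (j : ι) :
    Matrix (Fin (d j)) (Fin n) ℝ :=
  LinearMap.toMatrix' (fderiv ℝ (B j) z : (Fin n → ℝ) →ₗ[ℝ] (Fin (d j) → ℝ))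

lemma jacobian_mulVec (B : ∀ j, (Fin n → ℝ) → (Fin (d j) → ℝ)) (z : Fin n → ℝ) (j : ι)
    (u : Fin n → ℝ) : (jacobian B z j).mulVec u = fderiv ℝ (B j) z u := by
  rw [jacobian, LinearMap.toMatrix'_mulVec]; rfl

lemma continuousAt_jacobian {B : ∀ j, (Fin n → ℝ) → (Fin (d j) → ℝ)} {x₀ : Fin n → ℝ}
    (hB : ∀ j, ContDiffAt ℝ 2 (B j) x₀) : ContinuousAt (jacobian B) x₀ := by
  have hc : ∀ j, ContinuousAt (fderiv ℝ (B j)) x₀ := fun j =>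
    ((hB j).fderiv_right (m := 1) (by norm_num)).continuousAt
  refine continuousAt_pi.2 fun j => continuousAt_pi.2 fun i => continuousAt_pi.2 fun k => ?_
  have h : ContinuousAt (fun z => fderiv ℝ (B j) z (Pi.single k 1) i) x₀ :=
    (continuous_apply i).continuousAt.comp ((hc j).clm_apply continuousAt_const)
  refine h.congr (Filter.Eventually.of_forall fun z => ?_)
  simp [jacobian, LinearMap.toMatrix'_apply]

lemma exists_localModel [Fintype ι] {B : ∀ j, (Fin n → ℝ) → (Fin (d j) → ℝ)} {x₀ : Fin n → ℝ}
    (hB : ∀ j, ContDiffAt ℝ 2 (B j) x₀) {S : Set (∀ j, Matrix (Fin (d j)) (Fin n) ℝ)}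
    (hS : S ∈ nhds (jacobian B x₀)) :
    ∃ ρ, 0 < ρ ∧ ∃ H, ∃ B' : ∀ j, (Fin n → ℝ) → (Fin (d j) → ℝ),
      (∀ j, ∀ x ∈ Metric.closedBall x₀ ρ, B' j x = B j x) ∧
      (∀ z ∈ Metric.closedBall x₀ ρ, jacobian B z ∈ S) ∧
      LocalModel B' (jacobian B) x₀ ρ H := by
  classical
  have hd : ∀ j, ∀ᶠ z in nhds x₀, DifferentiableAt ℝ (B j) z := fun j =>
    ((hB j).eventually (by norm_num)).mono fun z hz => hz.differentiableAt (by norm_num)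
  have hlip : ∀ j, ∃ K : NNReal, ∃ t ∈ nhds x₀, LipschitzOnWith K (fderiv ℝ (B j)) t := fun j =>
    ((hB j).fderiv_right (m := 1) (by norm_num)).exists_lipschitzOnWith
  choose K t ht hK using hlip
  have ht' : ∀ j, ∀ᶠ z in nhds x₀, z ∈ t j := ht
  have hbd : ∀ j, ∀ᶠ z in nhds x₀, ‖fderiv ℝ (B j) z‖ < ‖fderiv ℝ (B j) x₀‖ + 1 := fun j =>
    (((hB j).fderiv_right (m := 1) (by norm_num)).continuousAt.norm).eventually_lt_const
      (lt_add_one _)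
  have hall : ∀ᶠ z in nhds x₀, jacobian B z ∈ S ∧ ∀ j, DifferentiableAt ℝ (B j) z ∧ z ∈ t j ∧
      ‖fderiv ℝ (B j) z‖ < ‖fderiv ℝ (B j) x₀‖ + 1 :=
    ((continuousAt_jacobian hB).eventually hS).and (Filter.eventually_all.2 fun j =>
      (hd j).and ((ht' j).and (hbd j)))
  obtain ⟨ρ, hρ, hball⟩ := Metric.nhds_basis_closedBall.eventually_iff.1 hall
  set H : ℝ := 1 + ∑ j, ((K j : ℝ) + (‖fderiv ℝ (B j) x₀‖ + 1)) with hH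
  have hHj : ∀ j, (K j : ℝ) + (‖fderiv ℝ (B j) x₀‖ + 1) ≤ H := fun j =>
    (Finset.single_le_sum (f := fun j => (K j : ℝ) + (‖fderiv ℝ (B j) x₀‖ + 1))
      (fun _ _ => by positivity) (Finset.mem_univ j)).trans (by rw [hH]; linarith)
  have hHd : ∀ j, ∀ z ∈ Metric.closedBall x₀ ρ, ‖fderiv ℝ (B j) z‖ ≤ H := fun j z hz => by
    have := ((hball hz).2 j).2.2
    have := hHj j

    have h0 : (0 : ℝ) ≤ K j := (K j).2
    linarith
  have hHK : ∀ j, (K j : ℝ) ≤ H := fun j => by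
    have := hHj j
    have := norm_nonneg (fderiv ℝ (B j) x₀)
    linarith
  refine ⟨ρ, hρ, H, fun j => (Metric.closedBall x₀ ρ).piecewise (B j) 0,
    fun j x hx => Set.piecewise_eq_of_mem _ _ _ hx, fun z hz => (hball hz).1, ?_, fun j => ?_, ?_, ?_, ?_⟩
  · rw [hH]
    exact le_add_of_nonneg_right (Finset.sum_nonneg fun j _ => by positivity)
  · refine ContinuousOn.measurable_piecewise (fun z hz =>
      ((hball hz).2 j).1.continuousAt.continuousWithinAt) continuousOn_const
      Metric.isClosed_closedBall.measurableSet
  · intro j x hx y hy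
    rw [Set.piecewise_eq_of_mem _ _ _ hx, Set.piecewise_eq_of_mem _ _ _ hy]
    exact (convex_closedBall x₀ ρ).norm_image_sub_le_of_norm_hasFDerivWithin_le
      (fun z hz => ((hball hz).2 j).1.hasFDerivAt.hasFDerivWithinAt) (hHd j) hy hx
  · intro j z hz u
    rw [jacobian_mulVec]
    exact (ContinuousLinearMap.le_opNorm _ _).trans
      (mul_le_mul_of_nonneg_right (hHd j z hz) (norm_nonneg _))
  · intro j z hz x hx y hy
    rw [Set.piecewise_eq_of_mem _ _ _ hx, Set.piecewise_eq_of_mem _ _ _ hy, jacobian_mulVec]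
    have hseg : segment ℝ y x ⊆ Metric.closedBall x₀ ρ :=
      (convex_closedBall x₀ ρ).segment_subset hy hx
    refine (convex_segment y x).norm_image_sub_le_of_norm_hasFDerivWithin_le'
      (fun w hw => ((hball (hseg hw)).2 j).1.hasFDerivAt.hasFDerivWithinAt) (fun w hw => ?_)
      (left_mem_segment ℝ y x) (right_mem_segment ℝ y x)
    have hwz : ‖w - z‖ ≤ max ‖x - z‖ ‖y - z‖ := by
      have := (convex_closedBall z (max ‖x - z‖ ‖y - z‖)).segment_subset
        (x := y) (y := x) (by simp [dist_eq_norm]) (by simp [dist_eq_norm]) hw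
      rwa [Metric.mem_closedBall, dist_eq_norm] at this
    refine ((hK j).norm_sub_le ((hball (hseg hw)).2 j).2.1 ((hball hz).2 j).2.1).trans ?_
    exact mul_le_mul (hHK j) hwz (norm_nonneg _) ((K j).2.trans (hHK j))

end

section Mollification
variable {k : ℕ}

/-- A kernel with slowly varying logarithm. -/
noncomputable def slowKernel (v : Fin k → ℝ) : ℝ≥0∞ := ENNReal.ofReal ((1 + ‖v‖) ^ (-((k : ℝ) + 1)))

lemma measurable_slowKernel : Measurable (slowKernel (k := k)) := by
  unfold slowKernel; fun_prop

lemma slowKernel_ne_top (v : Fin k → ℝ) : slowKernel v ≠ ⊤ := ENNReal.ofReal_ne_top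

lemma slowKernel_pos (v : Fin k → ℝ) : 0 < slowKernel v :=
  ENNReal.ofReal_pos.2 (Real.rpow_pos_of_pos (by positivity) _)

lemma lintegral_slowKernel_ne_top : ∫⁻ v, slowKernel (k := k) v ≠ ⊤ :=
  (finite_integral_one_add_norm (by simp)).ne

lemma lintegral_slowKernel_ne_zero : ∫⁻ v, slowKernel (k := k) v ≠ 0 := by
  rw [Ne, lintegral_eq_zero_iff measurable_slowKernel]
  intro h
  obtain ⟨x, hx⟩ := h.exists
  exact (slowKernel_pos x).ne' hx

lemma slowKernel_add_le (v e : Fin k → ℝ) :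
    slowKernel (v + e) ≤ ENNReal.ofReal (Real.exp ((k + 1) * ‖e‖)) * slowKernel v := by
  rw [slowKernel, slowKernel, ← ENNReal.ofReal_mul (Real.exp_pos _).le]
  refine ENNReal.ofReal_le_ofReal ?_
  have hv : ‖v‖ ≤ ‖v + e‖ + ‖e‖ := by
    simpa using norm_sub_le (v + e) e
  have h1 : 1 + ‖v‖ ≤ Real.exp ‖e‖ * (1 + ‖v + e‖) := by
    have := Real.add_one_le_exp ‖e‖
    have h0 := norm_nonneg (v + e)
    have h0' := norm_nonneg e
    nlinarith
  have h2 := Real.rpow_le_rpow_of_nonpos (by positivity) h1 (by linarith : -((k : ℝ) + 1) ≤ 0)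
  rw [Real.mul_rpow (Real.exp_pos _).le (by positivity), ← Real.exp_mul] at h2
  have h3 := mul_le_mul_of_nonneg_left h2 (Real.exp_pos (((k : ℝ) + 1) * ‖e‖)).le
  rw [← mul_assoc, ← Real.exp_add] at h3
  have h4 : ((k : ℝ) + 1) * ‖e‖ + ‖e‖ * -((k : ℝ) + 1) = 0 := by ring
  rwa [h4, Real.exp_zero, one_mul] at h3

/-- Mollification at scale `lam⁻¹`. -/
noncomputable def mollify (lam : ℝ) (g : (Fin k → ℝ) → ℝ≥0∞) (u : Fin k → ℝ) : ℝ≥0∞ :=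
  (∫⁻ v, slowKernel (k := k) v)⁻¹ * ∫⁻ v, g (u - lam⁻¹ • v) * slowKernel v

lemma measurable_mollify {lam : ℝ} {g : (Fin k → ℝ) → ℝ≥0∞} (hg : Measurable g) :
    Measurable (mollify lam g) := by
  refine Measurable.const_mul (Measurable.lintegral_prod_right' (f := fun x : (Fin k → ℝ) × (Fin k → ℝ) =>
    g (x.1 - lam⁻¹ • x.2) * slowKernel x.2) ?_) _
  exact (hg.comp (by fun_prop)).mul (measurable_slowKernel.comp measurable_snd)

lemma lintegral_mollify {lam : ℝ} {g : (Fin k → ℝ) → ℝ≥0∞} (hg : Measurable g) :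
    ∫⁻ u, mollify lam g u = ∫⁻ u, g u := by
  have hm : Measurable fun x : (Fin k → ℝ) × (Fin k → ℝ) =>
      g (x.1 - lam⁻¹ • x.2) * slowKernel x.2 :=
    (hg.comp (by fun_prop)).mul (measurable_slowKernel.comp measurable_snd)
  simp only [mollify]
  rw [lintegral_const_mul' _ _ (ENNReal.inv_ne_top.2 lintegral_slowKernel_ne_zero),
    lintegral_lintegral_swap hm.aemeasurable]
  have : ∀ v, ∫⁻ u, g (u - lam⁻¹ • v) * slowKernel v = (∫⁻ u, g u) * slowKernel v := fun v => by
    rw [lintegral_mul_const' _ _ (slowKernel_ne_top v), lintegral_sub_right_eq_self]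
  simp only [this]
  rw [lintegral_const_mul _ measurable_slowKernel, mul_left_comm,
    ENNReal.inv_mul_cancel lintegral_slowKernel_ne_zero lintegral_slowKernel_ne_top, mul_one]

lemma logLip_mollify {lam : ℝ} (hlam : 0 < lam) (g : (Fin k → ℝ) → ℝ≥0∞) :
    LogLip ((k + 1) * lam) Set.univ (mollify lam g) := by
  intro u _ w _
  rw [mollify, mollify, mul_left_comm]
  refine mul_le_mul_right ?_ _
  rw [← lintegral_const_mul' _ _ ENNReal.ofReal_ne_top,
    ← lintegral_add_right_eq_self _ (lam • (u - w))]
  refine lintegral_mono fun v => ?_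
  have h1 : u - lam⁻¹ • (v + lam • (u - w)) = w - lam⁻¹ • v := by
    rw [smul_add, smul_smul, inv_mul_cancel₀ hlam.ne', one_smul]; abel
  simp only [h1]
  rw [mul_left_comm]
  refine mul_le_mul_right ((slowKernel_add_le _ _).trans (le_of_eq ?_)) _
  rw [norm_smul, Real.norm_of_nonneg hlam.le, mul_assoc]

lemma mollify_ne_top {lam : ℝ} (hlam : 0 < lam) {g : (Fin k → ℝ) → ℝ≥0∞} (hg : Measurable g)
    (hgi : ∫⁻ u, g u ≠ ⊤) (u : Fin k → ℝ) : mollify lam g u ≠ ⊤ := by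
  have h := ae_lt_top (measurable_mollify (lam := lam) hg) (by rwa [lintegral_mollify hg])
  obtain ⟨w, hw⟩ := h.exists
  exact ne_top_of_le_ne_top (ENNReal.mul_ne_top ENNReal.ofReal_ne_top hw.ne)
    (logLip_mollify hlam g u trivial w trivial)

lemma le_liminf_mollify {g : (Fin k → ℝ) → ℝ≥0∞} (hg : LowerSemicontinuous g) (u : Fin k → ℝ) :
    g u ≤ Filter.liminf (fun i : ℕ => mollify (i + 1) g u) Filter.atTop := by
  set Z := ∫⁻ v, slowKernel (k := k) v with hZ
  have hZ0 : Z ≠ 0 := lintegral_slowKernel_ne_zero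
  have hZt : Z ≠ ⊤ := lintegral_slowKernel_ne_top
  have hpt : ∀ v : Fin k → ℝ, g u * slowKernel v ≤ Filter.liminf
      (fun i : ℕ => g (u - ((i : ℝ) + 1)⁻¹ • v) * slowKernel v) Filter.atTop := by
    intro v
    have ht : Filter.Tendsto (fun i : ℕ => u - ((i : ℝ) + 1)⁻¹ • v) Filter.atTop (nhds u) := by
      have h := (tendsto_one_div_add_atTop_nhds_zero_nat (𝕜 := ℝ)).smul_const v
      simp only [one_div, zero_smul] at h
      simpa using (tendsto_const_nhds (x := u)).sub h
    have h1 : g u ≤ Filter.liminf (fun i : ℕ => g (u - ((i : ℝ) + 1)⁻¹ • v)) Filter.atTop :=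
      (lowerSemicontinuousAt_iff_le_liminf.1 (hg u)).trans (Filter.liminf_le_liminf_of_le ht)
    refine (mul_le_mul_left h1 _).trans ?_
    rw [ENNReal.liminf_mul_const_of_ne_top (slowKernel_ne_top v), mul_comm]
  calc g u = Z⁻¹ * (g u * Z) := by
        rw [mul_left_comm, ENNReal.inv_mul_cancel hZ0 hZt, mul_one]
    _ = Z⁻¹ * ∫⁻ v, g u * slowKernel v := by rw [lintegral_const_mul _ measurable_slowKernel]
    _ ≤ Z⁻¹ * Filter.liminf (fun i : ℕ => ∫⁻ v, g (u - ((i : ℝ) + 1)⁻¹ • v) * slowKernel v)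
          Filter.atTop := by
        refine mul_le_mul_right ((lintegral_mono hpt).trans (lintegral_liminf_le fun i => ?_)) _
        exact (hg.measurable.comp (by fun_prop)).mul measurable_slowKernel
    _ = _ := by
        rw [← ENNReal.liminf_const_mul_of_ne_top (ENNReal.inv_ne_top.2 hZ0)]; rfl

end Mollification

section
variable {ι : Type*} [Fintype ι] {d : ι → ℕ}

lemma prod_liminf_rpow_le {p : ι → ℝ} (hp : ∀ j, 0 < p j) (h : ι → ℕ → ℝ≥0∞) :
    ∏ j, Filter.liminf (h j) Filter.atTop ^ p j ≤
      Filter.liminf (fun i => ∏ j, h j i ^ p j) Filter.atTop := by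
  classical
  have h1 : ∀ j, Filter.liminf (h j) Filter.atTop ^ p j =
      Filter.liminf (fun i => h j i ^ p j) Filter.atTop := fun j =>
    (ENNReal.orderIsoRpow (p j) (hp j)).liminf_apply
  simp only [h1]
  have : ∀ s : Finset ι, ∏ j ∈ s, Filter.liminf (fun i => h j i ^ p j) Filter.atTop ≤
      Filter.liminf (fun i => ∏ j ∈ s, h j i ^ p j) Filter.atTop := by
    intro s
    induction s using Finset.induction_on with
    | empty => simp
    | insert a s ha ih =>
      simp only [Finset.prod_insert ha]
      exact (mul_le_mul_right ih _).trans ENNReal.le_liminf_mul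
  exact this _

/-- A multilinear integral inequality extends from inputs with Lipschitz logarithm to integrable
inputs. -/
lemma lintegral_prod_le_of_logLip {n : ℕ} {p : ι → ℝ} (hp : ∀ j, 0 < p j)
    {B : ∀ j, (Fin n → ℝ) → (Fin (d j) → ℝ)} (hB : ∀ j, Measurable (B j)) {μ : Measure (Fin n → ℝ)}
    {C : ℝ≥0∞} (hC : C ≠ ⊤)
    (h : ∀ lam, 0 ≤ lam → ∀ f : ∀ j, (Fin (d j) → ℝ) → ℝ≥0∞, (∀ j, Measurable (f j)) →
      (∀ j u, f j u ≠ ⊤) → (∀ j, LogLip lam Set.univ (f j)) →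
      ∫⁻ x, ∏ j, f j (B j x) ^ p j ∂μ ≤ C * ∏ j, (∫⁻ u, f j u) ^ p j)
    (f : ∀ j, (Fin (d j) → ℝ) → ℝ≥0∞) (hf : ∀ j, Measurable (f j))
    (hfi : ∀ j, ∫⁻ u, f j u ≠ ⊤) :
    ∫⁻ x, ∏ j, f j (B j x) ^ p j ∂μ ≤ C * ∏ j, (∫⁻ u, f j u) ^ p j := by
  have key : ∀ δ : ℝ≥0∞, δ ≠ 0 → δ ≠ ⊤ →
      ∫⁻ x, ∏ j, f j (B j x) ^ p j ∂μ ≤ C * ∏ j, ((∫⁻ u, f j u) + δ) ^ p j := by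
    intro δ hδ hδt
    choose g hfg hgl hgi using fun j =>
      exists_le_lowerSemicontinuous_lintegral_ge (μ := (volume : Measure (Fin (d j) → ℝ))) (f j)
        (hf j) hδ
    have hgm : ∀ j, Measurable (g j) := fun j => (hgl j).measurable
    have hgt : ∀ j, ∫⁻ u, g j u ≠ ⊤ := fun j =>
      ne_top_of_le_ne_top (ENNReal.add_ne_top.2 ⟨hfi j, hδt⟩) (hgi j)
    have hpos : ∀ i : ℕ, (0 : ℝ) < (i : ℝ) + 1 := fun i => by positivity
    calc ∫⁻ x, ∏ j, f j (B j x) ^ p j ∂μ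
        ≤ ∫⁻ x, Filter.liminf (fun i : ℕ => ∏ j, mollify (i + 1) (g j) (B j x) ^ p j)
            Filter.atTop ∂μ := by
          refine lintegral_mono fun x => ?_
          refine le_trans (Finset.prod_le_prod' fun j _ => ?_) (prod_liminf_rpow_le hp _)
          exact ENNReal.rpow_le_rpow ((hfg j _).trans (le_liminf_mollify (hgl j) _)) (hp j).le
      _ ≤ Filter.liminf (fun i : ℕ => ∫⁻ x, ∏ j, mollify (i + 1) (g j) (B j x) ^ p j ∂μ)
            Filter.atTop := lintegral_liminf_le fun i => Finset.measurable_prod _ fun j _ =>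
          ((measurable_mollify (hgm j)).comp (hB j)).pow_const _
      _ ≤ C * ∏ j, ((∫⁻ u, f j u) + δ) ^ p j := by
          refine Filter.liminf_le_of_frequently_le' (Filter.Frequently.of_forall fun i => ?_)
          refine (h ((∑ j, ((d j : ℝ) + 1)) * (i + 1)) (by positivity)
            (fun j => mollify (i + 1) (g j)) (fun j => measurable_mollify (hgm j))
            (fun j => mollify_ne_top (hpos i) (hgm j) (hgt j)) fun j =>
              (logLip_mollify (hpos i) (g j)).mono ?_ subset_rfl).trans ?_
          · exact mul_le_mul_of_nonneg_right (Finset.single_le_sum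
              (f := fun j => (d j : ℝ) + 1) (fun _ _ => by positivity) (Finset.mem_univ j))
              (hpos i).le
          · refine mul_le_mul_right (Finset.prod_le_prod' fun j _ => ?_) _
            rw [lintegral_mollify (hgm j)]
            exact ENNReal.rpow_le_rpow (hgi j) (hp j).le
  have hlim : Filter.Tendsto (fun i : ℕ => C * ∏ j, ((∫⁻ u, f j u) + (i : ℝ≥0∞)⁻¹) ^ p j)
      Filter.atTop (nhds (C * ∏ j, (∫⁻ u, f j u) ^ p j)) := by
    refine ENNReal.Tendsto.const_mul (ENNReal.tendsto_finsetProd_of_ne_top _ (fun j _ => ?_)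
      fun j _ => ENNReal.rpow_ne_top_of_nonneg (hp j).le (hfi j)) (Or.inr hC)
    refine (ENNReal.continuous_rpow_const.tendsto _).comp ?_
    simpa using (tendsto_const_nhds (x := ∫⁻ u, f j u)).add ENNReal.tendsto_inv_nat_nhds_zero
  refine ge_of_tendsto hlim (Filter.eventually_atTop.2 ⟨1, fun i hi => key _ (by simp) ?_⟩)
  rw [Ne, ENNReal.inv_eq_top]
  exact_mod_cast (by omega : i ≠ 0)

end

/-- Submersions locally pull null sets back to null sets. -/
lemma exists_nhds_preimage_null {n k : ℕ} {B : (Fin n → ℝ) → (Fin k → ℝ)} {x₀ : Fin n → ℝ}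
    {L : (Fin n → ℝ) →L[ℝ] (Fin k → ℝ)} (hB : HasStrictFDerivAt B L x₀)
    (hL : Function.Surjective L) :
    ∃ s ∈ nhds x₀, ∀ E : Set (Fin k → ℝ), volume E = 0 → volume (s ∩ B ⁻¹' E) = 0 := by
  obtain ⟨σ, hσ⟩ := (L : (Fin n → ℝ) →ₗ[ℝ] (Fin k → ℝ)).exists_rightInverse_of_surjective
    (LinearMap.range_eq_top.2 hL)
  have hLσ : ∀ u, L (σ u) = u := fun u => LinearMap.congr_fun hσ u
  set S : (Fin k → ℝ) →L[ℝ] (Fin n → ℝ) := LinearMap.toContinuousLinearMap σ with hSdef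
  set Ψ : (Fin n → ℝ) → (Fin n → ℝ) := fun x => x - S (L x) + S (B x) with hΨdef
  have hΨ : HasStrictFDerivAt Ψ (ContinuousLinearMap.id ℝ (Fin n → ℝ)) x₀ := by
    have h := ((hasStrictFDerivAt_id (𝕜 := ℝ) x₀).sub ((S.comp L).hasStrictFDerivAt (x := x₀))).add
      (S.hasStrictFDerivAt.comp x₀ hB)
    rwa [sub_add_cancel] at h
  have hLΨ : ∀ x, L (Ψ x) = B x := fun x => by
    have h1 : ∀ u, L (S u) = u := hLσ
    simp only [hΨdef, map_add, map_sub, h1, sub_self, zero_add]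
  obtain ⟨s, hs, hap⟩ := hΨ.approximates_deriv_on_nhds (c := 1 / 2) (Or.inr (by norm_num))
  have hexp : ∀ x ∈ s, ∀ y ∈ s, ‖x - y‖ ≤ 2 * ‖Ψ x - Ψ y‖ := by
    intro x hx y hy
    have h := hap x hx y hy
    rw [ContinuousLinearMap.id_apply] at h
    have h2 := norm_sub_norm_le (x - y) (Ψ x - Ψ y)
    rw [norm_sub_rev (x - y)] at h2
    push_cast at h
    linarith
  refine ⟨s, hs, fun E hE => ?_⟩
  have hLE : volume (L ⁻¹' E) = 0 := by
    have h := (ae_comp_linearMap_mem_iff (L : (Fin n → ℝ) →ₗ[ℝ] (Fin k → ℝ)) volume volume hL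
      (measurableSet_toMeasurable volume E).compl).2
      (measure_eq_zero_iff_ae_notMem.1 (by rwa [measure_toMeasurable]))
    refine measure_mono_null (Set.preimage_mono (subset_toMeasurable volume E)) ?_
    exact measure_eq_zero_iff_ae_notMem.2 h
  have hlip : LipschitzOnWith 2 (Function.invFunOn Ψ s) (Ψ '' s) := by
    refine LipschitzOnWith.of_dist_le_mul fun u hu v hv => ?_
    rw [dist_eq_norm, dist_eq_norm]
    have h := hexp _ (Function.invFunOn_mem hu) _ (Function.invFunOn_mem hv)
    rwa [Function.invFunOn_eq hu, Function.invFunOn_eq hv] at h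
  have hinj : Set.InjOn Ψ s := fun x hx y hy hxy => by
    have h := hexp x hx y hy
    rw [hxy, sub_self, norm_zero, mul_zero] at h
    exact sub_eq_zero.1 (norm_eq_zero.1 (le_antisymm h (norm_nonneg _)))
  have hsub : s ∩ B ⁻¹' E ⊆ Function.invFunOn Ψ s '' (Ψ '' s ∩ L ⁻¹' E) := by
    rintro x ⟨hx, hxE⟩
    exact ⟨Ψ x, ⟨⟨x, hx, rfl⟩, by rwa [Set.mem_preimage, hLΨ]⟩, hinj.leftInvOn_invFunOn hx⟩
  refine measure_mono_null hsub ?_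
  have h := (hlip.mono (Set.inter_subset_left (t := L ⁻¹' E))).hausdorffMeasure_image_le
    (d := (Fintype.card (Fin n) : ℝ)) (Nat.cast_nonneg _)
  rw [hausdorffMeasure_pi_real, measure_mono_null Set.inter_subset_right hLE, mul_zero] at h
  exact le_antisymm h zero_le

/-- The local inequality with constant arbitrarily close to a constant admissible for Gaussians. -/
lemma local_bound_of_gaussian {ι : Type*} [Fintype ι] {n : ℕ} {d : ι → ℕ} {p : ι → ℝ}
    (hp : ∀ j, 0 < p j) (hp1 : ∀ j, p j ≤ 1) {B : ∀ j, (Fin n → ℝ) → (Fin (d j) → ℝ)}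
    {x₀ : Fin n → ℝ} (hB : ∀ j, ContDiffAt ℝ 2 (B j) x₀) {b : ℝ} (hb : 0 < b)
    (hG : ∀ W : ∀ j, Matrix (Fin (d j)) (Fin (d j)) ℝ, (∀ j, (W j).det ≠ 0) →
      ∫⁻ x, ∏ j, gam ((W j).mulVec ((jacobian B x₀ j).mulVec x)) ^ p j ≤
        ENNReal.ofReal b * ∏ j, (∫⁻ u, gam ((W j).mulVec u)) ^ p j) {ε : ℝ} (hε : 0 < ε) :
    ∃ R, 0 < R ∧ ∀ f : ∀ j, (Fin (d j) → ℝ) → ℝ≥0∞, (∀ j, Measurable (f j)) →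
      (∀ j, ∫⁻ u, f j u ≠ ⊤) →
      ∫⁻ x in Metric.closedBall x₀ R, ∏ j, f j (B j x) ^ p j ≤
        ENNReal.ofReal ((1 + ε) * b) * ∏ j, (∫⁻ u, f j u) ^ p j := by
  obtain ⟨e, he, he1, hee⟩ : ∃ e : ℝ, 0 < e ∧ e ≤ 1 ∧ 3 * e ≤ ε :=
    ⟨min 1 (ε / 3), by positivity, min_le_left _ _, by linarith [min_le_right 1 (ε / 3)]⟩
  set b' : ℝ := b * (1 + e) with hb'
  have hb'0 : 0 < b' := by positivity
  have hlt : (b' ^ 2)⁻¹ < (b ^ 2)⁻¹ := by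
    refine inv_strictAnti₀ (by positivity) (pow_lt_pow_left₀ ?_ hb.le two_ne_zero)
    nlinarith
  obtain ⟨N, η₀, hη₀, -, hev⟩ := exists_goodData (L₀ := jacobian B x₀) (m := (b ^ 2)⁻¹)
    (θ := (b ^ 2)⁻¹ - (b' ^ 2)⁻¹) hp hp1 (by linarith)
    (by have : 0 < (b' ^ 2)⁻¹ := by positivity
        linarith) (fun W hW => Phi_lower_of_gaussian hp hb hW (hG W hW))
  simp only [sub_sub_cancel] at hev
  obtain ⟨ρ, hρ, H, B', hBB', hmem, M⟩ := exists_localModel hB hev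
  obtain ⟨R, hR, hRρ, hloc⟩ := local_bound_of_logLip hp hp1 hρ M hb'0 hη₀ hmem he
  refine ⟨R, hR, fun f hf hfi => ?_⟩
  have h := lintegral_prod_le_of_logLip hp M.meas ENNReal.ofReal_ne_top hloc f hf hfi
  have hcongr : ∫⁻ x in Metric.closedBall x₀ R, ∏ j, f j (B j x) ^ p j =
      ∫⁻ x in Metric.closedBall x₀ R, ∏ j, f j (B' j x) ^ p j :=
    setLIntegral_congr_fun Metric.isClosed_closedBall.measurableSet fun x hx => by
      refine Finset.prod_congr rfl fun j _ => ?_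
      rw [hBB' j x (Metric.closedBall_subset_closedBall hRρ hx)]
  rw [hcongr]
  refine h.trans (mul_le_mul_left (ENNReal.ofReal_le_ofReal ?_) _)
  rw [hb', mul_assoc, mul_comm]
  refine mul_le_mul_of_nonneg_right ?_ hb.le
  nlinarith

lemma prod_eq_prod_pos {m : ℕ} {p : Fin m → ℝ} (hp : ∀ j, 0 ≤ p j) (F : Fin m → ℝ≥0∞) :
    ∏ j, F j ^ p j = ∏ j : {j // 0 < p j}, F j ^ p j := by
  rw [← Finset.prod_subtype (Finset.univ.filter fun j => 0 < p j) (by simp) fun j => F j ^ p j]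
  refine (Finset.prod_filter_of_ne fun j _ hj => (hp j).lt_of_ne' fun h => hj ?_).symm
  rw [h, ENNReal.rpow_zero]

lemma lintegral_le_BLconst_mul {m n : ℕ} {nj : Fin m → ℕ}
    {L : ∀ j, (Fin n → ℝ) →L[ℝ] (Fin (nj j) → ℝ)} {p : Fin m → ℝ}
    {f : ∀ j, (Fin (nj j) → ℝ) → ℝ≥0∞} (hf : ∀ j, Measurable (f j))
    (h0 : ∏ j, (∫⁻ u, f j u) ^ p j ≠ 0) (ht : ∏ j, (∫⁻ u, f j u) ^ p j ≠ ⊤) :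
    ∫⁻ x, ∏ j, f j (L j x) ^ p j ≤ BLconst nj L p * ∏ j, (∫⁻ u, f j u) ^ p j := by
  rw [← ENNReal.div_le_iff h0 ht]
  exact le_sInf fun C hC => (ENNReal.div_le_iff h0 ht).2 (hC f hf)

lemma lintegral_gaussian_le {m n : ℕ} {nj : Fin m → ℕ}
    {L : ∀ j, (Fin n → ℝ) →L[ℝ] (Fin (nj j) → ℝ)} {p : Fin m → ℝ} (hp : ∀ j, 0 ≤ p j)
    {W : ∀ j, Matrix (Fin (nj j)) (Fin (nj j)) ℝ} (hW : ∀ j, (W j).det ≠ 0) :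
    ∫⁻ x, ∏ j, gam ((W j).mulVec (L j x)) ^ p j ≤
      BLconst nj L p * ∏ j, (∫⁻ u, gam ((W j).mulVec u)) ^ p j := by
  have hpos : ∀ j, 0 < |(W j).det|⁻¹ := fun j => inv_pos.2 (abs_pos.2 (hW j))
  refine lintegral_le_BLconst_mul (f := fun j u => gam ((W j).mulVec u))
    (fun j => measurable_gam.comp
      (by fun_prop : Continuous fun u => (W j).mulVec u).measurable) ?_ ?_
  · refine Finset.prod_ne_zero_iff.2 fun j _ => ?_
    rw [lintegral_gam_mulVec (hW j), ENNReal.ofReal_rpow_of_pos (hpos j)]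
    exact (ENNReal.ofReal_pos.2 (Real.rpow_pos_of_pos (hpos j) _)).ne'
  · refine ENNReal.prod_ne_top fun j _ => ENNReal.rpow_ne_top_of_nonneg (hp j) ?_
    rw [lintegral_gam_mulVec (hW j)]
    exact ENNReal.ofReal_ne_top

lemma BLconst_ne_zero {m n : ℕ} {nj : Fin m → ℕ}
    {L : ∀ j, (Fin n → ℝ) →L[ℝ] (Fin (nj j) → ℝ)} {p : Fin m → ℝ} (hp : ∀ j, 0 ≤ p j) :
    BLconst nj L p ≠ 0 := by
  intro h
  have h1 := lintegral_gaussian_le (L := L) hp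
    (W := fun j => (1 : Matrix (Fin (nj j)) (Fin (nj j)) ℝ)) (fun j => by simp)
  have hm : Measurable fun x => ∏ j,
      gam ((1 : Matrix (Fin (nj j)) (Fin (nj j)) ℝ).mulVec (L j x)) ^ p j :=
    Finset.measurable_fun_prod _ fun j _ => (measurable_gam.comp (by fun_prop : Continuous fun x =>
      (1 : Matrix (Fin (nj j)) (Fin (nj j)) ℝ).mulVec (L j x)).measurable).pow_const _
  rw [h, zero_mul, nonpos_iff_eq_zero, lintegral_eq_zero_iff hm] at h1
  obtain ⟨x, hx⟩ := h1.exists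
  refine Finset.prod_ne_zero_iff.2 (fun j _ => ?_) hx
  exact (ENNReal.rpow_pos (pos_iff_ne_zero.2 (gam_ne_zero _)) (gam_ne_top _)).ne'

end NLBL

open NLBL in
/-- **Theorem (nonlinear Brascamp–Lieb inequality).**
Let `(L,p)` be a Brascamp–Lieb datum (`L_j : ℝ^n → ℝ^{n_j}` linear surjections,
`p_j ∈ [0,1]`).  Suppose `B_j : ℝ^n → ℝ^{n_j}` are `C²` submersions in a neighbourhood of
`x₀` with `dB_j(x₀) = L_j`.  Then for every `ε > 0` there is a neighbourhood `U` of `x₀`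
such that for all nonnegative integrable `f_j`,
`∫_U ∏_j f_j(B_j x)^{p_j} dx ≤ (1+ε) · BL(L,p) · ∏_j (∫ f_j)^{p_j}`. -/
theorem nonlinear_brascamp_lieb
    {m n : ℕ} (nj : Fin m → ℕ)
    (L : ∀ j, (Fin n → ℝ) →L[ℝ] (Fin (nj j) → ℝ)) (p : Fin m → ℝ)
    (hp : ∀ j, p j ∈ Set.Icc (0 : ℝ) 1)
    (hL : ∀ j, Function.Surjective (L j))
    (B : ∀ j, (Fin n → ℝ) → (Fin (nj j) → ℝ)) (x₀ : Fin n → ℝ)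
    (hB : ∀ j, ∃ V ∈ nhds x₀, IsOpen V ∧ ContDiffOn ℝ 2 (B j) V ∧
      ∀ x ∈ V, Function.Surjective (fderiv ℝ (B j) x))
    (hdB : ∀ j, fderiv ℝ (B j) x₀ = L j) :
    ∀ ε > (0 : ℝ), ∃ U ∈ nhds x₀,
      ∀ f : ∀ j, (Fin (nj j) → ℝ) → ℝ≥0∞, (∀ j, Measurable (f j)) →
        ∫⁻ x in U, ∏ j, (f j (B j x)) ^ (p j)
          ≤ ENNReal.ofReal (1 + ε) * BLconst nj L p * ∏ j, (∫⁻ xj, f j xj) ^ (p j) := by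
  intro ε hε
  have hp0 : ∀ j, 0 ≤ p j := fun j => (hp j).1
  have hC : ∀ j, ContDiffAt ℝ 2 (B j) x₀ := fun j => by
    obtain ⟨V, hV, -, hBV, -⟩ := hB j
    exact hBV.contDiffAt hV
  have hBL0 := BLconst_ne_zero (L := L) hp0
  have hnull : ∀ j, ∃ s ∈ nhds x₀, ∀ E : Set (Fin (nj j) → ℝ), volume E = 0 →
      volume (s ∩ B j ⁻¹' E) = 0 := fun j => by
    refine exists_nhds_preimage_null (L := L j) ?_ (hL j)
    rw [← hdB j]
    exact (hC j).hasStrictFDerivAt (by norm_num)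
  choose s hs hsnull using hnull
  have hfinite : ∃ U ∈ nhds x₀, BLconst nj L p ≠ ⊤ →
      ∀ f : ∀ j, (Fin (nj j) → ℝ) → ℝ≥0∞, (∀ j, Measurable (f j)) →
        (∀ j, 0 < p j → ∫⁻ u, f j u ≠ ⊤) →
        ∫⁻ x in U, ∏ j, (f j (B j x)) ^ (p j)
          ≤ ENNReal.ofReal (1 + ε) * BLconst nj L p * ∏ j, (∫⁻ xj, f j xj) ^ (p j) := by
    by_cases hBL : BLconst nj L p = ⊤
    · exact ⟨Set.univ, Filter.univ_mem, fun h => absurd hBL h⟩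
    obtain ⟨R, hR, hloc⟩ := local_bound_of_gaussian (ι := {j // 0 < p j}) (p := fun j => p j)
      (B := fun j => B j) (x₀ := x₀) (fun j => j.2) (fun j => (hp j).2) (fun j => hC j)
      (b := (BLconst nj L p).toReal) (ENNReal.toReal_pos hBL0 hBL) (fun W hW => by
        classical
        have h := lintegral_gaussian_le (L := L) hp0
          (W := fun j => if h : 0 < p j then W ⟨j, h⟩ else 1) (fun j => by
            split_ifs with h
            · exact hW _
            · simp)
        rw [ENNReal.ofReal_toReal hBL]
        simp only [prod_eq_prod_pos hp0] at h
        convert h using 4 with x j _ j _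
        · rw [dif_pos j.2, jacobian_mulVec, hdB]
        · rw [dif_pos j.2]) hε
    refine ⟨_, Metric.closedBall_mem_nhds x₀ hR, fun _ f hf hfi => ?_⟩
    have h := hloc (fun j => f j) (fun j => hf j) fun j => hfi j j.2
    rw [ENNReal.ofReal_mul (by linarith), ENNReal.ofReal_toReal hBL] at h
    simpa only [prod_eq_prod_pos hp0] using h
  obtain ⟨U, hU, hUf⟩ := hfinite
  obtain ⟨r, hr, hrsub⟩ := Metric.nhds_basis_closedBall.mem_iff.1
    (Filter.inter_mem hU (Filter.iInter_mem.2 hs))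
  refine ⟨_, Metric.closedBall_mem_nhds x₀ hr, fun f hf => ?_⟩
  by_cases hz : ∃ j, 0 < p j ∧ ∫⁻ u, f j u = 0
  · obtain ⟨j, hj, hfj⟩ := hz
    rw [lintegral_eq_zero_iff (hf j)] at hfj
    have hE : volume {u | f j u ≠ 0} = 0 := hfj
    have hae : ∀ᵐ x ∂volume.restrict (Metric.closedBall x₀ r), ∏ j, (f j (B j x)) ^ (p j) = 0 := by
      rw [ae_restrict_iff' Metric.isClosed_closedBall.measurableSet, ae_iff]
      refine measure_mono_null (fun x hx => ?_) (hsnull j _ hE)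
      simp only [Set.mem_ofPred_eq, Classical.not_imp] at hx
      refine ⟨Set.mem_iInter.1 (hrsub hx.1).2 j, fun h0 => hx.2 ?_⟩
      refine Finset.prod_eq_zero (Finset.mem_univ j) ?_
      rw [h0, ENNReal.zero_rpow_of_pos hj]
    rw [lintegral_congr_ae hae, lintegral_zero]
    exact zero_le
  · push Not at hz
    by_cases htop : BLconst nj L p ≠ ⊤ ∧ ∀ j, 0 < p j → ∫⁻ u, f j u ≠ ⊤
    · exact (lintegral_mono_set (hrsub.trans Set.inter_subset_left)).trans
        (hUf htop.1 f hf htop.2)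
    · have hε0 : ENNReal.ofReal (1 + ε) ≠ 0 := (ENNReal.ofReal_pos.2 (by linarith)).ne'
      have hfac : ∀ j, (∫⁻ u, f j u) ^ p j ≠ 0 := fun j h => by
        rcases (hp0 j).lt_or_eq with hj | hj
        · exact hz j hj ((ENNReal.rpow_eq_zero_iff_of_pos hj).1 h)
        · rw [← hj, ENNReal.rpow_zero] at h
          exact one_ne_zero h
      suffices h : ENNReal.ofReal (1 + ε) * BLconst nj L p * ∏ j, (∫⁻ u, f j u) ^ p j = ⊤ by
        rw [h]; exact le_top
      by_cases hBL : BLconst nj L p = ⊤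
      · rw [hBL, ENNReal.mul_top hε0, ENNReal.top_mul (Finset.prod_ne_zero_iff.2 fun j _ => hfac j)]
      · obtain ⟨j, hj, hfj⟩ : ∃ j, 0 < p j ∧ ∫⁻ u, f j u = ⊤ := by
          by_contra! hcon
          exact htop ⟨hBL, hcon⟩
        rw [← Finset.mul_prod_erase _ _ (Finset.mem_univ j), hfj, ENNReal.top_rpow_of_pos hj,
          ENNReal.top_mul (Finset.prod_ne_zero_iff.2 fun j _ => hfac j),
          ENNReal.mul_top (mul_ne_zero hε0 hBL0)]
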